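/- arXiv:1912.08250 — 2 statements merged into one kernel-verified Lean document; each statement's English description precedes it below -/
import Mathlib

section
/- Let α > 0 and p = 4. The set e^{−1/(4α)}Γ = {e^{−1/(4α)} γ_n : n ≥ 0} is a complete interpolating sequence for F^4_φ if and only if the following three conditions hold: (a) Γ is d_ρ-separated; (b) the sequence (δ_n)_{n≥0} is bounded; (c) there exists an integer N ≥ 1 such that −1/(4α) < ∇_N ≤ Δ_N < 1/(4α). -/
open MeasureTheory Complex
open scoped ENNReal

noncomputable section

/-- `log⁺ t = max (log t) 0`. -/
def logPlus (t : ℝ) : ℝ := max (Real.log t) 0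

/-- The weight `φ(z) = α (log⁺ |z|)²`. -/
def phi (α : ℝ) (z : ℂ) : ℝ := α * (logPlus ‖z‖) ^ 2

/-- `‖f‖_{p,φ}^p = ∫_ℂ |f(z) e^{-φ(z)}|^p dm(z)` as an extended nonnegative real. -/
def fockNormP (α p : ℝ) (f : ℂ → ℂ) : ℝ≥0∞ :=
  ∫⁻ z : ℂ, ENNReal.ofReal ((‖f z‖ * Real.exp (-(phi α z))) ^ p)

/-- Membership in the Fock space `F^p_φ`: entire and finite norm. -/
def MemFock (α p : ℝ) (f : ℂ → ℂ) : Prop :=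
  Differentiable ℂ f ∧ fockNormP α p f < ⊤

/-- The discrete norm `‖f‖_{p,φ,Λ}^p = Σ_{λ∈Λ} (1+|λ|)² |f(λ)|^p e^{-pφ(λ)}`. -/
def discNormP (α p : ℝ) (Λ : Set ℂ) (f : ℂ → ℂ) : ℝ≥0∞ :=
  ∑' lam : Λ, ENNReal.ofReal
    ((1 + ‖(lam : ℂ)‖) ^ 2 * ‖f (lam : ℂ)‖ ^ p *
      Real.exp (-(p * phi α (lam : ℂ))))

/-- `Λ` is sampling for `F^p_φ`. -/
def Sampling (α p : ℝ) (Λ : Set ℂ) : Prop :=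
  ∃ C : ℝ, 1 ≤ C ∧ ∀ f : ℂ → ℂ, MemFock α p f →
    (ENNReal.ofReal C)⁻¹ * fockNormP α p f ≤ discNormP α p Λ f ∧
    discNormP α p Λ f ≤ ENNReal.ofReal C * fockNormP α p f

/-- `Λ` is interpolating for `F^p_φ`. -/
def Interpolating (α p : ℝ) (Λ : Set ℂ) : Prop :=
  ∀ v : ℂ → ℂ,
    (∑' lam : Λ, ENNReal.ofReal
      ((1 + ‖(lam : ℂ)‖) ^ 2 * ‖v (lam : ℂ)‖ ^ p *
        Real.exp (-(p * phi α (lam : ℂ))))) < ⊤ →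
    ∃ f : ℂ → ℂ, MemFock α p f ∧ ∀ lam ∈ Λ, f lam = v lam

/-- `Λ` is a complete interpolating sequence for `F^p_φ`. -/
def CompleteInterpolating (α p : ℝ) (Λ : Set ℂ) : Prop :=
  Sampling α p Λ ∧ Interpolating α p Λ

/-- `ρ(z) = |z| / √(2α)`. -/
def rhoF (α : ℝ) (z : ℂ) : ℝ := ‖z‖ / Real.sqrt (2 * α)

/-- `d_ρ(z,w) = |z-w| / (1 + min(ρ(z), ρ(w)))`. -/
def dRho (α : ℝ) (z w : ℂ) : ℝ :=
  ‖z - w‖ / (1 + min (rhoF α z) (rhoF α w))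

/-- `Λ` is `d_ρ`-separated. -/
def DRhoSeparated (α : ℝ) (Λ : Set ℂ) : Prop :=
  ∃ ε : ℝ, 0 < ε ∧ ∀ l ∈ Λ, ∀ l' ∈ Λ, l ≠ l' → ε ≤ dRho α l l'

/-- The average `(1/N) Σ_{k=n}^{n+N-1} δ_k`. -/
def avgD (δ : ℕ → ℝ) (N n : ℕ) : ℝ := (1 / (N : ℝ)) * ∑ k ∈ Finset.range N, δ (n + k)



/-- exponential kernel -/
def kap (a u : ℝ) : ℝ≥0∞ := ENNReal.ofReal (Real.exp (-(a * |u|)))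

lemma kern_sum (a : ℝ) (ha : 0 < a) :
    ∃ G : NNReal, ∀ t : ℝ, ∑' n : ℕ, kap a (t - n) ≤ G := by
  have hs : Summable (fun m : ℤ => Real.exp (-(a * |(m : ℝ)|))) := by
    have h1 : Summable (fun n : ℕ => Real.exp (-(a * n))) := by
      have : (fun n : ℕ => Real.exp (-(a * n))) = fun n : ℕ => (Real.exp (-a)) ^ n := by
        ext n; rw [← Real.exp_nat_mul]; congr 1; ring
      rw [this]
      apply summable_geometric_of_lt_one (Real.exp_pos _).le
      rw [Real.exp_lt_one_iff]; linarith
    apply Summable.of_nat_of_neg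
    · simpa using h1
    · simpa using h1
  have hfin : ∑' m : ℤ, ENNReal.ofReal (Real.exp (-(a * |(m : ℝ)|))) ≠ ⊤ := by
    rw [← ENNReal.ofReal_tsum_of_nonneg (fun _ => (Real.exp_pos _).le) hs]
    exact ENNReal.ofReal_ne_top
  refine ⟨(ENNReal.ofReal (Real.exp a) * ∑' m : ℤ, ENNReal.ofReal (Real.exp (-(a * |(m : ℝ)|)))).toNNReal, fun t => ?_⟩
  rw [ENNReal.coe_toNNReal (ENNReal.mul_ne_top ENNReal.ofReal_ne_top hfin)]
  calc ∑' n : ℕ, kap a (t - n)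
      ≤ ∑' n : ℕ, ENNReal.ofReal (Real.exp a) * ENNReal.ofReal (Real.exp (-(a * |((((n : ℤ) - ⌊t⌋ : ℤ)) : ℝ)|))) := by
        apply ENNReal.tsum_le_tsum
        intro n
        rw [kap, ← ENNReal.ofReal_mul (Real.exp_pos _).le, ← Real.exp_add]
        apply ENNReal.ofReal_le_ofReal
        apply Real.exp_le_exp.2
        push_cast
        have h1 := Int.floor_le t
        have h2 := Int.lt_floor_add_one t
        have h3 : |(n : ℝ) - ⌊t⌋| ≤ |t - n| + 1 := by
          have h4 : |t - ⌊t⌋| ≤ 1 := by rw [abs_le]; constructor <;> linarith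
          calc |(n : ℝ) - ⌊t⌋| = |(t - ⌊t⌋) - (t - n)| := by congr 1; ring
            _ ≤ |t - ⌊t⌋| + |t - n| := abs_sub _ _
            _ ≤ _ := by linarith
        nlinarith
    _ = ENNReal.ofReal (Real.exp a) * ∑' n : ℕ, ENNReal.ofReal (Real.exp (-(a * |((((n : ℤ) - ⌊t⌋ : ℤ)) : ℝ)|))) := ENNReal.tsum_mul_left
    _ ≤ _ := by
        gcongr
        exact ENNReal.tsum_comp_le_tsum_of_injective (f := fun n : ℕ => ((n : ℤ) - ⌊t⌋))
          (fun x y h => by simpa using h) (fun m : ℤ => ENNReal.ofReal (Real.exp (-(a * |(m : ℝ)|))))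

lemma gauss_le_exp (β a : ℝ) (hβ : 0 < β) (u : ℝ) :
    Real.exp (-(β * u ^ 2 / 2)) ≤ Real.exp (a ^ 2 / (2 * β)) * Real.exp (-(a * |u|)) := by
  rw [← Real.exp_add]
  apply Real.exp_le_exp.2
  have h : 0 ≤ (β * |u| - a) ^ 2 / (2 * β) := by positivity
  have h2 : (β * |u| - a) ^ 2 / (2 * β) = β * u ^ 2 / 2 - a * |u| + a ^ 2 / (2 * β) := by
    rw [sub_sq, mul_pow, sq_abs]; field_simp
  linarith

lemma holder4 {ι : Type*} (K x : ι → ℝ≥0∞) :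
    (∑' i, K i * x i) ^ 4 ≤ (∑' i, K i) ^ 3 * ∑' i, K i * x i ^ 4 := by
  have key : ∀ s : Finset ι, (∑ i ∈ s, K i * x i) ^ 4 ≤ (∑' i, K i) ^ 3 * ∑' i, K i * x i ^ 4 := by
    intro s
    have h := ENNReal.inner_le_weight_mul_Lp_of_nonneg s (p := 4) (by norm_num) K x
    have h2 : (∑ i ∈ s, K i * x i) ^ 4 ≤ (∑ i ∈ s, K i) ^ 3 * ∑ i ∈ s, K i * x i ^ 4 := by
      calc (∑ i ∈ s, K i * x i) ^ 4 ≤ ((∑ i ∈ s, K i) ^ (1 - (4:ℝ)⁻¹) * (∑ i ∈ s, K i * x i ^ (4:ℝ)) ^ (4:ℝ)⁻¹) ^ 4 := by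
            gcongr
        _ = _ := by
            rw [mul_pow, ← ENNReal.rpow_natCast, ← ENNReal.rpow_natCast, ← ENNReal.rpow_mul, ← ENNReal.rpow_mul]
            norm_num
    refine h2.trans ?_
    gcongr
    · exact ENNReal.sum_le_tsum s
    · exact ENNReal.sum_le_tsum s
  have ht : Filter.Tendsto (fun s : Finset ι => (∑ i ∈ s, K i * x i) ^ 4) Filter.atTop (nhds ((∑' i, K i * x i) ^ 4)) :=
    (ENNReal.continuous_pow 4).continuousAt.tendsto.comp ENNReal.summable.hasSum
  exact le_of_tendsto' ht key

lemma schur4 {ι κ : Type*} (K : ι → κ → ℝ≥0∞) (x : κ → ℝ≥0∞) (A B : ℝ≥0∞)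
    (hA : ∀ i, ∑' j, K i j ≤ A) (hB : ∀ j, ∑' i, K i j ≤ B) :
    ∑' i, (∑' j, K i j * x j) ^ 4 ≤ A ^ 3 * B * ∑' j, x j ^ 4 := by
  calc ∑' i, (∑' j, K i j * x j) ^ 4 ≤ ∑' i, A ^ 3 * ∑' j, K i j * x j ^ 4 := by
        apply ENNReal.tsum_le_tsum
        intro i
        refine (holder4 _ _).trans ?_
        gcongr
        exact hA i
    _ = A ^ 3 * ∑' j, ∑' i, K i j * x j ^ 4 := by rw [ENNReal.tsum_mul_left, ENNReal.tsum_comm]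
    _ ≤ A ^ 3 * ∑' j, B * x j ^ 4 := by
        gcongr with j
        rw [ENNReal.tsum_mul_right]
        gcongr
        exact hB j
    _ = _ := by rw [ENNReal.tsum_mul_left, mul_assoc]

/-- fourth power of the `ℓ^4` norm -/
def N4 {ι : Type*} (x : ι → ℂ) : ℝ≥0∞ := ∑' i, ‖x i‖ₑ ^ 4

lemma add_pow4 (a b : ℝ≥0∞) : (a + b) ^ 4 ≤ 8 * (a ^ 4 + b ^ 4) := by
  have h := holder4 (fun _ : Bool => (1 : ℝ≥0∞)) (fun i => if i then a else b)
  simp only [tsum_fintype, Fintype.sum_bool, one_mul, if_true, Bool.false_eq_true, if_false] at h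
  have h8 : ((1 : ℝ≥0∞) + 1) ^ 3 = 8 := by norm_num
  rwa [h8] at h

lemma N4_add {ι : Type*} (x y : ι → ℂ) : N4 (fun i => x i + y i) ≤ 8 * (N4 x + N4 y) := by
  unfold N4
  rw [← ENNReal.tsum_add, ← ENNReal.tsum_mul_left]
  apply ENNReal.tsum_le_tsum
  intro i
  refine le_trans ?_ (add_pow4 _ _)
  gcongr
  exact enorm_add_le _ _

lemma N4_mono {ι : Type*} {x y : ι → ℂ} (h : ∀ i, ‖x i‖ ≤ ‖y i‖) : N4 x ≤ N4 y := by
  unfold N4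
  apply ENNReal.tsum_le_tsum
  intro i
  gcongr
  exact enorm_le_iff_norm_le.2 (h i)

lemma le_N4 {ι : Type*} (x : ι → ℂ) (i : ι) : ‖x i‖ₑ ^ 4 ≤ N4 x := ENNReal.le_tsum i

lemma N4_bdd {ι : Type*} {x : ι → ℂ} (h : N4 x ≠ ⊤) (i : ι) : ‖x i‖ ^ 4 ≤ (N4 x).toReal := by
  have := ENNReal.toReal_mono h (le_N4 x i)
  simpa using this

lemma N4_bdd' {ι : Type*} {x : ι → ℂ} {C : ℝ} (hC : 0 ≤ C) (h : N4 x ≤ ENNReal.ofReal C) (i : ι) : ‖x i‖ ≤ C + 1 := by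
  have h1 := N4_bdd (ne_top_of_le_ne_top ENNReal.ofReal_ne_top h) i
  have h2 : (N4 x).toReal ≤ C := ENNReal.toReal_le_of_le_ofReal hC h
  by_contra hc
  push Not at hc
  have h3 : ‖x i‖ ^ 1 ≤ ‖x i‖ ^ 4 := pow_le_pow_right₀ (by linarith) (by norm_num)
  linarith [pow_one ‖x i‖]

lemma N4_const_mul {ι : Type*} (c : ℂ) (x : ι → ℂ) : N4 (fun i => c * x i) = ‖c‖ₑ ^ 4 * N4 x := by
  unfold N4
  rw [← ENNReal.tsum_mul_left]
  congr 1; ext i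
  rw [enorm_mul, mul_pow]

lemma N4_single (k : ℕ) (c : ℂ) : N4 (fun i : ℕ => if i = k then c else 0) = ‖c‖ₑ ^ 4 := by
  unfold N4
  rw [tsum_eq_single k]
  · simp
  · intro i hi; simp [hi]

lemma N4_finite (K : ℕ) (x : ℕ → ℂ) (hx : ∀ n, K ≤ n → x n = 0) : N4 x ≠ ⊤ := by
  unfold N4
  rw [tsum_eq_sum (s := Finset.range K)]
  · exact ENNReal.sum_ne_top.2 (fun i _ => by simp)
  · intro n hn; rw [hx n (by simpa using hn)]; simp



lemma kern_sum_real (a : ℝ) (ha : 0 < a) :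
    ∃ G : ℝ, 0 < G ∧ ∀ t : ℝ, Summable (fun n : ℕ => Real.exp (-(a * |t - n|))) ∧
      ∑' n : ℕ, Real.exp (-(a * |t - n|)) ≤ G := by
  obtain ⟨G, hG⟩ := kern_sum a ha
  refine ⟨G + 1, by positivity, fun t => ?_⟩
  have hne : ∑' n : ℕ, kap a (t - n) ≠ ⊤ := ne_top_of_le_ne_top ENNReal.coe_ne_top (hG t)
  have hs : Summable (fun n : ℕ => Real.exp (-(a * |t - n|))) := by
    have := ENNReal.summable_toReal hne
    refine this.congr (fun n => ?_)
    simp [kap, (Real.exp_pos _).le]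
  refine ⟨hs, ?_⟩
  have h2 : ∑' n : ℕ, kap a (t - n) = ENNReal.ofReal (∑' n : ℕ, Real.exp (-(a * |t - n|))) := by
    rw [ENNReal.ofReal_tsum_of_nonneg (fun _ => (Real.exp_pos _).le) hs]; rfl
  have h3 := hG t
  rw [h2] at h3
  have h4 := ENNReal.toReal_mono ENNReal.coe_ne_top h3
  rw [ENNReal.toReal_ofReal (tsum_nonneg (fun _ => (Real.exp_pos _).le))] at h4
  simp at h4
  linarith

lemma kern_fin (a : ℝ) (ha : 0 < a) :
    ∃ G : ℝ, 0 < G ∧ ∀ (t : ℝ) (s : Finset ℕ), ∑ n ∈ s, Real.exp (-(a * |t - n|)) ≤ G := by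
  obtain ⟨G, hG0, hG⟩ := kern_sum_real a ha
  exact ⟨G, hG0, fun t s => ((hG t).1.sum_le_tsum s (fun _ _ => (Real.exp_pos _).le)).trans (hG t).2⟩

/-- matrix entry -/
def MM (β t : ℝ) (z : ℂ) (n : ℕ) : ℂ :=
  (Real.exp (-(β * t ^ 2 / 2)) : ℂ) * (Real.exp (-(β * (n : ℝ) ^ 2 / 2)) : ℂ) * z ^ n

/-- matrix action -/
def mv (β t : ℝ) (z : ℂ) (x : ℕ → ℂ) : ℂ := ∑' n, x n * MM β t z n

/-- power series -/
def PS (β : ℝ) (x : ℕ → ℂ) (z : ℂ) : ℂ := ∑' n, x n * (Real.exp (-(β * (n : ℝ) ^ 2 / 2)) : ℂ) * z ^ n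

lemma mv_eq (β t : ℝ) (z : ℂ) (x : ℕ → ℂ) :
    mv β t z x = (Real.exp (-(β * t ^ 2 / 2)) : ℂ) * PS β x z := by
  rw [mv, PS, ← tsum_mul_left]
  congr 1; ext n; rw [MM]; ring

lemma norm_MM {β t : ℝ} {z : ℂ} (hz : ‖z‖ = Real.exp (β * t)) (n : ℕ) :
    ‖MM β t z n‖ = Real.exp (-(β * (t - n) ^ 2 / 2)) := by
  rw [MM, norm_mul, norm_mul, norm_pow, hz, Complex.norm_real, Complex.norm_real, Real.norm_of_nonneg (Real.exp_pos _).le,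
    Real.norm_of_nonneg (Real.exp_pos _).le, ← Real.exp_nat_mul, ← Real.exp_add, ← Real.exp_add]
  congr 1; ring

lemma norm_PS (β t : ℝ) (z : ℂ) (x : ℕ → ℂ) :
    ‖PS β x z‖ = Real.exp (β * t ^ 2 / 2) * ‖mv β t z x‖ := by
  rw [mv_eq, norm_mul, Complex.norm_real, Real.norm_of_nonneg (Real.exp_pos _).le, ← mul_assoc, ← Real.exp_add]
  simp

lemma mv_weighted_bound (β : ℝ) (hβ : 0 < β) :
    ∃ G : ℝ, 0 < G ∧ ∀ (t : ℝ) (z : ℂ) (x : ℕ → ℂ) (A c t0 : ℝ), ‖z‖ = Real.exp (β * t) → |c| ≤ 1 → 0 ≤ A →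
      (∀ n, ‖x n‖ ≤ A * Real.exp (-(c * (n - t0)))) →
      Summable (fun n => ‖x n * MM β t z n‖) ∧ ‖mv β t z x‖ ≤ A * G * Real.exp (-(c * (t - t0))) := by
  obtain ⟨G, hG0, hG⟩ := kern_sum_real 1 one_pos
  refine ⟨Real.exp (2 ^ 2 / (2 * β)) * G, by positivity, fun t z x A c t0 hz hc hA hx => ?_⟩
  have hb : ∀ n : ℕ, ‖x n * MM β t z n‖ ≤ A * Real.exp (2 ^ 2 / (2 * β)) * Real.exp (-(c * (t - t0))) * Real.exp (-(1 * |t - n|)) := by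
    intro n
    rw [norm_mul, norm_MM hz]
    have h1 := gauss_le_exp β 2 hβ (t - n)
    have h2 : Real.exp (-(c * (n - t0))) * Real.exp (-(2 * |t - n|)) ≤ Real.exp (-(c * (t - t0))) * Real.exp (-(1 * |t - n|)) := by
      rw [← Real.exp_add, ← Real.exp_add]
      apply Real.exp_le_exp.2
      have h3 : c * (t - n) ≤ |t - n| := by
        calc c * (t - n) ≤ |c * (t - n)| := le_abs_self _
          _ = |c| * |t - n| := abs_mul _ _
          _ ≤ 1 * |t - n| := by gcongr
          _ = _ := one_mul _
      linarith
    calc ‖x n‖ * Real.exp (-(β * (t - n) ^ 2 / 2)) ≤ (A * Real.exp (-(c * (n - t0)))) * (Real.exp (2 ^ 2 / (2 * β)) * Real.exp (-(2 * |t - n|))) := by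
          gcongr
          exact hx n
      _ = A * Real.exp (2 ^ 2 / (2 * β)) * (Real.exp (-(c * (n - t0))) * Real.exp (-(2 * |t - n|))) := by ring
      _ ≤ A * Real.exp (2 ^ 2 / (2 * β)) * (Real.exp (-(c * (t - t0))) * Real.exp (-(1 * |t - n|))) := by gcongr
      _ = _ := by ring
  have hs := (hG t).1.mul_left (A * Real.exp (2 ^ 2 / (2 * β)) * Real.exp (-(c * (t - t0))))
  have hsum : Summable (fun n => ‖x n * MM β t z n‖) := Summable.of_nonneg_of_le (fun _ => norm_nonneg _) hb hs
  refine ⟨hsum, ?_⟩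
  calc ‖mv β t z x‖ ≤ ∑' n, ‖x n * MM β t z n‖ := norm_tsum_le_tsum_norm hsum
    _ ≤ ∑' n : ℕ, A * Real.exp (2 ^ 2 / (2 * β)) * Real.exp (-(c * (t - t0))) * Real.exp (-(1 * |t - n|)) := hsum.tsum_le_tsum hb hs
    _ = A * Real.exp (2 ^ 2 / (2 * β)) * Real.exp (-(c * (t - t0))) * ∑' n : ℕ, Real.exp (-(1 * |t - n|)) := tsum_mul_left
    _ ≤ A * Real.exp (2 ^ 2 / (2 * β)) * Real.exp (-(c * (t - t0))) * G := by gcongr; exact (hG t).2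
    _ = _ := by ring

lemma mv_bound (β : ℝ) (hβ : 0 < β) :
    ∃ G : ℝ, 0 < G ∧ ∀ (t : ℝ) (z : ℂ) (x : ℕ → ℂ) (A : ℝ), ‖z‖ = Real.exp (β * t) → 0 ≤ A →
      (∀ n, ‖x n‖ ≤ A) →
      Summable (fun n => ‖x n * MM β t z n‖) ∧ ‖mv β t z x‖ ≤ A * G := by
  obtain ⟨G, hG0, hG⟩ := mv_weighted_bound β hβ
  refine ⟨G, hG0, fun t z x A hz hA hx => ?_⟩
  simpa using hG t z x A 0 0 hz (by simp) hA (by simpa using hx)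

lemma bdd_of_N4 {x : ℕ → ℂ} (h : N4 x ≠ ⊤) : ∃ A : ℝ, 0 ≤ A ∧ ∀ n, ‖x n‖ ≤ A := by
  refine ⟨(N4 x).toReal + 1, by positivity, fun n => ?_⟩
  exact N4_bdd' (by positivity) (by rw [ENNReal.ofReal_toReal h]) n

lemma summable_mv {β t : ℝ} (hβ : 0 < β) {z : ℂ} (hz : ‖z‖ = Real.exp (β * t)) {x : ℕ → ℂ} (h : N4 x ≠ ⊤) :
    Summable (fun n => x n * MM β t z n) := by
  obtain ⟨A, hA, hx⟩ := bdd_of_N4 h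
  obtain ⟨G, hG0, hG⟩ := mv_bound β hβ
  exact (hG t z x A hz hA hx).1.of_norm

lemma mv_add {β t : ℝ} (hβ : 0 < β) {z : ℂ} (hz : ‖z‖ = Real.exp (β * t)) {x y : ℕ → ℂ} (hx : N4 x ≠ ⊤) (hy : N4 y ≠ ⊤) :
    mv β t z (fun n => x n + y n) = mv β t z x + mv β t z y := by
  unfold mv
  rw [← (summable_mv hβ hz hx).tsum_add (summable_mv hβ hz hy)]
  congr 1; ext n; ring

lemma mv_const_mul (β t : ℝ) (z c : ℂ) (x : ℕ → ℂ) :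
    mv β t z (fun n => c * x n) = c * mv β t z x := by
  unfold mv
  rw [← tsum_mul_left]
  congr 1; ext n; ring

lemma mv_single (β t : ℝ) (z : ℂ) (k : ℕ) (c : ℂ) :
    mv β t z (fun n => if n = k then c else 0) = c * MM β t z k := by
  unfold mv
  rw [tsum_eq_single k]
  · simp
  · intro n hn; simp [hn]

lemma N4_add_ne_top {x y : ℕ → ℂ} (hx : N4 x ≠ ⊤) (hy : N4 y ≠ ⊤) : N4 (fun n => x n + y n) ≠ ⊤ :=
  ne_top_of_le_ne_top (ENNReal.mul_ne_top (by norm_num) (ENNReal.add_ne_top.2 ⟨hx, hy⟩)) (N4_add x y)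

lemma N4_mul_ne_top {c : ℂ} {x : ℕ → ℂ} (hx : N4 x ≠ ⊤) : N4 (fun n => c * x n) ≠ ⊤ := by
  rw [N4_const_mul]; exact ENNReal.mul_ne_top (by simp) hx

lemma N4_sum_ne_top (s : Finset ℕ) (c : ℕ → ℂ) (x : ℕ → ℕ → ℂ) (hx : ∀ k, N4 (x k) ≠ ⊤) :
    N4 (fun n => ∑ k ∈ s, c k * x k n) ≠ ⊤ := by
  induction s using Finset.induction_on with
  | empty => simp [N4]
  | insert a s ha ih =>
    simp_rw [Finset.sum_insert ha]
    exact N4_add_ne_top (N4_mul_ne_top (hx a)) ih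

lemma mv_sum {β t : ℝ} (hβ : 0 < β) {z : ℂ} (hz : ‖z‖ = Real.exp (β * t)) (s : Finset ℕ) (c : ℕ → ℂ) (x : ℕ → ℕ → ℂ)
    (hx : ∀ k, N4 (x k) ≠ ⊤) :
    mv β t z (fun n => ∑ k ∈ s, c k * x k n) = ∑ k ∈ s, c k * mv β t z (x k) := by
  induction s using Finset.induction_on with
  | empty => simp [mv]
  | insert a s ha ih =>
    simp_rw [Finset.sum_insert ha]
    rw [mv_add hβ hz (N4_mul_ne_top (hx a)) (N4_sum_ne_top s c x hx), ih, mv_const_mul]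

/-- sequence attached to a polynomial -/
def xp (β : ℝ) (p : Polynomial ℂ) (n : ℕ) : ℂ := p.coeff n * (Real.exp (β * (n : ℝ) ^ 2 / 2) : ℂ)

lemma PS_xp (β : ℝ) (p : Polynomial ℂ) (z : ℂ) : PS β (xp β p) z = p.eval z := by
  have h : ∀ n, xp β p n * (Real.exp (-(β * (n : ℝ) ^ 2 / 2)) : ℂ) * z ^ n = p.coeff n * z ^ n := by
    intro n
    rw [xp, mul_assoc (p.coeff n), ← Complex.ofReal_mul, ← Real.exp_add]
    simp
  rw [PS, Polynomial.eval_eq_sum_range]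
  simp_rw [h]
  apply tsum_eq_sum
  intro n hn
  rw [Polynomial.coeff_eq_zero_of_natDegree_lt (by simpa using hn), zero_mul]

lemma N4_xp (β : ℝ) (p : Polynomial ℂ) : N4 (xp β p) ≠ ⊤ := by
  apply N4_finite (p.natDegree + 1)
  intro n hn
  rw [xp, Polynomial.coeff_eq_zero_of_natDegree_lt (by omega), zero_mul]

lemma ofReal_gauss_le (β : ℝ) (hβ : 0 < β) (u : ℝ) :
    ENNReal.ofReal (Real.exp (-(β * u ^ 2 / 2))) ≤ ENNReal.ofReal (Real.exp (1 ^ 2 / (2 * β))) * kap 1 u := by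
  rw [kap, ← ENNReal.ofReal_mul (Real.exp_pos _).le]
  exact ENNReal.ofReal_le_ofReal (gauss_le_exp β 1 hβ u)

lemma schur_kap {ι : Type*} {τ : ι → ℝ} {G G' : ℝ≥0∞} {D : ℝ≥0∞}
    (hG : ∀ t : ℝ, ∑' n : ℕ, kap 1 (t - n) ≤ G) (hG' : ∀ n : ℕ, ∑' k, kap 1 (τ k - n) ≤ G')
    (x : ℕ → ℂ) (y : ι → ℂ) (hy : ∀ k, ‖y k‖ₑ ≤ ∑' n : ℕ, D * kap 1 (τ k - n) * ‖x n‖ₑ) :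
    N4 y ≤ D ^ 4 * (G ^ 3 * G') * N4 x := by
  have h := schur4 (fun k (n : ℕ) => D * kap 1 (τ k - n)) (fun n => ‖x n‖ₑ) (D * G) (D * G')
    (fun k => by rw [ENNReal.tsum_mul_left]; gcongr; exact hG _)
    (fun n => by rw [ENNReal.tsum_mul_left]; gcongr; exact hG' _)
  calc N4 y ≤ ∑' k, (∑' n : ℕ, D * kap 1 (τ k - n) * ‖x n‖ₑ) ^ 4 := by
        unfold N4
        apply ENNReal.tsum_le_tsum
        intro k; gcongr; exact hy k
    _ ≤ _ := h
    _ = _ := by rw [N4]; ring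

lemma enorm_mv_le {β t : ℝ} (hβ : 0 < β) {z : ℂ} (hz : ‖z‖ = Real.exp (β * t)) (x : ℕ → ℂ) :
    ‖mv β t z x‖ₑ ≤ ∑' n : ℕ, ENNReal.ofReal (Real.exp (1 ^ 2 / (2 * β))) * kap 1 (t - n) * ‖x n‖ₑ := by
  refine (enorm_tsum_le_tsum_enorm).trans ?_
  apply ENNReal.tsum_le_tsum
  intro n
  rw [enorm_mul, mul_comm]
  gcongr
  rw [← ofReal_norm, norm_MM hz]
  exact ofReal_gauss_le β hβ _

lemma mv_upper {β : ℝ} (hβ : 0 < β) {τ : ℕ → ℝ} {μ : ℕ → ℂ} (hμ : ∀ k, ‖μ k‖ = Real.exp (β * τ k)) {G' : NNReal}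
    (hG' : ∀ n : ℕ, ∑' k, kap 1 (τ k - n) ≤ G') :
    ∃ C : NNReal, ∀ x : ℕ → ℂ, N4 (fun k => mv β (τ k) (μ k) x) ≤ C * N4 x := by
  obtain ⟨G, hG⟩ := kern_sum 1 one_pos
  refine ⟨(Real.exp (1 ^ 2 / (2 * β))).toNNReal ^ 4 * (G ^ 3 * G'), fun x => ?_⟩
  have := schur_kap (D := ENNReal.ofReal (Real.exp (1 ^ 2 / (2 * β)))) hG hG' x (fun k => mv β (τ k) (μ k) x) (fun k => enorm_mv_le hβ (hμ k) x)
  refine this.trans (le_of_eq ?_)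
  push_cast
  rfl



lemma abs_tau_shift {τ : ℕ → ℝ} {E : ℝ} (hE : ∀ j, |τ j - j| ≤ E) (t : ℝ) (j : ℕ) : |t - j| ≤ |t - τ j| + E := by
  calc |t - j| = |(t - τ j) + (τ j - j)| := by congr 1; ring
    _ ≤ |t - τ j| + |τ j - j| := abs_add_le _ _
    _ ≤ _ := by linarith [hE j]

lemma kern_tau {τ : ℕ → ℝ} {E : ℝ} (hE : ∀ j, |τ j - j| ≤ E) :
    ∃ G : NNReal, ∀ t : ℝ, ∑' k, kap 1 (τ k - t) ≤ G := by
  obtain ⟨G, hG⟩ := kern_sum 1 one_pos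
  refine ⟨(Real.exp E).toNNReal * G, fun t => ?_⟩
  push_cast
  refine le_trans ?_ (mul_le_mul_right (hG t) _)
  rw [← ENNReal.tsum_mul_left]
  apply ENNReal.tsum_le_tsum
  intro k
  change _ ≤ ENNReal.ofReal (Real.exp E) * _
  rw [kap, kap, ← ENNReal.ofReal_mul (Real.exp_pos _).le, ← Real.exp_add]
  apply ENNReal.ofReal_le_ofReal
  apply Real.exp_le_exp.2
  have := abs_tau_shift hE t k
  rw [abs_sub_comm t (τ k)] at this
  linarith

lemma kern_tau_fin {τ : ℕ → ℝ} {E : ℝ} (hE : ∀ j, |τ j - j| ≤ E) (a : ℝ) (ha : 0 < a) :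
    ∃ G : ℝ, 0 < G ∧ ∀ (t : ℝ) (s : Finset ℕ), ∑ k ∈ s, Real.exp (-(a * |t - τ k|)) ≤ G := by
  obtain ⟨G, hG0, hG⟩ := kern_fin a ha
  refine ⟨Real.exp (a * E) * G, by positivity, fun t s => ?_⟩
  refine le_trans ?_ (mul_le_mul_of_nonneg_left (hG t s) (Real.exp_pos _).le)
  rw [Finset.mul_sum]
  apply Finset.sum_le_sum
  intro k _
  rw [← Real.exp_add]
  apply Real.exp_le_exp.2
  have := abs_tau_shift hE t k
  nlinarith

lemma exp_add_exp_le (β s t : ℝ) (hβ : 0 < β) :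
    Real.exp (β * s) + Real.exp (β * t) ≤ Real.exp (β * max s t + Real.exp (-(β * |s - t|))) := by
  have key : ∀ s t : ℝ, t ≤ s → Real.exp (β * s) + Real.exp (β * t) ≤ Real.exp (β * s + Real.exp (-(β * |s - t|))) := by
    intro s t h
    rw [Real.exp_add (β * s), abs_of_nonneg (sub_nonneg.2 h)]
    have h1 := Real.add_one_le_exp (Real.exp (-(β * (s - t))))
    have h2 : Real.exp (β * t) = Real.exp (β * s) * Real.exp (-(β * (s - t))) := by
      rw [← Real.exp_add]; congr 1; ring
    rw [h2]
    nlinarith [Real.exp_pos (β * s)]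
  rcases le_total t s with h | h
  · rw [max_eq_left h]; exact key s t h
  · rw [max_eq_right h, add_comm, abs_sub_comm]; exact key t s h

lemma prod_upper {β : ℝ} (hβ : 0 < β) {τ : ℕ → ℝ} {μ : ℕ → ℂ} (hμ : ∀ k, ‖μ k‖ = Real.exp (β * τ k))
    {E : ℝ} (hE : ∀ j, |τ j - j| ≤ E) :
    ∃ G : ℝ, 0 < G ∧ ∀ (σ : ℝ) (s : Finset ℕ), ∏ j ∈ s, (Real.exp (β * σ) + ‖μ j‖) ≤ Real.exp (G + β * ∑ j ∈ s, max σ (τ j)) := by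
  obtain ⟨G, hG0, hG⟩ := kern_tau_fin hE β hβ
  refine ⟨G, hG0, fun σ s => ?_⟩
  calc ∏ j ∈ s, (Real.exp (β * σ) + ‖μ j‖) ≤ ∏ j ∈ s, Real.exp (β * max σ (τ j) + Real.exp (-(β * |σ - τ j|))) := by
        apply Finset.prod_le_prod
        · intro j _; positivity
        · intro j _; rw [hμ]; exact exp_add_exp_le β σ (τ j) hβ
    _ = Real.exp (∑ j ∈ s, (β * max σ (τ j) + Real.exp (-(β * |σ - τ j|)))) := (Real.exp_sum _ _).symm
    _ ≤ _ := by
        apply Real.exp_le_exp.2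
        rw [Finset.sum_add_distrib, ← Finset.mul_sum]
        linarith [hG σ s]

lemma sub_lower {β : ℝ} (hβ : 0 < β) {ε s t : ℝ} (hε : 0 < ε) {z w : ℂ} (hz : ‖z‖ = Real.exp (β * s)) (hw : ‖w‖ = Real.exp (β * t))
    (h1 : ε * ‖z‖ ≤ ‖z - w‖) (h2 : ε * ‖w‖ ≤ ‖z - w‖) :
    Real.exp (β * max s t - (2 + 2 * |Real.log ε|) * Real.exp (-(β * |s - t|))) ≤ ‖z - w‖ := by
  set u := Real.exp (-(β * |s - t|)) with hu
  have hu0 : 0 < u := Real.exp_pos _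
  have hm1 : Real.exp (β * max s t) * ε ≤ ‖z - w‖ := by
    rcases le_total t s with h | h
    · rw [max_eq_left h, ← hz]; linarith
    · rw [max_eq_right h, ← hw]; linarith
  have hm2 : Real.exp (β * max s t) * (1 - u) ≤ ‖z - w‖ := by
    have h3 := norm_sub_norm_le z w
    have h4 := norm_sub_norm_le w z
    rw [norm_sub_rev w z] at h4
    have e : ∀ a b : ℝ, b ≤ a → Real.exp (β * a) * (1 - Real.exp (-(β * |a - b|))) = Real.exp (β * a) - Real.exp (β * b) := by
      intro a b hab
      rw [mul_sub, ← Real.exp_add, abs_of_nonneg (sub_nonneg.2 hab), mul_one]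
      congr 2; ring
    rcases le_total t s with h | h
    · rw [max_eq_left h, hu, e s t h, ← hz, ← hw]; exact h3
    · rw [max_eq_right h, hu, abs_sub_comm, e t s h, ← hz, ← hw]; exact h4
  have hL := abs_nonneg (Real.log ε)
  rw [sub_eq_add_neg, Real.exp_add]
  by_cases hc : u ≤ 1 / 2
  · refine le_trans ?_ hm2
    gcongr
    have h5 : Real.exp (-((2 + 2 * |Real.log ε|) * u)) ≤ Real.exp (-(2 * u)) := by
      apply Real.exp_le_exp.2; nlinarith
    refine h5.trans ?_
    rw [Real.exp_neg, inv_le_comm₀ (Real.exp_pos _) (by linarith)]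
    have h6 := Real.add_one_le_exp (2 * u)
    refine le_trans ?_ h6
    rw [inv_le_iff_one_le_mul₀ (by linarith)]
    nlinarith
  · push Not at hc
    refine le_trans ?_ hm1
    gcongr
    calc Real.exp (-((2 + 2 * |Real.log ε|) * u)) ≤ Real.exp (Real.log ε) := by
          apply Real.exp_le_exp.2
          nlinarith [neg_abs_le (Real.log ε)]
      _ = ε := Real.exp_log hε

lemma prod_lower {β : ℝ} (hβ : 0 < β) {τ : ℕ → ℝ} {μ : ℕ → ℂ} (hμ : ∀ k, ‖μ k‖ = Real.exp (β * τ k))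
    {E : ℝ} (hE : ∀ j, |τ j - j| ≤ E) {ε : ℝ} (hε : 0 < ε) (hsep : ∀ j k, j ≠ k → ε * ‖μ k‖ ≤ ‖μ j - μ k‖) :
    ∃ G : ℝ, 0 < G ∧ ∀ (k : ℕ) (s : Finset ℕ), k ∉ s →
      Real.exp (β * ∑ j ∈ s, max (τ k) (τ j) - G) ≤ ∏ j ∈ s, ‖μ k - μ j‖ := by
  obtain ⟨G, hG0, hG⟩ := kern_tau_fin hE β hβ
  have hL := abs_nonneg (Real.log ε)
  refine ⟨(2 + 2 * |Real.log ε|) * G, by positivity, fun k s hk => ?_⟩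
  calc Real.exp (β * ∑ j ∈ s, max (τ k) (τ j) - (2 + 2 * |Real.log ε|) * G)
      ≤ Real.exp (∑ j ∈ s, (β * max (τ k) (τ j) - (2 + 2 * |Real.log ε|) * Real.exp (-(β * |τ k - τ j|)))) := by
        apply Real.exp_le_exp.2
        rw [Finset.sum_sub_distrib, ← Finset.mul_sum, ← Finset.mul_sum]
        have := hG (τ k) s
        nlinarith
    _ = ∏ j ∈ s, Real.exp (β * max (τ k) (τ j) - (2 + 2 * |Real.log ε|) * Real.exp (-(β * |τ k - τ j|))) := Real.exp_sum _ _
    _ ≤ _ := by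
        apply Finset.prod_le_prod
        · intro j _; positivity
        · intro j hj
          have hjk : j ≠ k := fun h => hk (h ▸ hj)
          apply sub_lower hβ hε (hμ k) (hμ j)
          · rw [norm_sub_rev]; exact hsep j k hjk
          · exact hsep k j hjk.symm

open Polynomial in
lemma coeff_prod_bound {ι : Type*} (s : Finset ι) (c y : ι → ℂ) (r : ℝ) (hr : 0 < r) (n : ℕ) :
    ‖(∏ j ∈ s, (C (c j) * (X - C (y j)))).coeff n‖ * r ^ n ≤ ∏ j ∈ s, (‖c j‖ * (r + ‖y j‖)) := by
  classical
  induction s using Finset.induction_on generalizing n with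
  | empty =>
    simp only [Finset.prod_empty, Polynomial.coeff_one]
    split_ifs with h
    · simp [h]
    · simp
  | insert a s ha ih =>
    rw [Finset.prod_insert ha, Finset.prod_insert ha]
    set p := ∏ j ∈ s, (C (c j) * (X - C (y j))) with hp
    set A := ∏ j ∈ s, (‖c j‖ * (r + ‖y j‖))
    have e : C (c a) * (X - C (y a)) * p = C (c a) * (X * p - C (y a) * p) := by ring
    rw [e, coeff_C_mul, coeff_sub, coeff_C_mul, norm_mul]
    have hA : ‖(X * p).coeff n‖ * r ^ n ≤ r * A := by
      cases n with
      | zero => simp; exact mul_nonneg hr.le ((mul_nonneg (norm_nonneg _) (by positivity)).trans (ih 0))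
      | succ m =>
        rw [coeff_X_mul, pow_succ]
        nlinarith [ih m]
    have h1 : ‖(X * p).coeff n - y a * p.coeff n‖ * r ^ n ≤ (r + ‖y a‖) * A := by
      calc ‖(X * p).coeff n - y a * p.coeff n‖ * r ^ n ≤ (‖(X * p).coeff n‖ + ‖y a‖ * ‖p.coeff n‖) * r ^ n := by
            gcongr
            refine (norm_sub_le _ _).trans ?_
            rw [norm_mul]
        _ = ‖(X * p).coeff n‖ * r ^ n + ‖y a‖ * (‖p.coeff n‖ * r ^ n) := by ring
        _ ≤ r * A + ‖y a‖ * A := by gcongr; exact ih n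
        _ = _ := by ring
    calc ‖c a‖ * ‖(X * p).coeff n - y a * p.coeff n‖ * r ^ n = ‖c a‖ * (‖(X * p).coeff n - y a * p.coeff n‖ * r ^ n) := by ring
      _ ≤ ‖c a‖ * ((r + ‖y a‖) * A) := by gcongr
      _ = _ := by ring

lemma sum_if_split (τ : ℕ → ℝ) (a : ℝ) (n K : ℕ) (h : n ≤ K) :
    ∑ j ∈ Finset.range K, (if j < n then a else τ j) = n * a + (∑ j ∈ Finset.range K, τ j - ∑ j ∈ Finset.range n, τ j) := by
  induction K, h using Nat.le_induction with
  | base =>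
    rw [Finset.sum_congr rfl (g := fun _ => a)]
    · simp
    · intro j hj; simp [Finset.mem_range.1 hj]
  | succ K hK ih =>
    rw [Finset.sum_range_succ, ih, Finset.sum_range_succ, if_neg (by omega)]; ring

lemma sum_range_cast (n : ℕ) : ∑ j ∈ Finset.range n, (j : ℝ) = n * (n - 1) / 2 := by
  induction n with
  | zero => simp
  | succ n ih => rw [Finset.sum_range_succ, ih]; push_cast; ring

/-- partial sums of deviations -/
def Ep (τ : ℕ → ℝ) (n : ℕ) : ℝ := ∑ j ∈ Finset.range n, (τ j - j)

lemma sum_tau (τ : ℕ → ℝ) (n : ℕ) : ∑ j ∈ Finset.range n, τ j = n * (n - 1) / 2 + Ep τ n := by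
  rw [Ep, Finset.sum_sub_distrib, sum_range_cast]; ring

lemma sum_max_lower (τ : ℕ → ℝ) (a : ℝ) (n K : ℕ) (h : n ≤ K) :
    n * a + (∑ j ∈ Finset.range K, τ j - ∑ j ∈ Finset.range n, τ j) ≤ ∑ j ∈ Finset.range K, max a (τ j) := by
  rw [← sum_if_split τ a n K h]
  apply Finset.sum_le_sum
  intro j _
  split_ifs
  · exact le_max_left _ _
  · exact le_max_right _ _

lemma sum_max_upper {τ : ℕ → ℝ} {E : ℝ} (hE : ∀ j, |τ j - j| ≤ E) :
    ∃ C : ℝ, 0 < C ∧ ∀ n K : ℕ, n ≤ K → ∑ j ∈ Finset.range K, max (n : ℝ) (τ j) ≤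
      n * n + (∑ j ∈ Finset.range K, τ j - ∑ j ∈ Finset.range n, τ j) + C := by
  obtain ⟨G, hG0, hG⟩ := kern_fin 1 one_pos
  refine ⟨Real.exp E * G, by positivity, fun n K h => ?_⟩
  rw [← sum_if_split τ n n K h]
  have : ∑ j ∈ Finset.range K, max (n : ℝ) (τ j) ≤ ∑ j ∈ Finset.range K, ((if j < n then (n : ℝ) else τ j) + Real.exp E * Real.exp (-(1 * |(n : ℝ) - j|))) := by
    apply Finset.sum_le_sum
    intro j _
    rw [← Real.exp_add]
    have h1 := Real.add_one_le_exp (E + -(1 * |(n : ℝ) - j|))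
    have h0 := Real.exp_pos (E + -(1 * |(n : ℝ) - j|))
    have h2 := abs_le.1 (hE j)
    split_ifs with hj
    · have hj' : (j : ℝ) < n := by exact_mod_cast hj
      rw [abs_of_pos (by linarith)] at h1 h0 ⊢
      apply max_le <;> linarith
    · have hj' : (n : ℝ) ≤ j := by exact_mod_cast not_lt.1 hj
      rw [abs_of_nonpos (by linarith)] at h1 h0 ⊢
      apply max_le <;> linarith
  refine this.trans ?_
  rw [Finset.sum_add_distrib, ← Finset.mul_sum]
  gcongr
  exact hG n _

lemma D_bound {τ : ℕ → ℝ} {E : ℝ} (hE : ∀ j, |τ j - j| ≤ E) {c Ca : ℝ}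
    (havg : ∀ k m : ℕ, k ≤ m → |Ep τ m - Ep τ k| ≤ (1 / 2 - c) * (m - k) + Ca) :
    ∃ C : ℝ, ∀ n k K : ℕ, n < K → k < K → (τ k) ^ 2 / 2 - (n : ℝ) ^ 2 / 2 +
      (∑ j ∈ (Finset.range K).erase k, max (n : ℝ) (τ j) - ∑ j ∈ (Finset.range K).erase k, max (τ k) (τ j)) ≤
      C - c * |(n : ℝ) - k| := by
  obtain ⟨C, hC0, hC⟩ := sum_max_upper hE
  refine ⟨C + Ca + E ^ 2 / 2 + E, fun n k K hn hk => ?_⟩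
  have hmem : k ∈ Finset.range K := by simpa using hk
  have e1 := Finset.add_sum_erase (Finset.range K) (fun j => max (n : ℝ) (τ j)) hmem
  have e2 := Finset.add_sum_erase (Finset.range K) (fun j => max (τ k) (τ j)) hmem
  have u1 := hC n K hn.le
  have l1 := sum_max_lower τ (τ k) k K hk.le
  simp only [max_self] at e1 e2
  rw [sum_tau τ n] at u1
  rw [sum_tau τ k] at l1
  have hEk := abs_le.1 (hE k)
  have hE0 : 0 ≤ E := (abs_nonneg _).trans (hE k)
  have hsq : (τ k - k) ^ 2 ≤ E ^ 2 := sq_le_sq' (by linarith) hEk.2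
  rcases le_or_gt n k with h | h
  · have hnk : (n : ℝ) ≤ k := by exact_mod_cast h
    have := (abs_le.1 (havg n k h)).2
    rw [abs_of_nonpos (by linarith)]
    have hm := le_max_right (n : ℝ) (τ k)
    nlinarith
  · have hnk : (k : ℝ) < n := by exact_mod_cast h
    have := (abs_le.1 (havg k n h.le)).1
    rw [abs_of_pos (by linarith)]
    have hm := le_max_left (n : ℝ) (τ k)
    nlinarith

/-- entries of the inverse of the truncated matrix -/
def BB (β : ℝ) (τ : ℕ → ℝ) (μ : ℕ → ℂ) (K n k : ℕ) : ℂ :=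
  (Real.exp (β * (n : ℝ) ^ 2 / 2) : ℂ) * (Lagrange.basis (Finset.range K) μ k).coeff n * (Real.exp (β * (τ k) ^ 2 / 2) : ℂ)

lemma BB_bound {β : ℝ} (hβ : 0 < β) {τ : ℕ → ℝ} {μ : ℕ → ℂ} (hμ : ∀ k, ‖μ k‖ = Real.exp (β * τ k))
    {E : ℝ} (hE : ∀ j, |τ j - j| ≤ E) {ε : ℝ} (hε : 0 < ε) (hsep : ∀ j k, j ≠ k → ε * ‖μ k‖ ≤ ‖μ j - μ k‖)
    {c Ca : ℝ} (havg : ∀ k m : ℕ, k ≤ m → |Ep τ m - Ep τ k| ≤ (1 / 2 - c) * (m - k) + Ca) :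
    ∃ C : ℝ, ∀ K n k : ℕ, n < K → k < K → ‖BB β τ μ K n k‖ ≤ Real.exp C * Real.exp (-(β * c * |(n : ℝ) - k|)) := by
  obtain ⟨G1, _, hG1⟩ := prod_upper hβ hμ hE
  obtain ⟨G2, _, hG2⟩ := prod_lower hβ hμ hE hε hsep
  obtain ⟨C, hC⟩ := D_bound hE havg
  refine ⟨G1 + G2 + β * C, fun K n k hn hk => ?_⟩
  set s := (Finset.range K).erase k with hs
  have hks : k ∉ s := by simp [hs]
  have hb : (Lagrange.basis (Finset.range K) μ k) = ∏ j ∈ s, (Polynomial.C ((μ k - μ j)⁻¹) * (Polynomial.X - Polynomial.C (μ j))) := rfl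
  have h1 := coeff_prod_bound s (fun j => (μ k - μ j)⁻¹) μ (Real.exp (β * n)) (Real.exp_pos _) n
  rw [← hb, Finset.prod_mul_distrib] at h1
  have h2 := hG1 n s
  have h3 := hG2 k s hks
  have h4 : ∏ j ∈ s, ‖(μ k - μ j)⁻¹‖ ≤ Real.exp (-(β * ∑ j ∈ s, max (τ k) (τ j) - G2)) := by
    simp_rw [norm_inv]
    rw [Finset.prod_inv_distrib, Real.exp_neg]
    gcongr
  have h5 : ‖(Lagrange.basis (Finset.range K) μ k).coeff n‖ * Real.exp (β * n) ^ n ≤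
      Real.exp (-(β * ∑ j ∈ s, max (τ k) (τ j) - G2)) * Real.exp (G1 + β * ∑ j ∈ s, max (n : ℝ) (τ j)) := by
    refine h1.trans ?_
    gcongr
  have h6 : ‖BB β τ μ K n k‖ = (‖(Lagrange.basis (Finset.range K) μ k).coeff n‖ * Real.exp (β * n) ^ n) *
      Real.exp (β * ((τ k) ^ 2 / 2 - (n : ℝ) ^ 2 / 2)) := by
    rw [BB, norm_mul, norm_mul, Complex.norm_real, Complex.norm_real, Real.norm_of_nonneg (Real.exp_pos _).le,
      Real.norm_of_nonneg (Real.exp_pos _).le, ← Real.exp_nat_mul, mul_comm (Real.exp _) ‖_‖, mul_assoc, mul_assoc, ← Real.exp_add, ← Real.exp_add]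
    congr 2; ring
  rw [h6]
  calc _ ≤ (Real.exp (-(β * ∑ j ∈ s, max (τ k) (τ j) - G2)) * Real.exp (G1 + β * ∑ j ∈ s, max (n : ℝ) (τ j))) * Real.exp (β * ((τ k) ^ 2 / 2 - (n : ℝ) ^ 2 / 2)) := by
        gcongr
    _ ≤ _ := by
        rw [← Real.exp_add, ← Real.exp_add, ← Real.exp_add]
        apply Real.exp_le_exp.2
        have := mul_le_mul_of_nonneg_left (hC n k K hn hk) hβ.le
        nlinarith



/-- complete interpolation at the level of sequences -/
def CISm (β : ℝ) (τ : ℕ → ℝ) (μ : ℕ → ℂ) : Prop :=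
  (∃ C : NNReal, ∀ x : ℕ → ℂ, N4 x ≠ ⊤ → N4 x ≤ C * N4 (fun k => mv β (τ k) (μ k) x) ∧
    N4 (fun k => mv β (τ k) (μ k) x) ≤ C * N4 x) ∧
  (∀ v : ℕ → ℂ, N4 v ≠ ⊤ → ∃ x : ℕ → ℂ, N4 x ≠ ⊤ ∧ ∀ k, mv β (τ k) (μ k) x = v k)

lemma exp_cancel (a : ℝ) : (Real.exp a : ℂ) * (Real.exp (-a) : ℂ) = 1 := by
  rw [← Complex.ofReal_mul, ← Real.exp_add]; simp

lemma interp_coeff (β : ℝ) (τ : ℕ → ℝ) (μ : ℕ → ℂ) (K : ℕ) (v : ℕ → ℂ) (n : ℕ) :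
    xp β (Lagrange.interpolate (Finset.range K) μ (fun k => v k * (Real.exp (β * (τ k) ^ 2 / 2) : ℂ))) n =
      ∑ k ∈ Finset.range K, BB β τ μ K n k * v k := by
  rw [xp, Lagrange.interpolate_apply, Polynomial.finsetSum_coeff, Finset.sum_mul]
  apply Finset.sum_congr rfl
  intro k _
  rw [Polynomial.coeff_C_mul, BB]; ring

lemma BB_schur {β : ℝ} {τ : ℕ → ℝ} {μ : ℕ → ℂ} {a C : ℝ} (ha : 0 < a)
    (h : ∀ K n k : ℕ, n < K → k < K → ‖BB β τ μ K n k‖ ≤ Real.exp C * Real.exp (-(a * |(n : ℝ) - k|))) :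
    ∃ D : NNReal, ∀ (K : ℕ) (v : ℕ → ℂ),
      N4 (fun n => if n < K then ∑ k ∈ Finset.range K, BB β τ μ K n k * v k else 0) ≤ D * N4 v := by
  obtain ⟨G, hG⟩ := kern_sum a ha
  refine ⟨((Real.exp C).toNNReal * G) ^ 3 * ((Real.exp C).toNNReal * G), fun K v => ?_⟩
  have hs := schur4 (fun (n k : ℕ) => ENNReal.ofReal (Real.exp C) * kap a ((n : ℝ) - k)) (fun k => ‖v k‖ₑ)
    (ENNReal.ofReal (Real.exp C) * G) (ENNReal.ofReal (Real.exp C) * G)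
    (fun n => by rw [ENNReal.tsum_mul_left]; gcongr; exact hG _)
    (fun k => by
      rw [ENNReal.tsum_mul_left]; gcongr
      simp_rw [kap, abs_sub_comm _ (k : ℝ)]
      exact hG k)
  push_cast
  refine le_trans ?_ hs
  unfold N4
  apply ENNReal.tsum_le_tsum
  intro n
  gcongr
  beta_reduce
  split_ifs with hn
  · refine (enorm_sum_le _ _).trans ?_
    refine le_trans ?_ (ENNReal.sum_le_tsum (Finset.range K))
    apply Finset.sum_le_sum
    intro k hk
    rw [enorm_mul]
    gcongr
    rw [kap, ← ENNReal.ofReal_mul (Real.exp_pos _).le, ← ofReal_norm]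
    exact ENNReal.ofReal_le_ofReal (h K n k hn (by simpa using hk))
  · simp

lemma xp_eq_zero (β : ℝ) {p : Polynomial ℂ} {K : ℕ} (hp : p.degree < K) {n : ℕ} (hn : K ≤ n) : xp β p n = 0 := by
  rw [xp, Polynomial.coeff_eq_zero_of_degree_lt, zero_mul]
  exact hp.trans_le (by exact_mod_cast hn)

lemma mv_xp (β t : ℝ) (z : ℂ) (p : Polynomial ℂ) : mv β t z (xp β p) = (Real.exp (-(β * t ^ 2 / 2)) : ℂ) * p.eval z := by
  rw [mv_eq, PS_xp]

lemma poly_lower {β : ℝ} {τ : ℕ → ℝ} {μ : ℕ → ℂ} (hinj : Function.Injective μ) {D : NNReal}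
    (hD : ∀ (K : ℕ) (v : ℕ → ℂ),
      N4 (fun n => if n < K then ∑ k ∈ Finset.range K, BB β τ μ K n k * v k else 0) ≤ D * N4 v)
    (K : ℕ) (p : Polynomial ℂ) (hp : p.degree < K) :
    N4 (xp β p) ≤ D * N4 (fun k => mv β (τ k) (μ k) (xp β p)) := by
  refine le_trans (le_of_eq ?_) (hD K _)
  congr 1; ext n
  split_ifs with hn
  · rw [← interp_coeff]
    congr 1
    rw [Lagrange.eq_interpolate (s := Finset.range K) (v := μ) (f := p) hinj.injOn (by simpa using hp)]
    congr 1; ext k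
    rw [← Lagrange.eq_interpolate (s := Finset.range K) (v := μ) (f := p) hinj.injOn (by simpa using hp), mv_xp]
    have := exp_cancel (β * τ k ^ 2 / 2)
    linear_combination (-Polynomial.eval (μ k) p) * this
  · exact xp_eq_zero β hp (not_lt.1 hn)

lemma exists_poly (β : ℝ) (x : ℕ → ℂ) (K : ℕ) :
    ∃ p : Polynomial ℂ, p.degree < K ∧ xp β p = fun n => if n < K then x n else 0 := by
  refine ⟨∑ n ∈ Finset.range K, Polynomial.monomial n (x n * (Real.exp (-(β * (n : ℝ) ^ 2 / 2)) : ℂ)), ?_, ?_⟩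
  · rw [Polynomial.degree_lt_iff_coeff_zero]
    intro m hm
    rw [Polynomial.finsetSum_coeff]
    apply Finset.sum_eq_zero
    intro n hn
    rw [Polynomial.coeff_monomial, if_neg]
    have := Finset.mem_range.1 hn; omega
  · ext n
    rw [xp, Polynomial.finsetSum_coeff]
    simp only [Polynomial.coeff_monomial, Finset.sum_ite_eq', Finset.mem_range]
    split_ifs
    · have := exp_cancel (β * (n : ℝ) ^ 2 / 2)
      linear_combination x n * this
    · simp

lemma N4_tail (x : ℕ → ℂ) (K : ℕ) : N4 (fun n => if n < K then 0 else x n) = ∑' n, ‖x (n + K)‖ₑ ^ 4 := by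
  unfold N4
  rw [← ENNReal.summable.sum_add_tsum_nat_add' (k := K) (f := fun n => ‖(if n < K then (0:ℂ) else x n)‖ₑ ^ 4)]
  rw [Finset.sum_eq_zero]
  · simp
  · intro n hn; rw [if_pos (Finset.mem_range.1 hn)]; simp

lemma N4_tail_tendsto {x : ℕ → ℂ} (h : N4 x ≠ ⊤) :
    Filter.Tendsto (fun K : ℕ => N4 (fun n => if n < K then 0 else x n)) Filter.atTop (nhds 0) := by
  simp_rw [N4_tail]
  exact ENNReal.tendsto_sum_nat_add (fun n => ‖x n‖ₑ ^ 4) h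

lemma N4_le_of_partial {x : ℕ → ℂ} {R : ℝ≥0∞} (h : ∀ m : ℕ, ∑ n ∈ Finset.range m, ‖x n‖ₑ ^ 4 ≤ R) : N4 x ≤ R := by
  unfold N4
  rw [ENNReal.tsum_eq_iSup_nat]
  exact iSup_le h

lemma lower_all {β : ℝ} (hβ : 0 < β) {τ : ℕ → ℝ} {μ : ℕ → ℂ} (hμ : ∀ k, ‖μ k‖ = Real.exp (β * τ k))
    {D C : NNReal}
    (hD : ∀ (K : ℕ) (p : Polynomial ℂ), p.degree < K → N4 (xp β p) ≤ D * N4 (fun k => mv β (τ k) (μ k) (xp β p)))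
    (hC : ∀ x : ℕ → ℂ, N4 (fun k => mv β (τ k) (μ k) x) ≤ C * N4 x) (x : ℕ → ℂ) (hx : N4 x ≠ ⊤) :
    N4 x ≤ (D * 8 : NNReal) * N4 (fun k => mv β (τ k) (μ k) x) := by
  apply N4_le_of_partial
  intro m
  have key : ∀ K : ℕ, m ≤ K → ∑ n ∈ Finset.range m, ‖x n‖ₑ ^ 4 ≤ D * (8 * (N4 (fun k => mv β (τ k) (μ k) x) +
      C * N4 (fun n => if n < K then 0 else x n))) := by
    intro K hK
    obtain ⟨p, hp, hpx⟩ := exists_poly β x K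
    have h1 := hD K p hp
    have h2 : ∑ n ∈ Finset.range m, ‖x n‖ₑ ^ 4 ≤ N4 (xp β p) := by
      rw [hpx]
      refine le_trans (le_of_eq ?_) (ENNReal.sum_le_tsum (Finset.range m))
      apply Finset.sum_congr rfl
      intro n hn
      beta_reduce
      rw [if_pos (by have := Finset.mem_range.1 hn; omega)]
    refine h2.trans (h1.trans ?_)
    gcongr
    have htail : N4 (fun n => (-1 : ℂ) * (if n < K then 0 else x n)) ≠ ⊤ := by
      apply N4_mul_ne_top
      refine ne_top_of_le_ne_top hx (N4_mono fun n => ?_)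
      split_ifs <;> simp
    have e : xp β p = fun n => x n + (-1 : ℂ) * (if n < K then 0 else x n) := by
      rw [hpx]; ext n; split_ifs <;> simp
    rw [e]
    have e2 : (fun k => mv β (τ k) (μ k) (fun n => x n + (-1 : ℂ) * (if n < K then 0 else x n))) =
        fun k => mv β (τ k) (μ k) x + mv β (τ k) (μ k) (fun n => (-1 : ℂ) * (if n < K then 0 else x n)) := by
      ext k; exact mv_add hβ (hμ k) hx htail
    rw [e2]
    refine (N4_add _ _).trans ?_
    gcongr
    refine (hC _).trans ?_
    rw [N4_const_mul]; simp
  have ht : Filter.Tendsto (fun K : ℕ => (D : ℝ≥0∞) * (8 * (N4 (fun k => mv β (τ k) (μ k) x) +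
      C * N4 (fun n => if n < K then 0 else x n)))) Filter.atTop (nhds (D * (8 * (N4 (fun k => mv β (τ k) (μ k) x) + C * 0)))) := by
    apply ENNReal.Tendsto.const_mul _ (Or.inr ENNReal.coe_ne_top)
    apply ENNReal.Tendsto.const_mul _ (Or.inr (by norm_num))
    apply Filter.Tendsto.const_add
    exact ENNReal.Tendsto.const_mul (N4_tail_tendsto hx) (Or.inr ENNReal.coe_ne_top)
  have := ge_of_tendsto ht (Filter.eventually_atTop.2 ⟨m, key⟩)
  refine this.trans (le_of_eq ?_)
  push_cast; ring

lemma interp_all {β : ℝ} (hβ : 0 < β) {τ : ℕ → ℝ} {μ : ℕ → ℂ} (hμ : ∀ k, ‖μ k‖ = Real.exp (β * τ k))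
    (hinj : Function.Injective μ) {D : NNReal}
    (hD : ∀ (K : ℕ) (v : ℕ → ℂ),
      N4 (fun n => if n < K then ∑ k ∈ Finset.range K, BB β τ μ K n k * v k else 0) ≤ D * N4 v)
    (v : ℕ → ℂ) (hv : N4 v ≠ ⊤) : ∃ x : ℕ → ℂ, N4 x ≠ ⊤ ∧ ∀ k, mv β (τ k) (μ k) x = v k := by
  set p : ℕ → Polynomial ℂ := fun K => Lagrange.interpolate (Finset.range K) μ (fun k => v k * (Real.exp (β * (τ k) ^ 2 / 2) : ℂ)) with hp
  set X : ℕ → ℕ → ℂ := fun K => xp β (p K) with hX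
  have hdeg : ∀ K, (p K).degree < K := fun K => by
    have := Lagrange.degree_interpolate_lt (s := Finset.range K) (v := μ) (fun k => v k * (Real.exp (β * (τ k) ^ 2 / 2) : ℂ)) hinj.injOn
    rwa [Finset.card_range] at this
  have hR : (D : ℝ≥0∞) * N4 v ≠ ⊤ := ENNReal.mul_ne_top ENNReal.coe_ne_top hv
  have hXN : ∀ K, N4 (X K) ≤ D * N4 v := by
    intro K
    refine le_trans (le_of_eq ?_) (hD K v)
    congr 1; ext n
    split_ifs with hn
    · rw [← interp_coeff]
    · exact xp_eq_zero β (hdeg K) (not_lt.1 hn)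
  have hmvX : ∀ k K, k < K → mv β (τ k) (μ k) (X K) = v k := by
    intro k K hk
    rw [hX, mv_xp, hp]
    simp only
    rw [Lagrange.eval_interpolate_at_node _ hinj.injOn (by simpa using hk)]
    have := exp_cancel (β * τ k ^ 2 / 2)
    linear_combination v k * this
  set A := ((D : ℝ≥0∞) * N4 v).toReal + 1
  have hA : ∀ K n, ‖X K n‖ ≤ A := fun K n =>
    N4_bdd' (by positivity) (by rw [ENNReal.ofReal_toReal hR]; exact hXN K) n
  have hlim : ∀ n, ∃ y : ℂ, Filter.Tendsto (fun K => X K n) (Filter.hyperfilter ℕ : Filter ℕ) (nhds y) := by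
    intro n
    have hc : IsCompact (Metric.closedBall (0 : ℂ) A) := isCompact_closedBall _ _
    obtain ⟨y, _, hy⟩ := hc.ultrafilter_le_nhds ((Filter.hyperfilter ℕ).map (fun K => X K n)) (by
      rw [Ultrafilter.coe_map, Filter.le_principal_iff, Filter.mem_map]
      apply Filter.univ_mem'
      intro K; simpa using hA K n)
    exact ⟨y, hy⟩
  choose y hy using hlim
  have hle : (Filter.hyperfilter ℕ : Filter ℕ) ≤ Filter.atTop := by
    rw [← Nat.cofinite_eq_atTop]; exact Filter.hyperfilter_le_cofinite
  refine ⟨y, ne_top_of_le_ne_top hR (N4_le_of_partial fun m => ?_), fun k => ?_⟩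
  · have ht : Filter.Tendsto (fun K => ∑ n ∈ Finset.range m, ‖X K n‖ₑ ^ 4) (Filter.hyperfilter ℕ : Filter ℕ)
        (nhds (∑ n ∈ Finset.range m, ‖y n‖ₑ ^ 4)) := by
      apply tendsto_finsetSum
      intro n _
      exact ((ENNReal.continuous_pow 4).tendsto _).comp ((continuous_enorm.tendsto _).comp (hy n))
    apply le_of_tendsto' ht
    intro K
    exact (ENNReal.sum_le_tsum _).trans (hXN K)
  · obtain ⟨G, hG0, hG⟩ := mv_bound β hβ
    have hs := (hG (τ k) (μ k) (fun _ => (A : ℂ)) A (hμ k) (by positivity) (fun _ => by rw [Complex.norm_real, Real.norm_of_nonneg (by positivity)])).1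
    have ht : Filter.Tendsto (fun K => mv β (τ k) (μ k) (X K)) (Filter.hyperfilter ℕ : Filter ℕ) (nhds (mv β (τ k) (μ k) y)) := by
      unfold mv
      apply tendsto_tsum_of_dominated_convergence hs
      · intro n
        exact (hy n).mul_const _
      · apply Filter.Eventually.of_forall
        intro K n
        rw [norm_mul, norm_mul]
        gcongr
        refine (hA K n).trans ?_
        simp [le_abs_self]
    refine tendsto_nhds_unique ht ?_
    apply tendsto_const_nhds.congr'
    apply hle
    filter_upwards [Filter.eventually_gt_atTop k] with K hK
    exact (hmvX k K hK).symm

theorem sufficiency {β : ℝ} (hβ : 0 < β) {τ : ℕ → ℝ} {μ : ℕ → ℂ} (hμ : ∀ k, ‖μ k‖ = Real.exp (β * τ k))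
    (hinj : Function.Injective μ)
    {E : ℝ} (hE : ∀ j, |τ j - j| ≤ E) {ε : ℝ} (hε : 0 < ε) (hsep : ∀ j k, j ≠ k → ε * ‖μ k‖ ≤ ‖μ j - μ k‖)
    {c Ca : ℝ} (hc : 0 < c) (havg : ∀ k m : ℕ, k ≤ m → |Ep τ m - Ep τ k| ≤ (1 / 2 - c) * (m - k) + Ca) :
    CISm β τ μ := by
  obtain ⟨C0, hC0⟩ := BB_bound hβ hμ hE hε hsep havg
  obtain ⟨D, hD⟩ := BB_schur (mul_pos hβ hc) hC0
  obtain ⟨G', hG'⟩ := kern_tau hE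
  obtain ⟨C, hC⟩ := mv_upper hβ hμ (fun n => hG' n)
  refine ⟨⟨D * 8 + C, fun x hx => ⟨?_, ?_⟩⟩, interp_all hβ hμ hinj hD⟩
  · refine (lower_all hβ hμ (poly_lower hinj hD) hC x hx).trans ?_
    gcongr
    exact le_self_add
  · refine (hC x).trans ?_
    gcongr
    exact le_add_self



lemma near_nat {τ : ℕ → ℝ} (hmono : Monotone τ) (k : ℕ) : |τ k - ⌈τ k⌉₊| ≤ 1 + |τ 0| := by
  have h0 := abs_nonneg (τ 0)
  rcases le_or_gt 0 (τ k) with h | h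
  · have h1 := Nat.le_ceil (τ k)
    have h2 := Nat.ceil_lt_add_one h
    rw [abs_le]; constructor <;> linarith
  · rw [Nat.ceil_eq_zero.2 h.le]
    have h1 := hmono (Nat.zero_le k)
    have h2 := neg_abs_le (τ 0)
    rw [abs_le]; constructor <;> push_cast <;> linarith

lemma kern_nec {β : ℝ} (hβ : 0 < β) {τ : ℕ → ℝ} {μ : ℕ → ℂ} (hμ : ∀ k, ‖μ k‖ = Real.exp (β * τ k)) (hmono : Monotone τ)
    {C : NNReal} (hC : ∀ x : ℕ → ℂ, N4 x ≠ ⊤ → N4 (fun k => mv β (τ k) (μ k) x) ≤ C * N4 x) (a : ℝ) (ha : 0 < a) :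
    ∃ G : NNReal, ∀ t : ℝ, ∑' k, kap a (τ k - t) ≤ G := by
  obtain ⟨G, hG⟩ := kern_sum a ha
  have h1 : ∀ n : ℕ, ∑' k, ENNReal.ofReal (Real.exp (-(2 * β * (τ k - n) ^ 2))) ≤ C := by
    intro n
    have := hC (fun i => if i = n then 1 else 0) (by rw [N4_single]; simp)
    rw [N4_single] at this
    simp only [enorm_one, one_pow, mul_one] at this
    refine le_trans (le_of_eq ?_) this
    unfold N4
    congr 1; ext k
    beta_reduce
    rw [mv_single, one_mul, ← ofReal_norm, norm_MM (hμ k), ← ENNReal.ofReal_pow (Real.exp_pos _).le, ← Real.exp_nat_mul]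
    congr 2; push_cast; ring
  set M := 1 + |τ 0|
  set D := Real.exp (a * M + 2 * β * M ^ 2)
  refine ⟨D.toNNReal * (C * G), fun t => ?_⟩
  push_cast
  change _ ≤ ENNReal.ofReal D * _
  have h2 : ∀ k, kap a (τ k - t) ≤ ∑' n : ℕ, ENNReal.ofReal D * (ENNReal.ofReal (Real.exp (-(2 * β * (τ k - n) ^ 2))) * kap a (t - n)) := by
    intro k
    refine le_trans ?_ (ENNReal.le_tsum ⌈τ k⌉₊)
    have hM := near_nat hmono k
    rw [kap, kap, ← ENNReal.ofReal_mul (Real.exp_pos _).le, ← ENNReal.ofReal_mul (Real.exp_pos _).le, ← Real.exp_add, ← Real.exp_add]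
    apply ENNReal.ofReal_le_ofReal
    apply Real.exp_le_exp.2
    have h3 : (τ k - ⌈τ k⌉₊) ^ 2 ≤ M ^ 2 := by
      rw [← sq_abs]; gcongr
    have h4 : |t - (⌈τ k⌉₊ : ℝ)| ≤ |τ k - t| + M := by
      calc |t - (⌈τ k⌉₊ : ℝ)| = |-(τ k - t) + (τ k - ⌈τ k⌉₊)| := by congr 1; ring
        _ ≤ |-(τ k - t)| + |τ k - ⌈τ k⌉₊| := abs_add_le _ _
        _ ≤ _ := by rw [abs_neg]; linarith
    have := mul_le_mul_of_nonneg_left h4 ha.le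
    have := mul_le_mul_of_nonneg_left h3 hβ.le
    nlinarith
  calc ∑' k, kap a (τ k - t) ≤ ∑' k, ∑' n : ℕ, ENNReal.ofReal D * (ENNReal.ofReal (Real.exp (-(2 * β * (τ k - n) ^ 2))) * kap a (t - n)) :=
        ENNReal.tsum_le_tsum h2
    _ = ∑' n : ℕ, ∑' k, ENNReal.ofReal D * (ENNReal.ofReal (Real.exp (-(2 * β * (τ k - n) ^ 2))) * kap a (t - n)) := ENNReal.tsum_comm
    _ = ENNReal.ofReal D * ∑' n : ℕ, (∑' k, ENNReal.ofReal (Real.exp (-(2 * β * (τ k - n) ^ 2)))) * kap a (t - n) := by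
        simp_rw [ENNReal.tsum_mul_left, ENNReal.tsum_mul_right]
    _ ≤ ENNReal.ofReal D * ∑' n : ℕ, C * kap a (t - n) := by gcongr; exact h1 _
    _ ≤ _ := by rw [ENNReal.tsum_mul_left]; gcongr; exact hG t

lemma one_sub_exp_abs (a : ℝ) : |1 - Real.exp a| ≤ |a| * Real.exp |a| := by
  have h1 := Real.add_one_le_exp a
  have h2 := Real.add_one_le_exp (-a)
  have h3 : Real.exp a * Real.exp (-a) = 1 := by rw [← Real.exp_add]; simp
  have h4 := Real.exp_pos a
  rcases le_total 0 a with h | h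
  · rw [abs_of_nonneg h, abs_of_nonpos (by linarith)]
    nlinarith
  · rw [abs_of_nonpos h, abs_of_nonneg (by linarith [Real.exp_le_one_iff.2 h])]
    nlinarith [Real.exp_pos (-a), Real.one_le_exp_iff.2 (neg_nonneg.2 h)]

lemma perturb {β : ℝ} (hβ : 0 < β) {τ : ℕ → ℝ} {μ : ℕ → ℂ} (hμ : ∀ k, ‖μ k‖ = Real.exp (β * τ k))
    {C G' : NNReal} (hC : ∀ x : ℕ → ℂ, N4 x ≠ ⊤ → N4 x ≤ C * N4 (fun k => mv β (τ k) (μ k) x))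
    (hG' : ∀ t : ℝ, ∑' k, kap 1 (τ k - t) ≤ G') :
    ∃ c0 : ℝ, 0 < c0 ∧ c0 ≤ 1 ∧ ∃ C' : NNReal, ∀ w : ℝ → ℝ, (∀ s t, |w s - w t| ≤ c0 * |s - t|) →
      ∀ x : ℕ → ℂ, N4 x ≠ ⊤ → N4 (fun n : ℕ => (Real.exp (w n) : ℂ) * x n) ≠ ⊤ →
      N4 (fun n : ℕ => (Real.exp (w n) : ℂ) * x n) ≤ C' * N4 (fun k => (Real.exp (w (τ k)) : ℂ) * mv β (τ k) (μ k) x) := by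
  obtain ⟨G, hG⟩ := kern_sum 1 one_pos
  set D : ℝ := Real.exp (3 ^ 2 / (2 * β)) with hD
  have hD0 : 0 < D := Real.exp_pos _
  set Q : ℝ := 16 * C * D ^ 4 * (G ^ 3 * G') + 1 with hQ
  have hQ1 : 1 ≤ Q := by rw [hQ]; have : (0:ℝ) ≤ 16 * C * D ^ 4 * (G ^ 3 * G') := by positivity
                         linarith
  refine ⟨1 / Q, by positivity, by rw [div_le_one (by linarith)]; exact hQ1, 16 * C, fun w hw x hx hy => ?_⟩
  set c0 := 1 / Q with hc0
  have hc0p : 0 < c0 := by positivity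
  have hc01 : c0 ≤ 1 := by rw [hc0, div_le_one (by linarith)]; exact hQ1
  set y : ℕ → ℂ := fun n => (Real.exp (w n) : ℂ) * x n with hydef
  set R : ℕ → ℂ := fun k => mv β (τ k) (μ k) y - (Real.exp (w (τ k)) : ℂ) * mv β (τ k) (μ k) x with hR
  have hRb : ∀ k, ‖R k‖ₑ ≤ ∑' n : ℕ, ENNReal.ofReal (c0 * D) * kap 1 (τ k - n) * ‖y n‖ₑ := by
    intro k
    have e : R k = ∑' n : ℕ, ((1 - Real.exp (w (τ k) - w n) : ℝ) : ℂ) * y n * MM β (τ k) (μ k) n := by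
      rw [hR]; simp only
      rw [mv, mv, ← tsum_mul_left, ← (summable_mv hβ (hμ k) hy).tsum_sub ((summable_mv hβ (hμ k) hx).mul_left _)]
      congr 1; ext n
      have : (Real.exp (w (τ k)) : ℂ) = (Real.exp (w (τ k) - w n) : ℂ) * (Real.exp (w n) : ℂ) := by
        rw [← Complex.ofReal_mul, ← Real.exp_add]; congr 2; ring
      rw [this, hydef]; push_cast; ring
    rw [e]
    refine (enorm_tsum_le_tsum_enorm).trans ?_
    apply ENNReal.tsum_le_tsum
    intro n
    rw [enorm_mul, enorm_mul, mul_right_comm]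
    gcongr ?_ * _
    rw [kap, ← ENNReal.ofReal_mul (by positivity), ← ofReal_norm, ← ofReal_norm, norm_MM (hμ k), ← ENNReal.ofReal_mul (norm_nonneg _), Complex.norm_real, Real.norm_eq_abs]
    apply ENNReal.ofReal_le_ofReal
    set u := |τ k - n| with hu
    have hu0 : 0 ≤ u := abs_nonneg _
    have h1 := one_sub_exp_abs (w (τ k) - w n)
    have h2 := hw (τ k) n
    have h3 : |1 - Real.exp (w (τ k) - w n)| ≤ c0 * Real.exp (2 * u) := by
      calc _ ≤ |w (τ k) - w n| * Real.exp |w (τ k) - w n| := h1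
        _ ≤ (c0 * u) * Real.exp u := by
            gcongr
            exact h2.trans (by nlinarith)
        _ ≤ (c0 * Real.exp u) * Real.exp u := by
            gcongr; linarith [Real.add_one_le_exp u]
        _ = _ := by rw [mul_assoc, ← Real.exp_add]; congr 2; ring
    have h4 := gauss_le_exp β 3 hβ (τ k - n)
    calc _ ≤ (c0 * Real.exp (2 * u)) * (D * Real.exp (-(3 * u))) := by gcongr
      _ = c0 * D * (Real.exp (2 * u) * Real.exp (-(3 * u))) := by ring
      _ = _ := by rw [← Real.exp_add]; congr 2; ring
  have hRN := schur_kap hG (fun n => hG' n) y R hRb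
  have hyC := hC y hy
  have hsplit : N4 (fun k => mv β (τ k) (μ k) y) ≤ 8 * (N4 (fun k => (Real.exp (w (τ k)) : ℂ) * mv β (τ k) (μ k) x) + N4 R) := by
    refine le_trans (le_of_eq ?_) (N4_add _ _)
    congr 1; ext k; simp [hR]
  set P := N4 (fun k => (Real.exp (w (τ k)) : ℂ) * mv β (τ k) (μ k) x)
  have hsmall : (C : ℝ≥0∞) * 8 * (ENNReal.ofReal (c0 * D) ^ 4 * (G ^ 3 * G')) ≤ 1 / 2 := by
    have e1 : (C : ℝ≥0∞) * 8 * (ENNReal.ofReal (c0 * D) ^ 4 * (G ^ 3 * G')) = ENNReal.ofReal (C * 8 * ((c0 * D) ^ 4 * (G ^ 3 * G'))) := by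
      have e3 : ∀ c : NNReal, (c : ℝ≥0∞) = ENNReal.ofReal c := fun c => (ENNReal.ofReal_coe_nnreal).symm
      have e4 : (8 : ℝ≥0∞) = ENNReal.ofReal 8 := by simp
      rw [e3, e3, e3, e4, ← ENNReal.ofReal_pow (by positivity), ← ENNReal.ofReal_pow (by positivity), ← ENNReal.ofReal_mul (by positivity),
        ← ENNReal.ofReal_mul (by positivity), ← ENNReal.ofReal_mul (by positivity), ← ENNReal.ofReal_mul (by positivity)]
    have e2 : (1 / 2 : ℝ≥0∞) = ENNReal.ofReal (1 / 2) := by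
      rw [ENNReal.ofReal_div_of_pos (by norm_num)]; simp
    rw [e1, e2]
    apply ENNReal.ofReal_le_ofReal
    have h5 : c0 ^ 4 ≤ c0 := by
      calc c0 ^ 4 ≤ c0 ^ 1 := pow_le_pow_of_le_one hc0p.le hc01 (by norm_num)
        _ = c0 := pow_one _
    have h6 : c0 * Q = 1 := by rw [hc0]; field_simp
    have h7 : (0:ℝ) ≤ 16 * C * D ^ 4 * (G ^ 3 * G') := by positivity
    calc C * 8 * ((c0 * D) ^ 4 * (G ^ 3 * G')) = c0 ^ 4 * (16 * C * D ^ 4 * (G ^ 3 * G')) / 2 := by ring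
      _ ≤ c0 * (16 * C * D ^ 4 * (G ^ 3 * G')) / 2 := by gcongr
      _ ≤ 1 / 2 := by nlinarith
  have hfin : N4 y ≤ C * 8 * P + 1 / 2 * N4 y := by
    calc N4 y ≤ C * (8 * (P + ENNReal.ofReal (c0 * D) ^ 4 * (G ^ 3 * G') * N4 y)) := by
          refine hyC.trans ?_
          gcongr
          refine hsplit.trans ?_
          gcongr
      _ = C * 8 * P + C * 8 * (ENNReal.ofReal (c0 * D) ^ 4 * (G ^ 3 * G')) * N4 y := by ring
      _ ≤ _ := by gcongr
  have hhalf : N4 y = 1 / 2 * N4 y + 1 / 2 * N4 y := by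
    rw [← add_mul, ENNReal.add_halves, one_mul]
  have hhne : 1 / 2 * N4 y ≠ ⊤ := ENNReal.mul_ne_top (by simp) hy
  have h8 : 1 / 2 * N4 y ≤ C * 8 * P := by
    rw [hhalf] at hfin
    conv at hfin => rhs; rw [← hhalf]
    exact (ENNReal.add_le_add_iff_right hhne).1 hfin
  rw [hhalf]
  calc _ ≤ C * 8 * P + C * 8 * P := add_le_add h8 h8
    _ = _ := by push_cast; ring

lemma exists_dual {β : ℝ} {τ : ℕ → ℝ} {μ : ℕ → ℂ} 
    {C : NNReal} (hC : ∀ x : ℕ → ℂ, N4 x ≠ ⊤ → N4 x ≤ C * N4 (fun k => mv β (τ k) (μ k) x))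
    (hI : ∀ v : ℕ → ℂ, N4 v ≠ ⊤ → ∃ x : ℕ → ℂ, N4 x ≠ ⊤ ∧ ∀ k, mv β (τ k) (μ k) x = v k) :
    ∃ b : ℕ → ℕ → ℂ, (∀ k, N4 (b k) ≠ ⊤) ∧ (∀ k j, mv β (τ j) (μ j) (b k) = if j = k then 1 else 0) ∧
      ∀ k n, ‖b k n‖ ≤ C + 1 := by
  have h := fun k : ℕ => hI (fun j => if j = k then 1 else 0) (by rw [N4_single]; simp)
  choose b hb1 hb2 using h
  refine ⟨b, hb1, hb2, fun k n => ?_⟩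
  apply N4_bdd' (by positivity)
  refine (hC _ (hb1 k)).trans ?_
  have e : (fun j => mv β (τ j) (μ j) (b k)) = fun j => if j = k then 1 else 0 := by ext j; exact hb2 k j
  rw [e, N4_single]; simp



lemma pow_sub_one_bound {v : ℂ} {d : ℝ} (hv : ‖v‖ ≤ 2) (hd : ‖v - 1‖ ≤ d) (l : ℕ) : ‖v ^ l - 1‖ ≤ d * 4 ^ l := by
  have hd0 : 0 ≤ d := (norm_nonneg _).trans hd
  induction l with
  | zero => simpa using hd0
  | succ l ih =>
    have e : v ^ (l + 1) - 1 = v * (v ^ l - 1) + (v - 1) := by ring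
    rw [e]
    refine (norm_add_le _ _).trans ?_
    rw [norm_mul]
    have h1 : (1 : ℝ) ≤ 4 ^ l := one_le_pow₀ (by norm_num)
    have h2 : ‖v‖ * ‖v ^ l - 1‖ ≤ 2 * (d * 4 ^ l) := by gcongr
    rw [pow_succ]
    nlinarith

lemma zpow_sub_one_bound {w : ℂ} (hw : ‖w - 1‖ ≤ 1 / 2) (l : ℤ) :
    ‖1 - w ^ l‖ ≤ 2 * ‖w - 1‖ * Real.exp (2 * |(l : ℝ)|) := by
  have h0 := norm_nonneg (w - 1)
  have hw1 : ‖w‖ ≤ 2 := by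
    calc ‖w‖ = ‖(w - 1) + 1‖ := by congr 1; ring
      _ ≤ ‖w - 1‖ + ‖(1 : ℂ)‖ := norm_add_le _ _
      _ ≤ 2 := by rw [norm_one]; linarith
  have hw2 : 1 / 2 ≤ ‖w‖ := by
    have : ‖(1 : ℂ)‖ ≤ ‖w‖ + ‖w - 1‖ := by
      calc ‖(1 : ℂ)‖ = ‖w - (w - 1)‖ := by congr 1; ring
        _ ≤ _ := norm_sub_le _ _
    rw [norm_one] at this; linarith
  have hwne : w ≠ 0 := by rintro rfl; norm_num at hw2
  have he : ∀ n : ℕ, (4 : ℝ) ^ n ≤ Real.exp (2 * n) := by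
    intro n
    rw [mul_comm, Real.exp_nat_mul]
    gcongr
    have h1 := Real.quadratic_le_exp_of_nonneg (x := 2) (by norm_num)
    linarith
  rw [norm_sub_rev]
  obtain ⟨n, rfl | rfl⟩ := l.eq_nat_or_neg
  · rw [zpow_natCast]
    have := pow_sub_one_bound hw1 (d := 2 * ‖w - 1‖) (by linarith) n
    refine this.trans ?_
    rw [Int.cast_natCast, abs_of_nonneg (Nat.cast_nonneg n)]
    gcongr
    exact he n
  · rw [zpow_neg, zpow_natCast, ← inv_pow]
    have h1 : ‖w⁻¹‖ ≤ 2 := by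
      rw [norm_inv, inv_le_comm₀ (by linarith) (by norm_num)]; linarith
    have h2 : ‖w⁻¹ - 1‖ ≤ 2 * ‖w - 1‖ := by
      have : w⁻¹ - 1 = w⁻¹ * -(w - 1) := by field_simp; ring
      rw [this, norm_mul, norm_neg]; gcongr
    have := pow_sub_one_bound h1 h2 n
    refine this.trans ?_
    push_cast
    rw [abs_neg, abs_of_nonneg (Nat.cast_nonneg n)]
    gcongr
    exact he n

lemma sep_nec {β : ℝ} (hβ : 0 < β) {τ : ℕ → ℝ} {μ : ℕ → ℂ} (hμ : ∀ k, ‖μ k‖ = Real.exp (β * τ k)) (hmono : Monotone τ)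
    {b : ℕ → ℕ → ℂ} {B : ℝ} (hbN : ∀ k, N4 (b k) ≠ ⊤) (hb : ∀ k j, mv β (τ j) (μ j) (b k) = if j = k then 1 else 0)
    (hB : ∀ k n, ‖b k n‖ ≤ B) :
    ∃ ε : ℝ, 0 < ε ∧ ∀ j k, j ≠ k → ε * ‖μ k‖ ≤ ‖μ j - μ k‖ := by
  obtain ⟨G, hG0, hG⟩ := kern_sum_real 1 one_pos
  have hB0 : 0 ≤ B := (norm_nonneg _).trans (hB 0 0)
  set M := 1 + |τ 0| with hM
  have hM0 : 0 < M := by positivity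
  set D : ℝ := Real.exp (3 ^ 2 / (2 * β))
  set Q : ℝ := (B + 1) * (2 * Real.exp (2 * M) * D * G) with hQ
  have hQ0 : 0 < Q := by positivity
  refine ⟨min (1 / 2) (1 / Q), by positivity, fun j k hjk => ?_⟩
  have hμk : 0 < ‖μ k‖ := by rw [hμ]; exact Real.exp_pos _
  have hμkne : μ k ≠ 0 := norm_pos_iff.1 hμk
  have hμjne : μ j ≠ 0 := norm_pos_iff.1 (by rw [hμ]; exact Real.exp_pos _)
  set w := μ j / μ k with hw
  have hwne : w ≠ 0 := div_ne_zero hμjne hμkne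
  have e1 : ‖μ j - μ k‖ = ‖w - 1‖ * ‖μ k‖ := by
    rw [← norm_mul]; congr 1; rw [hw]; field_simp
  rw [e1]
  gcongr
  by_cases hc : ‖w - 1‖ ≤ 1 / 2
  · refine (min_le_right _ _).trans ?_
    rw [div_le_iff₀ hQ0]
    set m := ⌈τ k⌉₊
    have hm := near_nat hmono k
    have h1 := hb k k
    have h2 := hb k j
    rw [if_pos rfl] at h1
    rw [if_neg hjk] at h2
    have hs1 := summable_mv hβ (hμ k) (hbN k)
    have hs2 := summable_mv hβ (hμ j) (hbN k)
    have e2 : ∀ n : ℕ, b k n * MM β (τ k) (μ k) n * w ^ ((n : ℤ) - m) =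
        ((Real.exp (-(β * τ k ^ 2 / 2)) : ℂ) * (Real.exp (β * τ j ^ 2 / 2) : ℂ) * w ^ (-(m : ℤ))) * (b k n * MM β (τ j) (μ j) n) := by
      intro n
      rw [sub_eq_add_neg, zpow_add₀ hwne, zpow_natCast, MM, MM, hw, div_pow]
      have := exp_cancel (β * τ j ^ 2 / 2)
      have hpk : μ k ^ n ≠ 0 := pow_ne_zero _ hμkne
      field_simp
      linear_combination (-b k n) * this
    have hs3 : Summable (fun n : ℕ => b k n * MM β (τ k) (μ k) n * w ^ ((n : ℤ) - m)) := by
      simp_rw [e2]; exact hs2.mul_left _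
    have hz : ∑' n : ℕ, b k n * MM β (τ k) (μ k) n * w ^ ((n : ℤ) - m) = 0 := by
      simp_rw [e2]; rw [tsum_mul_left]
      change _ * mv β (τ j) (μ j) (b k) = 0
      rw [h2, mul_zero]
    have h3 : (1 : ℂ) = ∑' n : ℕ, b k n * MM β (τ k) (μ k) n * (1 - w ^ ((n : ℤ) - m)) := by
      calc (1 : ℂ) = mv β (τ k) (μ k) (b k) - 0 := by rw [h1, sub_zero]
        _ = _ := by
          rw [← hz, mv, ← hs1.tsum_sub hs3]; congr 1; ext n; ring
    have hbound : ∀ n : ℕ, ‖b k n * MM β (τ k) (μ k) n * (1 - w ^ ((n : ℤ) - m))‖ ≤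
        (B * (2 * Real.exp (2 * M) * D) * ‖w - 1‖) * Real.exp (-(1 * |τ k - n|)) := by
      intro n
      rw [norm_mul, norm_mul, norm_MM (hμ k)]
      have h4 := zpow_sub_one_bound hc ((n : ℤ) - m)
      have h5 := gauss_le_exp β 3 hβ (τ k - n)
      set u := |τ k - n|
      have h6 : Real.exp (2 * |(((n : ℤ) - m : ℤ) : ℝ)|) ≤ Real.exp (2 * M) * Real.exp (2 * u) := by
        rw [← Real.exp_add]
        apply Real.exp_le_exp.2
        push_cast
        have : |(n : ℝ) - m| ≤ u + M := by
          calc |(n : ℝ) - m| = |(τ k - m) - (τ k - n)| := by congr 1; ring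
            _ ≤ |τ k - m| + |τ k - n| := abs_sub _ _
            _ ≤ _ := by linarith
        linarith
      calc _ ≤ B * (D * Real.exp (-(3 * u))) * (2 * ‖w - 1‖ * (Real.exp (2 * M) * Real.exp (2 * u))) := by
            gcongr
            · exact hB k n
            · exact h4.trans (by gcongr)
        _ = (B * (2 * Real.exp (2 * M) * D) * ‖w - 1‖) * (Real.exp (-(3 * u)) * Real.exp (2 * u)) := by ring
        _ = _ := by rw [← Real.exp_add]; congr 2; ring
    have hsb := ((hG (τ k)).1.mul_left (B * (2 * Real.exp (2 * M) * D) * ‖w - 1‖))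
    have hsn : Summable (fun n : ℕ => ‖b k n * MM β (τ k) (μ k) n * (1 - w ^ ((n : ℤ) - m))‖) :=
      Summable.of_nonneg_of_le (fun _ => norm_nonneg _) hbound hsb
    have h7 : (1 : ℝ) ≤ (B * (2 * Real.exp (2 * M) * D) * ‖w - 1‖) * G := by
      calc (1 : ℝ) = ‖(1 : ℂ)‖ := norm_one.symm
        _ ≤ ∑' n : ℕ, ‖b k n * MM β (τ k) (μ k) n * (1 - w ^ ((n : ℤ) - m))‖ := by
            have h8 := norm_tsum_le_tsum_norm hsn
            rwa [← h3] at h8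
        _ ≤ _ := hsn.tsum_le_tsum hbound hsb
        _ = _ := tsum_mul_left
        _ ≤ _ := by gcongr; exact (hG _).2
    refine h7.trans ?_
    rw [hQ]
    have : 0 ≤ 2 * Real.exp (2 * M) * D * G * ‖w - 1‖ := by positivity
    nlinarith
  · push Not at hc
    exact (min_le_left _ _).trans hc.le

lemma kern_tsum_real {τ : ℕ → ℝ} {a : ℝ} {G : NNReal} (hG : ∀ t : ℝ, ∑' k, kap a (τ k - t) ≤ G) (t : ℝ) :
    Summable (fun k => Real.exp (-(a * |τ k - t|))) ∧ ∑' k, Real.exp (-(a * |τ k - t|)) ≤ G := by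
  have hne : ∑' k, kap a (τ k - t) ≠ ⊤ := ne_top_of_le_ne_top ENNReal.coe_ne_top (hG t)
  have hs : Summable (fun k => Real.exp (-(a * |τ k - t|))) := by
    have := ENNReal.summable_toReal hne
    refine this.congr (fun n => ?_)
    simp [kap, (Real.exp_pos _).le]
  refine ⟨hs, ?_⟩
  have h2 : ∑' k, kap a (τ k - t) = ENNReal.ofReal (∑' k, Real.exp (-(a * |τ k - t|))) := by
    rw [ENNReal.ofReal_tsum_of_nonneg (fun _ => (Real.exp_pos _).le) hs]; rfl
  have h3 := hG t
  rw [h2] at h3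
  have h4 := ENNReal.toReal_mono ENNReal.coe_ne_top h3
  rw [ENNReal.toReal_ofReal (tsum_nonneg (fun _ => (Real.exp_pos _).le))] at h4
  simpa using h4

/-- tail of a series -/
lemma tail_bound {f : ℕ → ℂ} {g : ℕ → ℝ} {S : ℂ} {A : ℝ} (hf : HasSum f S) (hg : Summable g) (hgA : ∑' n, g n ≤ A) (hg0 : ∀ n, 0 ≤ g n)
    (L : ℕ) (h : ∀ n, L ≤ n → ‖f n‖ ≤ g n) : ‖S - ∑ n ∈ Finset.range L, f n‖ ≤ A := by
  have h1 := hf.summable.sum_add_tsum_nat_add L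
  rw [hf.tsum_eq] at h1
  have e : S - ∑ n ∈ Finset.range L, f n = ∑' n, f (n + L) := by rw [← h1]; ring
  rw [e]
  have hg2 := (summable_nat_add_iff L).2 hg
  have hb : ∀ n, ‖f (n + L)‖ ≤ g (n + L) := fun n => h _ (by omega)
  refine (tsum_of_norm_bounded hg2.hasSum hb).trans ?_
  have h3 := hg.sum_add_tsum_nat_add L
  have h4 : 0 ≤ ∑ n ∈ Finset.range L, g n := Finset.sum_nonneg fun n _ => hg0 n
  linarith

lemma col_sum {β : ℝ} (hβ : 0 < β) {τ : ℕ → ℝ} {μ : ℕ → ℂ} (hμ : ∀ k, ‖μ k‖ = Real.exp (β * τ k))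
    {C G' : NNReal} (hC : ∀ x : ℕ → ℂ, N4 x ≠ ⊤ → N4 x ≤ C * N4 (fun k => mv β (τ k) (μ k) x))
    (hC2 : ∀ x : ℕ → ℂ, N4 x ≠ ⊤ → N4 (fun k => mv β (τ k) (μ k) x) ≤ C * N4 x)
    (hG' : ∀ t : ℝ, ∑' k, kap 1 (τ k - t) ≤ G')
    {b : ℕ → ℕ → ℂ} {B : ℝ} (hbN : ∀ k, N4 (b k) ≠ ⊤) (hb : ∀ k j, mv β (τ j) (μ j) (b k) = if j = k then 1 else 0)
    (hB : ∀ k n, ‖b k n‖ ≤ B) (n : ℕ) : HasSum (fun k => MM β (τ k) (μ k) n * b k n) 1 := by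
  have hB0 : 0 ≤ B := (norm_nonneg _).trans (hB 0 0)
  have hs : Summable (fun k => MM β (τ k) (μ k) n * b k n) := by
    apply Summable.of_norm_bounded ((kern_tsum_real hG' n).1.mul_left (Real.exp (1 ^ 2 / (2 * β)) * B))
    intro k
    rw [norm_mul, norm_MM (hμ k)]
    have := gauss_le_exp β 1 hβ (τ k - n)
    calc _ ≤ (Real.exp (1 ^ 2 / (2 * β)) * Real.exp (-(1 * |τ k - n|))) * B := by gcongr; exact hB k n
      _ = _ := by ring
  rw [hs.hasSum_iff_tendsto_nat]
  set e : ℕ → ℂ := fun i => if i = n then 1 else 0 with he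
  have heN : N4 e ≠ ⊤ := by rw [he, N4_single]; simp
  set v : ℕ → ℂ := fun j => mv β (τ j) (μ j) e with hv
  have hvM : ∀ j, v j = MM β (τ j) (μ j) n := fun j => by rw [hv, he]; simp only; rw [mv_single, one_mul]
  have hvN : N4 v ≠ ⊤ := ne_top_of_le_ne_top (ENNReal.mul_ne_top ENNReal.coe_ne_top heN) (hC2 e heN)
  set r : ℕ → ℕ → ℂ := fun K i => e i + (-1 : ℂ) * ∑ k ∈ Finset.range K, v k * b k i with hr
  have hrN : ∀ K, N4 (r K) ≠ ⊤ := fun K => N4_add_ne_top heN (N4_mul_ne_top (N4_sum_ne_top _ _ _ hbN))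
  have hmr : ∀ K j, mv β (τ j) (μ j) (r K) = if j < K then 0 else v j := by
    intro K j
    rw [hr]; simp only
    rw [mv_add hβ (hμ j) heN (N4_mul_ne_top (N4_sum_ne_top _ _ _ hbN)), mv_const_mul, mv_sum hβ (hμ j) _ _ _ hbN]
    simp_rw [hb]
    simp only [mul_ite, mul_one, mul_zero, Finset.sum_ite_eq, Finset.mem_range]
    change v j + _ = _
    split_ifs <;> ring
  have hrle : ∀ K, ‖r K n‖ₑ ^ 4 ≤ C * N4 (fun j => if j < K then 0 else v j) := by
    intro K
    refine (le_N4 (r K) n).trans ((hC _ (hrN K)).trans (le_of_eq ?_))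
    congr 2; ext j; exact hmr K j
  have ht : Filter.Tendsto (fun K => ‖r K n‖ₑ ^ 4) Filter.atTop (nhds 0) := by
    have h1 := ENNReal.Tendsto.const_mul (a := (C : ℝ≥0∞)) (N4_tail_tendsto hvN) (Or.inr ENNReal.coe_ne_top)
    rw [mul_zero] at h1
    exact tendsto_of_tendsto_of_tendsto_of_le_of_le tendsto_const_nhds h1 (fun _ => bot_le) hrle
  have ht2 : Filter.Tendsto (fun K => ‖r K n‖ ^ 4) Filter.atTop (nhds 0) := by
    have := (ENNReal.tendsto_toReal ENNReal.zero_ne_top).comp ht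
    simpa [Function.comp_def] using this
  have ht3 : Filter.Tendsto (fun K => r K n) Filter.atTop (nhds 0) := by
    rw [tendsto_zero_iff_norm_tendsto_zero]
    have h2 := (ht2.rpow_const (p := (1/4 : ℝ)) (Or.inr (by norm_num)))
    rw [Real.zero_rpow (by norm_num)] at h2
    refine h2.congr fun K => ?_
    rw [← Real.rpow_natCast, ← Real.rpow_mul (norm_nonneg _)]
    norm_num
  have h5 := (tendsto_const_nhds (x := (1 : ℂ))).sub ht3
  rw [sub_zero] at h5
  refine h5.congr fun K => ?_
  rw [hr]; simp only [he, if_true]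
  simp_rw [hvM]; ring

lemma bdd_nec {β : ℝ} (hβ : 0 < β) {τ : ℕ → ℝ} {μ : ℕ → ℂ} (hμ : ∀ k, ‖μ k‖ = Real.exp (β * τ k)) (hmono : Monotone τ)
    {C G' : NNReal} (hC : ∀ x : ℕ → ℂ, N4 x ≠ ⊤ → N4 x ≤ C * N4 (fun k => mv β (τ k) (μ k) x))
    (hC2 : ∀ x : ℕ → ℂ, N4 x ≠ ⊤ → N4 (fun k => mv β (τ k) (μ k) x) ≤ C * N4 x)
    (hG' : ∀ t : ℝ, ∑' k, kap 1 (τ k - t) ≤ G')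
    {b : ℕ → ℕ → ℂ} {B : ℝ} (hbN : ∀ k, N4 (b k) ≠ ⊤) (hb : ∀ k j, mv β (τ j) (μ j) (b k) = if j = k then 1 else 0)
    (hB : ∀ k n, ‖b k n‖ ≤ B) : ∃ E : ℝ, ∀ j, |τ j - j| ≤ E := by
  have hB0 : 0 ≤ B := (norm_nonneg _).trans (hB 0 0)
  obtain ⟨G, hG0, hG⟩ := kern_sum_real 1 one_pos
  set D : ℝ := Real.exp (1 ^ 2 / (2 * β)) * B with hD
  have hD0 : 0 ≤ D := by positivity
  refine ⟨D * G * G' + D * G * G' + (1 + |τ 0|), fun m => ?_⟩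
  set T := τ m
  set L := ⌈T⌉₊
  have hent : ∀ k n : ℕ, ‖MM β (τ k) (μ k) n * b k n‖ ≤ D * Real.exp (-(1 * |τ k - n|)) := by
    intro k n
    rw [norm_mul, norm_MM (hμ k)]
    have := gauss_le_exp β 1 hβ (τ k - n)
    calc _ ≤ (Real.exp (1 ^ 2 / (2 * β)) * Real.exp (-(1 * |τ k - n|))) * B := by gcongr; exact hB k n
      _ = _ := by rw [hD]; ring
  have hkey : ∀ k n : ℕ, |τ k - n| = |τ k - T| + |T - n| → ‖MM β (τ k) (μ k) n * b k n‖ ≤ D * Real.exp (-(1 * |τ k - T|)) * Real.exp (-(1 * |T - n|)) := by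
    intro k n h
    refine (hent k n).trans (le_of_eq ?_)
    rw [h, mul_assoc D, ← Real.exp_add]; congr 2; ring
  have hrow : ∀ k, HasSum (fun n => MM β (τ k) (μ k) n * b k n) 1 := by
    intro k
    have h1 := hb k k
    rw [if_pos rfl] at h1
    have h2 := (summable_mv hβ (hμ k) (hbN k)).hasSum
    change HasSum _ (mv β (τ k) (μ k) (b k)) at h2
    rw [h1] at h2
    simpa [mul_comm] using h2
  have hcol := col_sum hβ hμ hC hC2 hG' hbN hb hB
  have hr : ∀ k ∈ Finset.range m, ‖1 - ∑ n ∈ Finset.range L, MM β (τ k) (μ k) n * b k n‖ ≤ D * Real.exp (-(1 * |τ k - T|)) * G := by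
    intro k hk
    apply tail_bound (hrow k) ((hG T).1.mul_left (D * Real.exp (-(1 * |τ k - T|))))
    · rw [tsum_mul_left]; gcongr; exact (hG T).2
    · intro n; positivity
    · intro n hn
      apply hkey
      have h1 : τ k ≤ T := hmono (Finset.mem_range.1 hk).le
      have h2 : T ≤ n := Nat.ceil_le.1 hn
      rw [abs_of_nonpos (by linarith), abs_of_nonpos (by linarith), abs_of_nonpos (by linarith)]; ring
  have hc : ∀ n ∈ Finset.range L, ‖1 - ∑ k ∈ Finset.range m, MM β (τ k) (μ k) n * b k n‖ ≤ D * G' * Real.exp (-(1 * |T - n|)) := by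
    intro n hn
    have h0 := kern_tsum_real hG' T
    apply tail_bound (hcol n) (h0.1.mul_left (D * Real.exp (-(1 * |T - n|))))
    · rw [tsum_mul_left, mul_right_comm]; gcongr; exact h0.2
    · intro n; positivity
    · intro k hk
      have h1 : T ≤ τ k := hmono hk
      have h2 : (n : ℝ) < T := Nat.lt_ceil.1 (Finset.mem_range.1 hn)
      refine (hkey k n ?_).trans (le_of_eq (by ring))
      rw [abs_of_nonneg (by linarith), abs_of_nonneg (by linarith), abs_of_nonneg (by linarith)]; ring
  have e1 : (m : ℂ) - L = ∑ k ∈ Finset.range m, (1 - ∑ n ∈ Finset.range L, MM β (τ k) (μ k) n * b k n) -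
      ∑ n ∈ Finset.range L, (1 - ∑ k ∈ Finset.range m, MM β (τ k) (μ k) n * b k n) := by
    rw [Finset.sum_sub_distrib, Finset.sum_sub_distrib, Finset.sum_comm]
    simp
  have h1 : |(m : ℝ) - L| ≤ D * G * G' + D * G * G' := by
    have e2 : |(m : ℝ) - L| = ‖(m : ℂ) - L‖ := by
      rw [← Real.norm_eq_abs, ← Complex.norm_real]; push_cast; rfl
    rw [e2, e1]
    refine (norm_sub_le _ _).trans (add_le_add ?_ ?_)
    · refine (norm_sum_le _ _).trans ((Finset.sum_le_sum hr).trans ?_)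
      rw [← Finset.sum_mul, ← Finset.mul_sum]
      have h0 := kern_tsum_real hG' T
      have := (h0.1.sum_le_tsum (Finset.range m) (fun _ _ => (Real.exp_pos _).le)).trans h0.2
      calc _ ≤ D * G' * G := by gcongr
        _ = _ := by ring
    · refine (norm_sum_le _ _).trans ((Finset.sum_le_sum hc).trans ?_)
      rw [← Finset.mul_sum]
      have := ((hG T).1.sum_le_tsum (Finset.range L) (fun _ _ => (Real.exp_pos _).le)).trans (hG T).2
      calc _ ≤ D * G' * G := by gcongr
        _ = _ := by ring
  have h2 := near_nat hmono m
  calc |τ m - m| = |(τ m - L) - (m - L)| := by congr 1; ring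
    _ ≤ |τ m - L| + |(m : ℝ) - L| := abs_sub _ _
    _ ≤ _ := by linarith



lemma max_mod {f : ℂ → ℂ} (hf : Differentiable ℂ f) {r A : ℝ} (hr : 0 < r) (hA : ∀ z, ‖z‖ = r → ‖f z‖ ≤ A) {z : ℂ} (hz : ‖z‖ ≤ r) :
    ‖f z‖ ≤ A := by
  apply Complex.norm_le_of_forall_mem_frontier_norm_le (U := Metric.ball 0 r) Metric.isBounded_ball hf.diffContOnCl
  · intro w hw
    rw [frontier_ball _ hr.ne'] at hw
    exact hA w (by simpa using hw)
  · rw [closure_ball _ hr.ne']; simpa using hz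

lemma reflect_norm {r : ℝ} (hr : 0 < r) {z w : ℂ} (hz : ‖z‖ = r) : ‖(r : ℂ) - (starRingEnd ℂ) w * z / r‖ = ‖z - w‖ := by
  have hr' : (r : ℂ) ≠ 0 := by exact_mod_cast hr.ne'
  have hzz : z * (starRingEnd ℂ) z = (r : ℂ) * r := by
    rw [Complex.mul_conj, Complex.normSq_eq_norm_sq, hz]; push_cast; ring
  have e : (r : ℂ) - (starRingEnd ℂ) w * z / r = z / r * (starRingEnd ℂ) (z - w) := by
    rw [map_sub]; field_simp; linear_combination (-1 : ℂ) * hzz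
  rw [e, norm_mul, norm_div, hz, Complex.norm_conj, Complex.norm_real, Real.norm_of_nonneg hr.le, div_self hr.ne', one_mul]

lemma jensen_lower (s : Finset ℕ) (μ : ℕ → ℂ) {r A : ℝ} (hr : 0 < r) (hA : ∀ z, ‖z‖ = r → ‖∏ j ∈ s, (z - μ j)‖ ≤ A) :
    ∏ j ∈ s, max r ‖μ j‖ ≤ A := by
  classical
  set h : ℕ → ℂ → ℂ := fun j z => if r ≤ ‖μ j‖ then z - μ j else (r : ℂ) - (starRingEnd ℂ) (μ j) * z / r with hh
  have hd : Differentiable ℂ (fun z => ∏ j ∈ s, h j z) := by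
    apply Differentiable.fun_finsetProd
    intro j _
    by_cases hc : r ≤ ‖μ j‖
    · simp only [hh, if_pos hc]; fun_prop
    · simp only [hh, if_neg hc]; fun_prop
  have h1 : ∀ z, ‖z‖ = r → ‖∏ j ∈ s, h j z‖ ≤ A := by
    intro z hz
    refine le_trans (le_of_eq ?_) (hA z hz)
    rw [norm_prod, norm_prod]
    apply Finset.prod_congr rfl
    intro j _
    by_cases hc : r ≤ ‖μ j‖
    · simp only [hh, if_pos hc]
    · simp only [hh, if_neg hc]; exact reflect_norm hr hz
  have h2 := max_mod hd hr h1 (z := 0) (by simpa using hr.le)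
  refine le_trans (le_of_eq ?_) h2
  rw [norm_prod]
  apply Finset.prod_congr rfl
  intro j _
  by_cases hc : r ≤ ‖μ j‖
  · simp [hh, if_pos hc, max_eq_right hc]
  · simp [hh, if_neg hc, max_eq_left (not_le.1 hc).le, abs_of_pos hr]

lemma division (s : Finset ℕ) (μ : ℕ → ℂ) {r : ℝ} (hr : 0 < r) (hinj : Set.InjOn μ s) (hs : ∀ j ∈ s, ‖μ j‖ < r)
    (f : ℂ → ℂ) (hf : Differentiable ℂ f) (hz : ∀ j ∈ s, f (μ j) = 0) (A : ℝ) (hA : ∀ z, ‖z‖ = r → ‖f z‖ ≤ A) (z : ℂ) (hzr : ‖z‖ ≤ r) :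
    ‖f z‖ * ∏ j ∈ s, (r - ‖μ j‖) ≤ A * ∏ j ∈ s, ‖z - μ j‖ := by
  classical
  induction s using Finset.induction_on generalizing f A with
  | empty => simpa using max_mod hf hr hA hzr
  | insert a s ha ih =>
    rw [Finset.prod_insert ha, Finset.prod_insert ha]
    set g := dslope f (μ a) with hg
    have hfg : ∀ w, f w = (w - μ a) * g w := by
      intro w
      have := sub_smul_dslope f (μ a) w
      rw [hz a (Finset.mem_insert_self _ _), sub_zero, smul_eq_mul] at this
      exact this.symm
    have hgd : Differentiable ℂ g := by
      rw [← differentiableOn_univ]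
      exact (Complex.differentiableOn_dslope Filter.univ_mem).2 hf.differentiableOn
    have hra : 0 < r - ‖μ a‖ := by linarith [hs a (Finset.mem_insert_self _ _)]
    have hgA : ∀ w, ‖w‖ = r → ‖g w‖ ≤ A / (r - ‖μ a‖) := by
      intro w hw
      rw [le_div_iff₀ hra, mul_comm]
      have h1 := hA w hw
      rw [hfg, norm_mul] at h1
      refine le_trans ?_ h1
      gcongr
      have := norm_sub_norm_le w (μ a)
      linarith
    have hgz : ∀ j ∈ s, g (μ j) = 0 := by
      intro j hj
      have h1 := hz j (Finset.mem_insert_of_mem hj)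
      rw [hfg] at h1
      rcases mul_eq_zero.1 h1 with h2 | h2
      · exfalso
        have h3 := hinj (Finset.mem_coe.2 (Finset.mem_insert_of_mem hj)) (Finset.mem_coe.2 (Finset.mem_insert_self a s)) (sub_eq_zero.1 h2)
        exact ha (h3 ▸ hj)
      · exact h2
    have h4 := ih (hinj.mono (by simp)) (fun j hj => hs j (Finset.mem_insert_of_mem hj)) g hgd hgz _ hgA
    rw [hfg, norm_mul]
    calc ‖z - μ a‖ * ‖g z‖ * ((r - ‖μ a‖) * ∏ j ∈ s, (r - ‖μ j‖)) = ‖z - μ a‖ * (r - ‖μ a‖) * (‖g z‖ * ∏ j ∈ s, (r - ‖μ j‖)) := by ring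
      _ ≤ ‖z - μ a‖ * (r - ‖μ a‖) * (A / (r - ‖μ a‖) * ∏ j ∈ s, ‖z - μ j‖) := by gcongr
      _ = _ := by field_simp

lemma PS_entire {β : ℝ} (hβ : 0 < β) {x : ℕ → ℂ} {A : ℝ} (hA : ∀ n, ‖x n‖ ≤ A) : Differentiable ℂ (PS β x) := by
  have hA0 : 0 ≤ A := (norm_nonneg _).trans (hA 0)
  rw [← differentiableOn_univ]
  obtain ⟨G, hG0, hG⟩ := mv_bound β hβ
  intro z _
  apply DifferentiableAt.differentiableWithinAt
  set R := ‖z‖ + 1 with hR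
  have hR0 : 0 < R := by positivity
  set t := Real.log R / β
  have ht : ‖(R : ℂ)‖ = Real.exp (β * t) := by
    rw [Complex.norm_real, Real.norm_of_nonneg hR0.le, mul_div_cancel₀ _ hβ.ne', Real.exp_log hR0]
  have hs := (hG t R x A ht hA0 hA).1
  have hs2 : Summable (fun n => ‖x n * (Real.exp (-(β * (n : ℝ) ^ 2 / 2)) : ℂ)‖ * R ^ n) := by
    refine (hs.mul_left (Real.exp (β * t ^ 2 / 2))).congr fun n => ?_
    rw [MM, norm_mul, norm_mul, norm_mul, norm_mul, norm_pow, Complex.norm_real (Real.exp (-(β * t ^ 2 / 2))), Complex.norm_real R, Real.norm_of_nonneg hR0.le, Real.norm_of_nonneg (Real.exp_pos _).le]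
    have : Real.exp (β * t ^ 2 / 2) * Real.exp (-(β * t ^ 2 / 2)) = 1 := by rw [← Real.exp_add]; simp
    linear_combination (‖x n‖ * ‖(Real.exp (-(β * (n : ℝ) ^ 2 / 2)) : ℂ)‖ * R ^ n) * this
  have hd : DifferentiableOn ℂ (PS β x) (Metric.ball 0 R) := by
    unfold PS
    apply differentiableOn_tsum_of_summable_norm hs2
    · intro n; fun_prop
    · exact Metric.isOpen_ball
    · intro n w hw
      rw [norm_mul, norm_pow]
      have : ‖w‖ ≤ R := by simpa using (Metric.mem_ball.1 hw).le
      gcongr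
  exact hd.differentiableAt (Metric.isOpen_ball.mem_nhds (by simp [hR]))

lemma upper_avg {β : ℝ} (hβ : 0 < β) {τ : ℕ → ℝ} {μ : ℕ → ℂ} (hμ : ∀ k, ‖μ k‖ = Real.exp (β * τ k)) (hmono : Monotone τ)
    {E : ℝ} (hE : ∀ j, |τ j - j| ≤ E) {G' C' : NNReal}
    (hG' : ∀ t : ℝ, ∑' k, kap 1 (τ k - t) ≤ G') {c0 : ℝ} (hc0 : 0 < c0) (hc01 : c0 ≤ 1)
    (hP : ∀ w : ℝ → ℝ, (∀ s t, |w s - w t| ≤ c0 * |s - t|) →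
      ∀ x : ℕ → ℂ, N4 x ≠ ⊤ → N4 (fun n : ℕ => (Real.exp (w n) : ℂ) * x n) ≠ ⊤ →
      N4 (fun n : ℕ => (Real.exp (w n) : ℂ) * x n) ≤ C' * N4 (fun k => (Real.exp (w (τ k)) : ℂ) * mv β (τ k) (μ k) x)) :
    ∃ Ca : ℝ, ∀ k m : ℕ, k ≤ m → Ep τ m - Ep τ k ≤ (1 / 2 - c0 / β) * (m - k) + Ca := by
  obtain ⟨G1, _, hG1⟩ := prod_upper hβ hμ hE
  obtain ⟨G2, hG20, hG2⟩ := mv_weighted_bound β hβ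
  set g : ℝ := Real.exp (1 ^ 2 / (2 * β)) with hg
  set H : ℝ := C' * (g ^ 4 * G') with hH
  have hH0 : 0 ≤ H := by positivity
  -- the fourth power sum
  have hsum : ∀ t : ℝ, ∑' k, ENNReal.ofReal (Real.exp (-(β * (τ k - t) ^ 2 / 2))) ^ 4 ≤ ENNReal.ofReal (g ^ 4 * G') := by
    intro t
    calc _ ≤ ∑' k, ENNReal.ofReal g ^ 4 * kap 1 (τ k - t) := by
          apply ENNReal.tsum_le_tsum
          intro k
          calc _ ≤ (ENNReal.ofReal g * kap 1 (τ k - t)) ^ 4 := by gcongr; exact ofReal_gauss_le β hβ _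
            _ = ENNReal.ofReal g ^ 4 * kap 1 (τ k - t) ^ 4 := mul_pow _ _ _
            _ ≤ _ := by
              gcongr
              apply pow_le_of_le_one _ _ (by norm_num)
              · exact bot_le
              · rw [kap]; exact ENNReal.ofReal_le_one.2 (Real.exp_le_one_iff.2 (by simp))
      _ ≤ ENNReal.ofReal g ^ 4 * G' := by rw [ENNReal.tsum_mul_left]; gcongr; exact hG' t
      _ = _ := by rw [ENNReal.ofReal_mul (by positivity), ENNReal.ofReal_pow (by positivity)]; simp
  set Cst : ℝ := (H + 1) * Real.exp (G1 + c0 * E) * G2 with hCst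
  have hCst0 : 0 < Cst := by positivity
  refine ⟨Real.log Cst / β, fun n m hnm => ?_⟩
  set p : Polynomial ℂ := ∏ j ∈ Finset.range m, (Polynomial.X - Polynomial.C (μ j)) with hp
  have hpe : ∀ z, p.eval z = ∏ j ∈ Finset.range m, (z - μ j) := by
    intro z; rw [hp, Polynomial.eval_prod]; simp
  set x := xp β p with hx
  set w : ℝ → ℝ := fun t => -(c0 * t) with hw
  set F := Real.exp (G1 + c0 * E + β * (m : ℝ) ^ 2 / 2 - c0 * m) with hF
  have hF0 : 0 < F := Real.exp_pos _
  have hyfin : N4 (fun n : ℕ => (Real.exp (w n) : ℂ) * x n) ≠ ⊤ := by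
    apply N4_finite (p.natDegree + 1)
    intro i hi
    rw [hx, xp, Polynomial.coeff_eq_zero_of_natDegree_lt (by omega)]; simp
  have h1 := hP w (by
    intro s t
    rw [hw]; simp only
    rw [show -(c0 * s) - -(c0 * t) = -(c0 * (s - t)) by ring, abs_neg, abs_mul, abs_of_pos hc0]) x (N4_xp β p) hyfin
  have h2 : ∀ k, ‖(Real.exp (w (τ k)) : ℂ) * mv β (τ k) (μ k) x‖ ≤ F * Real.exp (-(β * (τ k - m) ^ 2 / 2)) := by
    intro k
    rw [hx, mv_xp, hpe]
    rcases lt_or_ge k m with hk | hk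
    · rw [Finset.prod_eq_zero (Finset.mem_range.2 hk) (sub_self _)]
      simp only [mul_zero, norm_zero]; positivity
    · have h3 : ‖∏ j ∈ Finset.range m, (μ k - μ j)‖ ≤ Real.exp (G1 + β * (m * τ k)) := by
        rw [norm_prod]
        calc _ ≤ ∏ j ∈ Finset.range m, (Real.exp (β * τ k) + ‖μ j‖) := by
              apply Finset.prod_le_prod (fun _ _ => norm_nonneg _)
              intro j _; rw [← hμ]; exact norm_sub_le _ _
          _ ≤ _ := hG1 (τ k) _
          _ = _ := by
              congr 3
              rw [Finset.sum_congr rfl (g := fun _ => τ k)]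
              · simp
              · intro j hj
                exact max_eq_left (hmono (by have := Finset.mem_range.1 hj; omega))
      rw [norm_mul, norm_mul, Complex.norm_real, Complex.norm_real, Real.norm_of_nonneg (Real.exp_pos _).le, Real.norm_of_nonneg (Real.exp_pos _).le]
      calc _ ≤ Real.exp (w (τ k)) * (Real.exp (-(β * τ k ^ 2 / 2)) * Real.exp (G1 + β * (m * τ k))) := by gcongr
        _ ≤ _ := by
          rw [hF, ← Real.exp_add, ← Real.exp_add, ← Real.exp_add]
          apply Real.exp_le_exp.2
          have h4 : (m : ℝ) - E ≤ τ k := by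
            have := hmono hk
            have := (abs_le.1 (hE m)).1
            linarith
          rw [hw]
          have := mul_le_mul_of_nonneg_left h4 hc0.le
          simp only
          nlinarith
  have h5 : N4 (fun n : ℕ => (Real.exp (w n) : ℂ) * x n) ≤ ENNReal.ofReal (H * F ^ 4) := by
    refine h1.trans ?_
    have : N4 (fun k => (Real.exp (w (τ k)) : ℂ) * mv β (τ k) (μ k) x) ≤ ENNReal.ofReal F ^ 4 * ENNReal.ofReal (g ^ 4 * G') := by
      refine le_trans ?_ (mul_le_mul_right (hsum m) _)
      rw [← ENNReal.tsum_mul_left]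
      unfold N4
      apply ENNReal.tsum_le_tsum
      intro k
      rw [← mul_pow]
      gcongr
      rw [← ofReal_norm, ← ENNReal.ofReal_mul hF0.le]
      exact ENNReal.ofReal_le_ofReal (h2 k)
    calc _ ≤ (C' : ℝ≥0∞) * (ENNReal.ofReal F ^ 4 * ENNReal.ofReal (g ^ 4 * G')) := by gcongr
      _ = ENNReal.ofReal C' * (ENNReal.ofReal F ^ 4 * ENNReal.ofReal (g ^ 4 * G')) := by simp
      _ = _ := by
        rw [← ENNReal.ofReal_pow hF0.le, ← ENNReal.ofReal_mul (by positivity), ← ENNReal.ofReal_mul (by positivity)]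
        congr 1; rw [hH]; ring
  have h6 : ∀ i : ℕ, ‖x i‖ ≤ (H + 1) * Real.exp (G1 + c0 * E + β * (m : ℝ) ^ 2 / 2) * Real.exp (-(-c0 * (i - m))) := by
    intro i
    have h7 := N4_bdd (ne_top_of_le_ne_top ENNReal.ofReal_ne_top h5) i
    have h8 := ENNReal.toReal_le_of_le_ofReal (by positivity) h5
    have h9 : (‖(Real.exp (w i) : ℂ) * x i‖) ^ 4 ≤ ((H + 1) * F) ^ 4 := by
      refine (h7.trans h8).trans ?_
      rw [mul_pow]
      gcongr
      have h10 : (H + 1) ^ 1 ≤ (H + 1) ^ 4 := pow_le_pow_right₀ (by linarith) (by norm_num)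
      linarith [pow_one (H + 1)]
    have h11 := le_of_pow_le_pow_left₀ (by norm_num) (by positivity) h9
    rw [norm_mul, Complex.norm_real, Real.norm_of_nonneg (Real.exp_pos _).le] at h11
    have h12 : ‖x i‖ = Real.exp (c0 * i) * (Real.exp (w i) * ‖x i‖) := by
      rw [← mul_assoc, ← Real.exp_add, hw]; simp
    rw [h12]
    calc _ ≤ Real.exp (c0 * i) * ((H + 1) * F) := by gcongr
      _ = (H + 1) * (F * Real.exp (c0 * i)) := by ring
      _ = _ := by rw [mul_assoc, hF, ← Real.exp_add, ← Real.exp_add]; congr 2; ring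
  have h7 : ∀ z : ℂ, ‖z‖ = Real.exp (β * n) → ‖∏ j ∈ Finset.range m, (z - μ j)‖ ≤
      Cst * Real.exp (β * (m : ℝ) ^ 2 / 2 + β * (n : ℝ) ^ 2 / 2 - c0 * (m - n)) := by
    intro z hz
    have h8 := (hG2 n z x _ (-c0) m hz (by rw [abs_neg, abs_of_pos hc0]; exact hc01) (by positivity) h6).2
    rw [← hpe, ← PS_xp β p z, norm_PS β n z]
    calc _ ≤ Real.exp (β * (n : ℝ) ^ 2 / 2) * ((H + 1) * Real.exp (G1 + c0 * E + β * (m : ℝ) ^ 2 / 2) * G2 * Real.exp (-(-c0 * (n - m)))) := by gcongr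
      _ = (H + 1) * G2 * (Real.exp (β * (n : ℝ) ^ 2 / 2) * Real.exp (G1 + c0 * E + β * (m : ℝ) ^ 2 / 2) * Real.exp (-(-c0 * (n - m)))) := by ring
      _ = (H + 1) * G2 * (Real.exp (G1 + c0 * E) * Real.exp (β * (m : ℝ) ^ 2 / 2 + β * (n : ℝ) ^ 2 / 2 - c0 * (m - n))) := by
          rw [← Real.exp_add, ← Real.exp_add, ← Real.exp_add]; congr 2; ring
      _ = _ := by rw [hCst]; ring
  have h8 := jensen_lower (Finset.range m) μ (Real.exp_pos _) h7
  have h9 : ∏ j ∈ Finset.range m, max (Real.exp (β * n)) ‖μ j‖ = Real.exp (β * ∑ j ∈ Finset.range m, max (n : ℝ) (τ j)) := by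
    rw [Finset.mul_sum, Real.exp_sum]
    apply Finset.prod_congr rfl
    intro j _
    rw [hμ, ← Real.exp_monotone.map_max, ← mul_max_of_nonneg _ _ hβ.le]
  rw [h9, ← Real.exp_log hCst0, ← Real.exp_add] at h8
  have h10 := Real.exp_le_exp.1 h8
  have h11 := sum_max_lower τ n n m hnm
  rw [sum_tau τ m, sum_tau τ n] at h11
  have h12 := mul_le_mul_of_nonneg_left h11 hβ.le
  have h13 : β * (Ep τ m - Ep τ n) ≤ β * ((1 / 2 - c0 / β) * (m - n) + Real.log Cst / β) := by
    have : β * ((1 / 2 - c0 / β) * ((m : ℝ) - n) + Real.log Cst / β) = (β / 2 - c0) * (m - n) + Real.log Cst := by field_simp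
    rw [this]
    nlinarith
  exact le_of_mul_le_mul_left h13 hβ



lemma lower_avg {β : ℝ} (hβ : 0 < β) {τ : ℕ → ℝ} {μ : ℕ → ℂ} (hμ : ∀ k, ‖μ k‖ = Real.exp (β * τ k)) (hmono : Monotone τ)
    (hinj : Function.Injective μ)
    {E : ℝ} (hE : ∀ j, |τ j - j| ≤ E) {C' : NNReal} {c0 : ℝ} (hc0 : 0 < c0) (hc01 : c0 ≤ 1)
    (hP : ∀ w : ℝ → ℝ, (∀ s t, |w s - w t| ≤ c0 * |s - t|) →
      ∀ x : ℕ → ℂ, N4 x ≠ ⊤ → N4 (fun n : ℕ => (Real.exp (w n) : ℂ) * x n) ≠ ⊤ →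
      N4 (fun n : ℕ => (Real.exp (w n) : ℂ) * x n) ≤ C' * N4 (fun k => (Real.exp (w (τ k)) : ℂ) * mv β (τ k) (μ k) x))
    {b : ℕ → ℕ → ℂ} (hbN : ∀ k, N4 (b k) ≠ ⊤) (hb : ∀ k j, mv β (τ j) (μ j) (b k) = if j = k then 1 else 0) :
    ∃ Ca : ℝ, ∀ k m : ℕ, k ≤ m → -((1 / 2 - c0 / β) * (m - k) + Ca) ≤ Ep τ m - Ep τ k := by
  have hE0 : 0 ≤ E := (abs_nonneg _).trans (hE 0)
  have hbk : ∀ k n : ℕ, ‖b k n‖ ≤ (C' + 1) * Real.exp (-(c0 * (n - τ k))) := by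
    intro k n
    set L := c0 * |(n : ℝ) - τ k| with hL
    have hL0 : 0 ≤ L := by positivity
    set w : ℝ → ℝ := fun t => min (c0 * (t - τ k)) L with hw
    have hwL : ∀ t, w t ≤ L := fun t => min_le_right _ _
    have hwk : w (τ k) = 0 := by rw [hw]; simp [hL0]
    have hwn : w n = c0 * (n - τ k) := by
      rw [hw]; apply min_eq_left; rw [hL]; gcongr; exact le_abs_self _
    have h1 := hP w (by
      intro s t
      refine (abs_min_sub_min_le_max _ _ _ _).trans ?_
      rw [sub_self, abs_zero, show c0 * (s - τ k) - c0 * (t - τ k) = c0 * (s - t) by ring, abs_mul, abs_of_pos hc0]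
      exact max_le le_rfl (by positivity)) (b k) (hbN k) (by
        have h2 : N4 (fun n : ℕ => (Real.exp (w n) : ℂ) * b k n) ≤ N4 (fun n : ℕ => (Real.exp L : ℂ) * b k n) := by
          apply N4_mono
          intro i
          rw [norm_mul, norm_mul, Complex.norm_real, Complex.norm_real, Real.norm_of_nonneg (Real.exp_pos _).le, Real.norm_of_nonneg (Real.exp_pos _).le]
          gcongr
          exact hwL _
        refine ne_top_of_le_ne_top ?_ h2
        rw [N4_const_mul]
        exact ENNReal.mul_ne_top (by simp) (hbN k))
    have h3 : N4 (fun j => (Real.exp (w (τ j)) : ℂ) * mv β (τ j) (μ j) (b k)) = 1 := by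
      have : (fun j => (Real.exp (w (τ j)) : ℂ) * mv β (τ j) (μ j) (b k)) = fun j => if j = k then 1 else 0 := by
        ext j; rw [hb]; split_ifs with h
        · rw [h, hwk]; simp
        · simp
      rw [this, N4_single]; simp
    rw [h3, mul_one] at h1
    have h4 := N4_bdd' (C := C') (by positivity) (by rw [ENNReal.ofReal_coe_nnreal]; exact h1) n
    rw [norm_mul, Complex.norm_real, Real.norm_of_nonneg (Real.exp_pos _).le, hwn] at h4
    rw [Real.exp_neg, ← div_eq_mul_inv, le_div_iff₀ (Real.exp_pos _)]
    linarith
  obtain ⟨G2, hG20, hG2⟩ := mv_weighted_bound β hβ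
  obtain ⟨G1, hG10, hG1⟩ := prod_upper hβ hμ hE
  obtain ⟨G3, hG30, hG3⟩ := kern_tau_fin hE β hβ
  set ε := 1 - Real.exp (-β) with hε
  have hε0 : 0 < ε := by
    have : Real.exp (-β) < 1 := by rw [← Real.exp_zero]; exact Real.exp_lt_exp.2 (by linarith)
    linarith
  set D := (2 + 2 * |Real.log ε|) * G3 with hD
  have hD0 : 0 ≤ D := by positivity
  set A0 : ℝ := (C' + 1) * G2 with hA0
  have hA00 : 0 < A0 := by positivity
  refine ⟨(D + G1 + |Real.log A0|) / β + (E + (E + 1) + (E + 1) ^ 2 / 2), fun k m hkm => ?_⟩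
  rcases hkm.eq_or_lt with rfl | hkm
  · simp only [sub_self, mul_zero, zero_add]
    have : 0 ≤ (D + G1 + |Real.log A0|) / β + (E + (E + 1) + (E + 1) ^ 2 / 2) := by positivity
    linarith
  set σ : ℝ := m + E + 1 with hσ
  set s := (Finset.range m).erase k with hs
  have hjσ : ∀ j ∈ s, τ j + 1 ≤ σ := by
    intro j hj
    have h1 := (abs_le.1 (hE j)).2
    have h2 : (j : ℝ) ≤ m := by
      have := Finset.mem_range.1 (Finset.mem_of_mem_erase hj)
      exact_mod_cast this.le
    linarith
  have hPS : ∀ j, ‖PS β (b k) (μ j)‖ = Real.exp (β * τ j ^ 2 / 2) * (if j = k then 1 else 0) := by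
    intro j
    rw [norm_PS β (τ j), hb]; split_ifs <;> simp
  have hkσ : τ k ≤ σ := by
    have h1 := (abs_le.1 (hE k)).2
    have h2 : (k : ℝ) ≤ m := by exact_mod_cast hkm.le
    linarith
  obtain ⟨A1, _, hA1⟩ := bdd_of_N4 (hbN k)
  have hdiv := division s μ (Real.exp_pos (β * σ)) hinj.injOn (by
      intro j hj
      rw [hμ]; apply Real.exp_lt_exp.2
      have := hjσ j hj
      nlinarith) (PS β (b k)) (PS_entire hβ hA1) (by
      intro j hj
      have := hPS j
      rw [if_neg (Finset.ne_of_mem_erase hj), mul_zero] at this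
      exact norm_eq_zero.1 this) (A0 * Real.exp (β * σ ^ 2 / 2 - c0 * (σ - τ k))) (by
      intro z hz
      have h := (hG2 σ z (b k) (C' + 1) c0 (τ k) hz (by rw [abs_of_pos hc0]; exact hc01) (by positivity) (hbk k)).2
      rw [norm_PS β σ]
      calc _ ≤ Real.exp (β * σ ^ 2 / 2) * ((C' + 1) * G2 * Real.exp (-(c0 * (σ - τ k)))) := by gcongr
        _ = A0 * (Real.exp (β * σ ^ 2 / 2) * Real.exp (-(c0 * (σ - τ k)))) := by rw [hA0]; ring
        _ = _ := by rw [← Real.exp_add]; rfl) (μ k) (by rw [hμ]; apply Real.exp_le_exp.2; gcongr)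
  rw [hPS k, if_pos rfl, mul_one] at hdiv
  have hcard : (s.card : ℝ) = m - 1 := by
    rw [hs, Finset.card_erase_of_mem (Finset.mem_range.2 hkm), Finset.card_range, Nat.cast_sub (by omega)]; simp
  have hlow : Real.exp (β * ((m - 1) * σ) - D) ≤ ∏ j ∈ s, (Real.exp (β * σ) - ‖μ j‖) := by
    calc _ ≤ Real.exp (∑ j ∈ s, (β * max σ (τ j) - (2 + 2 * |Real.log ε|) * Real.exp (-(β * |σ - τ j|)))) := by
          apply Real.exp_le_exp.2
          rw [Finset.sum_sub_distrib, ← Finset.mul_sum, ← Finset.mul_sum]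
          have h1 := hG3 σ s
          have h2 : ∑ j ∈ s, max σ (τ j) = (m - 1) * σ := by
            rw [Finset.sum_congr rfl (g := fun _ => σ)]
            · rw [Finset.sum_const, nsmul_eq_mul, hcard]
            · intro j hj; exact max_eq_left (by linarith [hjσ j hj])
          rw [h2, hD]
          have : 0 ≤ (2 + 2 * |Real.log ε|) := by positivity
          nlinarith
      _ = ∏ j ∈ s, Real.exp (β * max σ (τ j) - (2 + 2 * |Real.log ε|) * Real.exp (-(β * |σ - τ j|))) := Real.exp_sum _ _
      _ ≤ _ := by
          apply Finset.prod_le_prod (fun _ _ => (Real.exp_pos _).le)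
          intro j hj
          have h1 := hjσ j hj
          have hle : Real.exp (β * τ j) ≤ Real.exp (-β) * Real.exp (β * σ) := by
            rw [← Real.exp_add]; apply Real.exp_le_exp.2; nlinarith
          have hle2 : Real.exp (β * τ j) ≤ Real.exp (β * σ) := by
            apply Real.exp_le_exp.2; nlinarith
          have hn : ‖((Real.exp (β * σ) : ℝ) : ℂ) - ((Real.exp (β * τ j) : ℝ) : ℂ)‖ = Real.exp (β * σ) - Real.exp (β * τ j) := by
            rw [← Complex.ofReal_sub, Complex.norm_real, Real.norm_of_nonneg (by linarith)]
          have hnn : ∀ a : ℝ, ‖((Real.exp a : ℝ) : ℂ)‖ = Real.exp a := fun a => by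
            rw [Complex.norm_real, Real.norm_of_nonneg (Real.exp_pos _).le]
          have := sub_lower hβ hε0 (hnn (β * σ)) (hnn (β * τ j)) (by rw [hn, hnn, hε]; linarith) (by
            rw [hn, hnn, hε]
            have : (1 - Real.exp (-β)) * Real.exp (β * τ j) ≤ (1 - Real.exp (-β)) * Real.exp (β * σ) := by
              gcongr
            linarith)
          rw [hn] at this
          rw [hμ]; exact this
  have hup : ∏ j ∈ s, ‖μ k - μ j‖ ≤ Real.exp (G1 + β * ∑ j ∈ s, max (τ k) (τ j)) := by
    refine le_trans ?_ (hG1 (τ k) s)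
    apply Finset.prod_le_prod (fun _ _ => norm_nonneg _)
    intro j _; rw [← hμ]; exact norm_sub_le _ _
  have hsum : ∑ j ∈ s, max (τ k) (τ j) = k * τ k + (∑ j ∈ Finset.range m, τ j - ∑ j ∈ Finset.range k, τ j) - τ k := by
    have h1 := Finset.add_sum_erase (Finset.range m) (fun j => max (τ k) (τ j)) (Finset.mem_range.2 hkm)
    simp only [max_self] at h1
    have h2 : ∑ j ∈ Finset.range m, max (τ k) (τ j) = ∑ j ∈ Finset.range m, (if j < k then τ k else τ j) := by
      apply Finset.sum_congr rfl
      intro j _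
      split_ifs with h
      · exact max_eq_left (hmono h.le)
      · exact max_eq_right (hmono (not_lt.1 h))
    rw [h2, sum_if_split τ (τ k) k m hkm.le] at h1
    rw [← h1]; ring
  rw [hsum, sum_tau, sum_tau] at hup
  have hfin : Real.exp (β * τ k ^ 2 / 2 + (β * ((m - 1) * σ) - D)) ≤ Real.exp (Real.log A0 + (β * σ ^ 2 / 2 - c0 * (σ - τ k)) + (G1 + β * (k * τ k + (m * (m - 1) / 2 + Ep τ m - (k * (k - 1) / 2 + Ep τ k)) - τ k))) := by
    rw [Real.exp_add, Real.exp_add _ (G1 + _), Real.exp_add (Real.log A0), Real.exp_log hA00]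
    calc _ ≤ _ := by gcongr
      _ ≤ _ := hdiv
      _ ≤ _ := by gcongr
  have h1 := Real.exp_le_exp.1 hfin
  obtain ⟨e, he⟩ : ∃ e, τ k = k + e := ⟨τ k - k, by ring⟩
  have heE : |e| ≤ E := by have := hE k; rwa [he, add_sub_cancel_left] at this
  have h2 := abs_le.1 heE
  have h3 := le_abs_self (Real.log A0)
  have h4 : β * (-((1 / 2 - c0 / β) * ((m : ℝ) - k) + ((D + G1 + |Real.log A0|) / β + (E + (E + 1) + (E + 1) ^ 2 / 2)))) ≤ β * (Ep τ m - Ep τ k) := by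
    have h5 : β * (-((1 / 2 - c0 / β) * ((m : ℝ) - k) + ((D + G1 + |Real.log A0|) / β + (E + (E + 1) + (E + 1) ^ 2 / 2)))) = -((β / 2 - c0) * (m - k)) - (D + G1 + |Real.log A0|) - β * (E + (E + 1) + (E + 1) ^ 2 / 2) := by
      field_simp; ring
    rw [h5]
    have h6 : c0 * (m - k) ≤ c0 * (σ - τ k) := by gcongr ?_ * ?_; rw [he, hσ]; linarith
    have h7 : β * (-E) ≤ β * (e + e ^ 2 / 2) := by gcongr; nlinarith
    rw [he] at h1 h6
    rw [hσ] at h1 h6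
    clear hfin hsum hup hlow hdiv hPS
    linarith
  exact le_of_mul_le_mul_left h4 hβ

theorem necessity {β : ℝ} (hβ : 0 < β) {τ : ℕ → ℝ} {μ : ℕ → ℂ} (hμ : ∀ k, ‖μ k‖ = Real.exp (β * τ k)) (hmono : Monotone τ)
    (hinj : Function.Injective μ) (h : CISm β τ μ) :
    (∃ ε : ℝ, 0 < ε ∧ ∀ j k, j ≠ k → ε * ‖μ k‖ ≤ ‖μ j - μ k‖) ∧ (∃ E : ℝ, ∀ j, |τ j - j| ≤ E) ∧
    ∃ c Ca : ℝ, 0 < c ∧ ∀ k m : ℕ, k ≤ m → |Ep τ m - Ep τ k| ≤ (1 / 2 - c) * (m - k) + Ca := by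
  obtain ⟨⟨C, hC⟩, hI⟩ := h
  obtain ⟨G', hG'⟩ := kern_nec hβ hμ hmono (fun x hx => (hC x hx).2) 1 one_pos
  obtain ⟨b, hbN, hb, hB⟩ := exists_dual (fun x hx => (hC x hx).1) hI
  obtain ⟨E, hE⟩ := bdd_nec hβ hμ hmono (fun x hx => (hC x hx).1) (fun x hx => (hC x hx).2) hG' hbN hb hB
  obtain ⟨c0, hc0, hc01, C', hP⟩ := perturb hβ hμ (fun x hx => (hC x hx).1) hG'
  obtain ⟨C1, h1⟩ := upper_avg hβ hμ hmono hE hG' hc0 hc01 hP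
  obtain ⟨C2, h2⟩ := lower_avg hβ hμ hmono hinj hE hc0 hc01 hP hbN hb
  refine ⟨sep_nec hβ hμ hmono hbN hb hB, ⟨E, hE⟩, c0 / β, max C1 C2, by positivity, fun k m hkm => ?_⟩
  have h3 := h1 k m hkm
  have h4 := h2 k m hkm
  rw [abs_le]
  constructor
  · linarith [le_max_right C1 C2]
  · linarith [le_max_left C1 C2]



lemma entire_series {f : ℂ → ℂ} (hf : Differentiable ℂ f) :
    ∃ a : ℕ → ℂ, ∀ z, HasSum (fun n => a n * z ^ n) (f z) := by
  have h := hf.hasFPowerSeriesOnBall 0 (R := 1) one_pos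
  refine ⟨fun n => (cauchyPowerSeries f 0 (1 : NNReal)).coeff n, fun z => ?_⟩
  have h1 := h.hasSum (y := z) (by simp)
  rw [zero_add] at h1
  refine h1.congr_fun ?_ |> fun h => h
  intro n
  rw [FormalMultilinearSeries.apply_eq_pow_smul_coeff, smul_eq_mul, mul_comm]

lemma cauchy_est1 {f : ℂ → ℂ} (hf : Differentiable ℂ f) {a : ℕ → ℂ} (ha : ∀ z, HasSum (fun n => a n * z ^ n) (f z))
    (n : ℕ) {r : ℝ} (hr : 0 < r) :
    ‖a n‖ * r ^ n ≤ (2 * Real.pi)⁻¹ * ∫ θ in (0 : ℝ)..2 * Real.pi, ‖f (circleMap 0 r θ)‖ := by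
  lift r to NNReal using hr.le
  have h := hf.hasFPowerSeriesOnBall 0 (R := r) (by exact_mod_cast hr)
  have h2 : HasFPowerSeriesAt f (FormalMultilinearSeries.ofScalars ℂ a) 0 := by
    rw [hasFPowerSeriesAt_iff]
    refine Filter.Eventually.of_forall fun z => ?_
    rw [zero_add]
    refine (ha z).congr_fun ?_ |> fun h => h
    intro n
    simp [FormalMultilinearSeries.coeff_ofScalars, mul_comm]
  have h3 := h.hasFPowerSeriesAt.eq_formalMultilinearSeries h2
  have h4 : ‖a n‖ = ‖cauchyPowerSeries f 0 r n‖ := by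
    rw [h3, FormalMultilinearSeries.norm_apply_eq_norm_coef, FormalMultilinearSeries.coeff_ofScalars]
  have h5 := norm_cauchyPowerSeries_le f 0 r n
  rw [← h4, abs_of_pos hr] at h5
  calc ‖a n‖ * (r : ℝ) ^ n ≤ _ * (r : ℝ) ^ n := mul_le_mul_of_nonneg_right h5 (by positivity)
    _ = _ := by rw [mul_assoc, ← mul_pow, inv_mul_cancel₀ hr.ne', one_pow, mul_one]

lemma cauchy_est {f : ℂ → ℂ} (hf : Differentiable ℂ f) {a : ℕ → ℂ} (ha : ∀ z, HasSum (fun n => a n * z ^ n) (f z))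
    (n : ℕ) {r : ℝ} (hr : 0 < r) :
    2 * Real.pi * (‖a n‖ * r ^ n) ^ 4 ≤ ∫ θ in (0 : ℝ)..2 * Real.pi, ‖f (circleMap 0 r θ)‖ ^ 4 := by
  have h1 := cauchy_est1 hf ha n hr
  set A := ‖a n‖ * r ^ n with hA
  have hA0 : 0 ≤ A := by positivity
  have hpi := Real.pi_pos
  have hcont : Continuous fun θ => ‖f (circleMap 0 r θ)‖ := by
    have := hf.continuous
    have := continuous_circleMap 0 r
    fun_prop
  have h2 : ∫ θ in (0 : ℝ)..2 * Real.pi, (4 * A ^ 3 * ‖f (circleMap 0 r θ)‖ - 3 * A ^ 4) ≤ ∫ θ in (0 : ℝ)..2 * Real.pi, ‖f (circleMap 0 r θ)‖ ^ 4 := by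
    apply intervalIntegral.integral_mono_on (by positivity)
    · apply Continuous.intervalIntegrable; fun_prop
    · apply Continuous.intervalIntegrable; fun_prop
    · intro θ _
      have : 0 ≤ ‖f (circleMap 0 r θ)‖ := norm_nonneg _
      nlinarith [sq_nonneg (‖f (circleMap 0 r θ)‖ ^ 2 - A ^ 2), sq_nonneg (‖f (circleMap 0 r θ)‖ - A), sq_nonneg (A * (‖f (circleMap 0 r θ)‖ - A))]
  refine le_trans ?_ h2
  rw [intervalIntegral.integral_sub (by apply Continuous.intervalIntegrable; fun_prop) (by apply Continuous.intervalIntegrable; fun_prop),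
    intervalIntegral.integral_const_mul, intervalIntegral.integral_const, smul_eq_mul]
  rw [inv_mul_eq_div, le_div_iff₀ (by positivity)] at h1
  have := mul_le_mul_of_nonneg_left h1 (show 0 ≤ 4 * A ^ 3 by positivity)
  nlinarith

lemma circle_lint {f : ℂ → ℂ} (hf : Continuous f) (r : ℝ) :
    ENNReal.ofReal (∫ θ in (0 : ℝ)..2 * Real.pi, ‖f (circleMap 0 r θ)‖ ^ 4) =
      ∫⁻ θ in Set.Ioo (-Real.pi) Real.pi, ENNReal.ofReal (‖f (circleMap 0 r θ)‖ ^ 4) := by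
  have hpi := Real.pi_pos
  have hcont : Continuous fun θ => ‖f (circleMap 0 r θ)‖ ^ 4 := by
    have := continuous_circleMap 0 r
    fun_prop
  have hper : Function.Periodic (fun θ => ‖f (circleMap 0 r θ)‖ ^ 4) (2 * Real.pi) := by
    intro θ; beta_reduce; rw [periodic_circleMap 0 r θ]
  have h1 := hper.intervalIntegral_add_eq 0 (-Real.pi)
  rw [zero_add, show -Real.pi + 2 * Real.pi = Real.pi by ring] at h1
  rw [h1, intervalIntegral.integral_of_le (by linarith), integral_Ioc_eq_integral_Ioo]
  rw [ofReal_integral_eq_lintegral_ofReal]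
  · exact (hcont.integrableOn_Icc).mono_set Set.Ioo_subset_Icc_self
  · exact Filter.Eventually.of_forall fun θ => by positivity


lemma rpow_four (y : ℝ) : y ^ (4 : ℝ) = y ^ 4 := by
  rw [show (4 : ℝ) = ((4 : ℕ) : ℝ) by norm_num, Real.rpow_natCast]

lemma fock_polar {α : ℝ} {f : ℂ → ℂ} (hf : Continuous f) :
    fockNormP α 4 f = ∫⁻ r in Set.Ioi (0 : ℝ), ENNReal.ofReal (r * Real.exp (-(4 * (α * logPlus r ^ 2)))) *
      ∫⁻ θ in Set.Ioo (-Real.pi) Real.pi, ENNReal.ofReal (‖f (circleMap 0 r θ)‖ ^ 4) := by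
  rw [fockNormP, ← Complex.lintegral_comp_polarCoord_symm, polarCoord_target, Measure.volume_eq_prod,
    ← Measure.prod_restrict]
  have h1 : ∀ᵐ p : ℝ × ℝ ∂((volume.restrict (Set.Ioi (0 : ℝ))).prod (volume.restrict (Set.Ioo (-Real.pi) Real.pi))),
      ENNReal.ofReal p.1 • ENNReal.ofReal ((‖f (Complex.polarCoord.symm p)‖ * Real.exp (-(phi α (Complex.polarCoord.symm p)))) ^ (4 : ℝ)) =
      ENNReal.ofReal (p.1 * Real.exp (-(4 * (α * logPlus p.1 ^ 2)))) * ENNReal.ofReal (‖f (circleMap 0 p.1 p.2)‖ ^ 4) := by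
    rw [Measure.prod_restrict]
    refine (ae_restrict_iff' (measurableSet_Ioi.prod measurableSet_Ioo)).2 (Filter.Eventually.of_forall fun p hp => ?_)
    have hp1 : 0 < p.1 := hp.1
    have h2 : Complex.polarCoord.symm p = circleMap 0 p.1 p.2 := by
      rw [Complex.polarCoord_symm_apply, circleMap, Complex.exp_mul_I]; simp
    have h3 : ‖circleMap 0 p.1 p.2‖ = p.1 := by rw [norm_circleMap_zero, abs_of_pos hp1]
    rw [h2, phi, h3, rpow_four, smul_eq_mul, ← ENNReal.ofReal_mul hp1.le, ← ENNReal.ofReal_mul (by positivity), mul_pow, ← Real.exp_nat_mul]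
    congr 1
    push_cast
    rw [show (4 : ℝ) * -(α * logPlus p.1 ^ 2) = -(4 * (α * logPlus p.1 ^ 2)) by ring]
    ring
  rw [lintegral_congr_ae h1, lintegral_prod]
  · apply lintegral_congr
    intro r
    dsimp only
    rw [lintegral_const_mul']
    exact ENNReal.ofReal_ne_top
  · apply Measurable.aemeasurable
    have hm : Measurable fun p : ℝ × ℝ => ‖f (circleMap 0 p.1 p.2)‖ := by
      apply Continuous.measurable
      unfold circleMap
      fun_prop
    have hl : Measurable logPlus := by
      unfold logPlus
      fun_prop
    fun_prop

lemma fock_lower {α β : ℝ} (hβ : 0 < β) (hαβ : 2 * α * β = 1) :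
    ∃ C : NNReal, ∀ (f : ℂ → ℂ) (a : ℕ → ℂ), Differentiable ℂ f → (∀ z, HasSum (fun n => a n * z ^ n) (f z)) →
      N4 (fun n : ℕ => a n * (Real.exp (β * (n : ℝ) ^ 2 / 2 + β * n / 2) : ℂ)) ≤ C * fockNormP α 4 f := by
  have hpi := Real.pi_pos
  set κ := 2 * Real.pi * Real.exp (-(2 * β)) * (Real.exp β - 1) with hκ
  have he1 : 0 < Real.exp β - 1 := by have := Real.add_one_le_exp β; linarith
  have hκ0 : 0 < κ := by positivity
  refine ⟨(κ⁻¹).toNNReal, fun f a hf ha => ?_⟩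
  set x : ℕ → ℂ := fun n : ℕ => a n * (Real.exp (β * (n : ℝ) ^ 2 / 2 + β * n / 2) : ℂ) with hx
  have key : ENNReal.ofReal κ * N4 x ≤ fockNormP α 4 f := by
    rw [fock_polar hf.continuous]
    set H : ℝ → ℝ≥0∞ := fun r => ENNReal.ofReal (r * Real.exp (-(4 * (α * logPlus r ^ 2)))) *
      ∫⁻ θ in Set.Ioo (-Real.pi) Real.pi, ENNReal.ofReal (‖f (circleMap 0 r θ)‖ ^ 4) with hH
    set I : ℕ → Set ℝ := fun n : ℕ => Set.Ico (Real.exp (β * n)) (Real.exp (β * (n + 1 : ℕ))) with hI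
    have hmonoI : Monotone fun n : ℕ => Real.exp (β * n) := by
      intro m n h; beta_reduce; gcongr
    have hdisj : Pairwise (Function.onFun Disjoint I) := hmonoI.pairwise_disjoint_on_Ico_succ
    have h1 : ∑' n, ∫⁻ r in I n, H r ≤ ∫⁻ r in Set.Ioi (0 : ℝ), H r := by
      rw [← lintegral_iUnion (fun n => measurableSet_Ico) hdisj]
      apply lintegral_mono_set
      apply Set.iUnion_subset
      intro n r hr
      exact (Real.exp_pos _).trans_le hr.1
    refine le_trans ?_ h1
    unfold N4
    rw [← ENNReal.tsum_mul_left]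
    apply ENNReal.tsum_le_tsum
    intro n
    have h2 : ∀ r ∈ I n, ENNReal.ofReal (2 * Real.pi * ‖x n‖ ^ 4 * Real.exp (-(2 * β)) * Real.exp (-(β * n))) ≤ H r := by
      intro r hr
      have hr0 : 0 < r := (Real.exp_pos _).trans_le hr.1
      obtain ⟨u, hu⟩ : ∃ u, r = Real.exp (β * u) := ⟨Real.log r / β, by rw [mul_div_cancel₀ _ hβ.ne', Real.exp_log hr0]⟩
      have hu1 : (n : ℝ) ≤ u := by
        have := hr.1; rw [hu] at this
        exact le_of_mul_le_mul_left (Real.exp_le_exp.1 this) hβ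
      have hu2 : u < n + 1 := by
        have := hr.2; rw [hu] at this
        have := lt_of_mul_lt_mul_left (Real.exp_lt_exp.1 this) hβ.le
        push_cast at this; exact this
      have hlp : logPlus r = β * u := by
        rw [hu, logPlus, Real.log_exp]; apply max_eq_left
        have : (0 : ℝ) ≤ n := by positivity
        have : 0 ≤ u := by linarith
        positivity
      rw [hH]; beta_reduce
      rw [← circle_lint hf.continuous, ← ENNReal.ofReal_mul (by positivity)]
      apply ENNReal.ofReal_le_ofReal
      refine le_trans ?_ (mul_le_mul_of_nonneg_left (cauchy_est hf ha n hr0) (by positivity))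
      rw [hlp, hx]; beta_reduce
      rw [norm_mul, Complex.norm_real, Real.norm_of_nonneg (Real.exp_pos _).le, hu,
        show 4 * (α * (β * u) ^ 2) = 2 * β * u ^ 2 by linear_combination (2 * β * u ^ 2) * hαβ,
        mul_pow ‖a n‖, mul_pow ‖a n‖, ← Real.exp_nat_mul, ← Real.exp_nat_mul, ← Real.exp_nat_mul]
      have e1 : 2 * Real.pi * (‖a n‖ ^ 4 * Real.exp ((4 : ℕ) * (β * (n : ℝ) ^ 2 / 2 + β * n / 2))) * Real.exp (-(2 * β)) * Real.exp (-(β * n)) =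
        2 * Real.pi * ‖a n‖ ^ 4 * Real.exp ((4 : ℕ) * (β * (n : ℝ) ^ 2 / 2 + β * n / 2) + -(2 * β) + -(β * n)) := by
        rw [Real.exp_add, Real.exp_add]; ring
      have e2 : Real.exp (β * u) * Real.exp (-(2 * β * u ^ 2)) * (2 * Real.pi * (‖a n‖ ^ 4 * Real.exp ((4 : ℕ) * (n * (β * u))))) =
        2 * Real.pi * ‖a n‖ ^ 4 * Real.exp (β * u + -(2 * β * u ^ 2) + (4 : ℕ) * (n * (β * u))) := by
        rw [Real.exp_add, Real.exp_add]; ring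
      rw [e1, e2]
      refine mul_le_mul_of_nonneg_left (Real.exp_le_exp.2 ?_) (by positivity)
      push_cast
      have h5 : (u - n) ^ 2 ≤ 1 := by nlinarith
      have h6 := mul_le_mul_of_nonneg_left h5 hβ.le
      have h7 := mul_le_mul_of_nonneg_left hu1 hβ.le
      linarith
    calc ENNReal.ofReal κ * ‖x n‖ₑ ^ 4 = ENNReal.ofReal (2 * Real.pi * ‖x n‖ ^ 4 * Real.exp (-(2 * β)) * Real.exp (-(β * n))) * volume (I n) := by
          rw [hI]; beta_reduce
          rw [Real.volume_Ico, ← ENNReal.ofReal_mul (by positivity), ← ofReal_norm, ← ENNReal.ofReal_pow (by positivity), ← ENNReal.ofReal_mul hκ0.le]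
          congr 1
          have e3 : Real.exp (-(β * n)) * Real.exp (β * n) = 1 := by rw [← Real.exp_add]; simp
          have e4 : Real.exp (β * ((n + 1 : ℕ) : ℝ)) = Real.exp (β * n) * Real.exp β := by rw [← Real.exp_add]; congr 1; push_cast; ring
          rw [e4, hκ]
          linear_combination -(2 * Real.pi * ‖x n‖ ^ 4 * Real.exp (-(2 * β)) * (Real.exp β - 1)) * e3
      _ ≤ _ := by
          rw [← setLIntegral_const]
          exact setLIntegral_mono' measurableSet_Ico h2
  calc N4 x = ENNReal.ofReal κ⁻¹ * (ENNReal.ofReal κ * N4 x) := by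
        rw [← mul_assoc, ← ENNReal.ofReal_mul (by positivity), inv_mul_cancel₀ hκ0.ne']; simp
    _ ≤ _ := by gcongr; rfl



lemma kap_shift {s t : ℝ} (h : |s - t| ≤ 1) (c : ℝ) : kap 1 (s - c) ≤ ENNReal.ofReal (Real.exp 1) * kap 1 (t - c) := by
  rw [kap, kap, ← ENNReal.ofReal_mul (Real.exp_pos _).le, ← Real.exp_add]
  apply ENNReal.ofReal_le_ofReal
  apply Real.exp_le_exp.2
  have := abs_sub_abs_le_abs_sub (t - c) (s - c)
  rw [show t - c - (s - c) = -(s - t) by ring, abs_neg] at this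
  linarith

lemma fock_upper {α β : ℝ} (hβ : 0 < β) (hαβ : 2 * α * β = 1) :
    ∃ C : NNReal, ∀ (x : ℕ → ℂ),
      fockNormP α 4 (fun z => PS β x (z * (Real.exp (-(β / 2)) : ℂ))) ≤ C * N4 x := by
  obtain ⟨G, hG⟩ := kern_sum 1 one_pos
  set D : ℝ≥0∞ := ENNReal.ofReal (Real.exp (1 ^ 2 / (2 * β))) with hD
  set e : ℝ≥0∞ := ENNReal.ofReal (Real.exp 1) with he
  set Q : ℝ≥0∞ := ENNReal.ofReal (Real.exp (β / 2 + 2 * β)) * NNReal.pi * e ^ 4 with hQ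
  have hQt : Q ≠ ⊤ := by simp [hQ, he, ENNReal.mul_eq_top]
  set W : ℝ≥0∞ := (NNReal.pi + Q) * ((D * G) ^ 3 * (D * G)) with hW
  have hWt : W ≠ ⊤ := by
    simp [hW, hD, ENNReal.mul_eq_top, hQt]
  refine ⟨W.toNNReal, fun x => ?_⟩
  rw [ENNReal.coe_toNNReal hWt]
  set f : ℂ → ℂ := fun z => PS β x (z * (Real.exp (-(β / 2)) : ℂ)) with hf
  set S : ℕ → ℝ≥0∞ := fun k : ℕ => ∑' n : ℕ, D * kap 1 ((k : ℝ) - n) * ‖x n‖ₑ with hS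
  set F : ℂ → ℝ≥0∞ := fun z => ENNReal.ofReal ((‖f z‖ * Real.exp (-(phi α z))) ^ (4 : ℝ)) with hF
  have hF4 : ∀ z, F z = ENNReal.ofReal ((‖f z‖ * Real.exp (-(phi α z))) ^ 4) := fun z => by rw [hF]; beta_reduce; rw [rpow_four]
  have hSsum : ∑' k, S k ^ 4 ≤ (D * G) ^ 3 * (D * G) * N4 x := by
    apply schur4 (fun k n : ℕ => D * kap 1 ((k : ℝ) - n)) (fun n => ‖x n‖ₑ)
    · intro k; rw [ENNReal.tsum_mul_left]; gcongr; exact hG _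
    · intro n; rw [ENNReal.tsum_mul_left]; gcongr
      refine le_trans (le_of_eq ?_) (hG n)
      congr 1; ext k; rw [kap, kap, abs_sub_comm]
  set A : ℕ → Set ℂ := fun k : ℕ => {z | Real.exp (β * k) ≤ ‖z‖ ∧ ‖z‖ < Real.exp (β * (k + 1))} with hA
  have hAm : ∀ k, MeasurableSet (A k) := fun k =>
    (measurableSet_le measurable_const measurable_norm).inter (measurableSet_lt measurable_norm measurable_const)
  have hcover : (Set.univ : Set ℂ) ⊆ Metric.ball 0 1 ∪ ⋃ k, A k := by
    intro z _
    rcases lt_or_ge ‖z‖ 1 with h | h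
    · left; simpa using h
    · right
      have hz0 : 0 < ‖z‖ := by linarith
      have hu0 : 0 ≤ Real.log ‖z‖ / β := div_nonneg (Real.log_nonneg h) hβ.le
      have hzu : ‖z‖ = Real.exp (β * (Real.log ‖z‖ / β)) := by rw [mul_div_cancel₀ _ hβ.ne', Real.exp_log hz0]
      refine Set.mem_iUnion.2 ⟨⌊Real.log ‖z‖ / β⌋₊, ?_, ?_⟩
      · rw [hzu]; apply Real.exp_le_exp.2; gcongr
        rw [← hzu]; exact Nat.floor_le hu0
      · rw [hzu]; apply Real.exp_lt_exp.2; gcongr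
        rw [← hzu]; exact Nat.lt_floor_add_one _
  have hball : ∀ z ∈ Metric.ball (0 : ℂ) 1, F z ≤ S 0 ^ 4 := by
    intro z hz
    have hz1 : ‖z‖ ≤ 1 := by simpa using (Metric.mem_ball.1 hz).le
    have hphi : phi α z = 0 := by
      have : logPlus ‖z‖ = 0 := by rw [logPlus]; exact max_eq_right (Real.log_nonpos (norm_nonneg _) hz1)
      rw [phi, this]; simp
    rw [hF4, hphi, neg_zero, Real.exp_zero, mul_one, ENNReal.ofReal_pow (norm_nonneg _), ofReal_norm]
    gcongr
    rw [hf, hS]; beta_reduce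
    rw [PS]
    refine enorm_tsum_le_tsum_enorm.trans ?_
    apply ENNReal.tsum_le_tsum
    intro n
    rw [enorm_mul, enorm_mul, mul_comm ‖x n‖ₑ, mul_assoc, mul_comm ‖x n‖ₑ, ← mul_assoc]
    gcongr ?_ * _
    rw [← ofReal_norm, ← ofReal_norm, ← ENNReal.ofReal_mul (norm_nonneg _)]
    have h0 := ofReal_gauss_le β hβ (((0 : ℕ) : ℝ) - n)
    refine le_trans (ENNReal.ofReal_le_ofReal ?_) h0
    rw [Complex.norm_real, Real.norm_of_nonneg (Real.exp_pos _).le, norm_pow, norm_mul, Complex.norm_real, Real.norm_of_nonneg (Real.exp_pos _).le]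
    have h1 : Real.exp (-(β / 2)) ≤ 1 := Real.exp_le_one_iff.2 (by linarith)
    have h2 : (‖z‖ * Real.exp (-(β / 2))) ^ n ≤ 1 := pow_le_one₀ (by positivity) (mul_le_one₀ hz1 (Real.exp_pos _).le h1)
    calc _ ≤ Real.exp (-(β * (n : ℝ) ^ 2 / 2)) * 1 := by gcongr
      _ = _ := by simp
  have hann : ∀ k, ∀ z ∈ A k, F z ≤ ENNReal.ofReal (Real.exp (β / 2 - 2 * β * k)) * (e * S k) ^ 4 := by
    intro k z hz
    have hz0 : 0 < ‖z‖ := (Real.exp_pos _).trans_le hz.1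
    obtain ⟨u, hu⟩ : ∃ u, ‖z‖ = Real.exp (β * u) := ⟨Real.log ‖z‖ / β, by rw [mul_div_cancel₀ _ hβ.ne', Real.exp_log hz0]⟩
    have hu1 : (k : ℝ) ≤ u := by
      have := hz.1; rw [hu] at this
      exact le_of_mul_le_mul_left (Real.exp_le_exp.1 this) hβ
    have hu2 : u < k + 1 := by
      have := hz.2; rw [hu] at this
      exact lt_of_mul_lt_mul_left (Real.exp_lt_exp.1 this) hβ.le
    have hu0 : 0 ≤ u := le_trans (by positivity) hu1
    have hphi : phi α z = β * u ^ 2 / 2 := by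
      have : logPlus ‖z‖ = β * u := by rw [hu, logPlus, Real.log_exp]; exact max_eq_left (by positivity)
      rw [phi, this]; linear_combination (β * u ^ 2 / 2) * hαβ
    have hz' : ‖z * (Real.exp (-(β / 2)) : ℂ)‖ = Real.exp (β * (u - 1 / 2)) := by
      rw [norm_mul, Complex.norm_real, Real.norm_of_nonneg (Real.exp_pos _).le, hu, ← Real.exp_add]; congr 1; ring
    have hmv : ‖mv β (u - 1 / 2) (z * (Real.exp (-(β / 2)) : ℂ)) x‖ₑ ≤ e * S k := by
      refine (enorm_mv_le hβ hz' x).trans ?_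
      rw [hS]; beta_reduce
      rw [← ENNReal.tsum_mul_left]
      apply ENNReal.tsum_le_tsum
      intro n
      have := kap_shift (s := u - 1 / 2) (t := k) (by rw [abs_le]; constructor <;> linarith) n
      calc _ ≤ D * (e * kap 1 ((k : ℝ) - n)) * ‖x n‖ₑ := by gcongr
        _ = _ := by ring
    rw [hF4, hphi, hf]; beta_reduce
    rw [norm_PS β (u - 1 / 2)]
    calc _ = ENNReal.ofReal (Real.exp (β / 2 - 2 * β * u) * ‖mv β (u - 1 / 2) (z * (Real.exp (-(β / 2)) : ℂ)) x‖ ^ 4) := by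
          congr 1
          rw [mul_pow, mul_pow, ← Real.exp_nat_mul, ← Real.exp_nat_mul]
          rw [mul_right_comm, ← Real.exp_add]
          congr 2
          push_cast; ring
      _ = ENNReal.ofReal (Real.exp (β / 2 - 2 * β * u)) * ‖mv β (u - 1 / 2) (z * (Real.exp (-(β / 2)) : ℂ)) x‖ₑ ^ 4 := by
          rw [ENNReal.ofReal_mul (Real.exp_pos _).le, ENNReal.ofReal_pow (norm_nonneg _), ofReal_norm]
      _ ≤ _ := by gcongr
  calc fockNormP α 4 f = ∫⁻ z in Set.univ, F z := by rw [setLIntegral_univ]; rfl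
    _ ≤ ∫⁻ z in Metric.ball 0 1 ∪ ⋃ k, A k, F z := lintegral_mono_set hcover
    _ ≤ (∫⁻ z in Metric.ball 0 1, F z) + ∑' k, ∫⁻ z in A k, F z :=
        (lintegral_union_le _ _ _).trans (by gcongr; exact lintegral_iUnion_le _ _)
    _ ≤ S 0 ^ 4 * NNReal.pi + ∑' k, Q * S k ^ 4 := by
        gcongr with k
        · refine (setLIntegral_mono' measurableSet_ball hball).trans ?_
          rw [setLIntegral_const, Complex.volume_ball]; simp
        · refine (setLIntegral_mono' (hAm k) (hann k)).trans ?_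
          rw [setLIntegral_const]
          have hv : volume (A k) ≤ ENNReal.ofReal (Real.exp (β * (k + 1))) ^ 2 * NNReal.pi := by
            rw [← Complex.volume_ball 0]
            apply measure_mono
            intro z hz
            simpa using hz.2
          calc _ ≤ ENNReal.ofReal (Real.exp (β / 2 - 2 * β * k)) * (e * S k) ^ 4 * (ENNReal.ofReal (Real.exp (β * (k + 1))) ^ 2 * NNReal.pi) := by gcongr
            _ = (ENNReal.ofReal (Real.exp (β / 2 - 2 * β * k)) * ENNReal.ofReal (Real.exp (β * (k + 1))) ^ 2) * NNReal.pi * e ^ 4 * S k ^ 4 := by ring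
            _ = _ := by
              rw [hQ, ← ENNReal.ofReal_pow (Real.exp_pos _).le, ← ENNReal.ofReal_mul (Real.exp_pos _).le, ← Real.exp_nat_mul, ← Real.exp_add]
              congr 5
              push_cast; ring
    _ ≤ (∑' k, S k ^ 4) * NNReal.pi + Q * ∑' k, S k ^ 4 := by
        rw [ENNReal.tsum_mul_left]; gcongr
        exact ENNReal.le_tsum (f := fun k => S k ^ 4) 0
    _ = (NNReal.pi + Q) * ∑' k, S k ^ 4 := by ring
    _ ≤ (NNReal.pi + Q) * ((D * G) ^ 3 * (D * G) * N4 x) := by gcongr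
    _ = W * N4 x := by rw [hW]; ring



lemma PS_hasSum {β : ℝ} (hβ : 0 < β) {x : ℕ → ℂ} (hx : N4 x ≠ ⊤) (z : ℂ) :
    HasSum (fun n : ℕ => (x n * (Real.exp (-(β * (n : ℝ) ^ 2 / 2 + β * n / 2)) : ℂ)) * z ^ n) (PS β x (z * (Real.exp (-(β / 2)) : ℂ))) := by
  have he : ∀ n : ℕ, (x n * (Real.exp (-(β * (n : ℝ) ^ 2 / 2 + β * n / 2)) : ℂ)) * z ^ n =
      x n * (Real.exp (-(β * (n : ℝ) ^ 2 / 2)) : ℂ) * (z * (Real.exp (-(β / 2)) : ℂ)) ^ n := by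
    intro n
    rw [mul_pow, ← Complex.ofReal_pow, ← Real.exp_nat_mul, neg_add, Real.exp_add, Complex.ofReal_mul,
      show -(β * n / 2) = n * -(β / 2) by ring]
    ring
  simp_rw [he]
  unfold PS
  apply Summable.hasSum
  set w := z * (Real.exp (-(β / 2)) : ℂ)
  rcases eq_or_ne w 0 with h | h
  · apply summable_of_ne_finset_zero (s := {0})
    intro n hn
    rw [h, zero_pow (by simpa using hn), mul_zero]
  · have hw : ‖w‖ = Real.exp (β * (Real.log ‖w‖ / β)) := by
      rw [mul_div_cancel₀ _ hβ.ne', Real.exp_log (norm_pos_iff.2 h)]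
    have := (summable_mv hβ hw hx).mul_left ((Real.exp ((β * (Real.log ‖w‖ / β) ^ 2 / 2)) : ℂ))
    refine this.congr fun n => ?_
    rw [MM]
    linear_combination (x n * (Real.exp (-(β * (n : ℝ) ^ 2 / 2)) : ℂ) * w ^ n) * exp_cancel (β * (Real.log ‖w‖ / β) ^ 2 / 2)

lemma weight_comp {α β : ℝ} (hβ : 0 < β) (hαβ : 2 * α * β = 1) {τ : ℕ → ℝ} (hmono : Monotone τ) {w : ℕ → ℂ}
    (hw : ∀ k, ‖w k‖ = Real.exp (β * (τ k + 1 / 2))) :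
    ∃ c : ℝ, 0 < c ∧ ∀ k, Real.exp (-(2 * β * τ k ^ 2)) ≤ c * ((1 + ‖w k‖) ^ 2 * Real.exp (-(4 * phi α (w k)))) ∧
      (1 + ‖w k‖) ^ 2 * Real.exp (-(4 * phi α (w k))) ≤ c * Real.exp (-(2 * β * τ k ^ 2)) := by
  have hB1 : 1 ≤ Real.exp (β / 2) := Real.one_le_exp (by positivity)
  have hB2 : 1 ≤ Real.exp (2 * β * τ 0 ^ 2) := Real.one_le_exp (by positivity)
  refine ⟨4 * Real.exp (β / 2) + 4 * Real.exp (2 * β * τ 0 ^ 2), by positivity, fun k => ?_⟩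
  set X := Real.exp (-(2 * β * τ k ^ 2)) with hX
  have hX0 : 0 < X := Real.exp_pos _
  rcases le_or_gt 0 (τ k + 1 / 2) with h | h
  · set v := Real.exp (-(β * (τ k + 1 / 2))) with hv
    have hv0 : 0 < v := Real.exp_pos _
    have hv1 : v ≤ 1 := Real.exp_le_one_iff.2 (by nlinarith)
    have hphi : 4 * phi α (w k) = 2 * β * (τ k + 1 / 2) ^ 2 := by
      have : logPlus ‖w k‖ = β * (τ k + 1 / 2) := by rw [hw, logPlus, Real.log_exp]; exact max_eq_left (by positivity)
      rw [phi, this]; linear_combination (2 * β * (τ k + 1 / 2) ^ 2) * hαβ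
    have heq : (1 + ‖w k‖) ^ 2 * Real.exp (-(4 * phi α (w k))) = (1 + v) ^ 2 * Real.exp (β / 2) * X := by
      have h1 : 1 + ‖w k‖ = (1 + v) * Real.exp (β * (τ k + 1 / 2)) := by
        rw [hw, hv, add_mul, ← Real.exp_add, one_mul]; simp [add_comm]
      rw [h1, hphi, mul_pow, ← Real.exp_nat_mul, hX, mul_assoc ((1+v)^2), ← Real.exp_add, mul_assoc ((1+v)^2) (Real.exp (β/2)), ← Real.exp_add]
      congr 2; push_cast; ring
    rw [heq]
    constructor
    · have h3 : 1 ≤ (1 + v) ^ 2 := by nlinarith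
      have h4 : 1 ≤ (4 * Real.exp (β / 2) + 4 * Real.exp (2 * β * τ 0 ^ 2)) * ((1 + v) ^ 2 * Real.exp (β / 2)) := by
        apply one_le_mul_of_one_le_of_one_le (by linarith)
        exact one_le_mul_of_one_le_of_one_le h3 hB1
      nlinarith
    · have h3 : (1 + v) ^ 2 ≤ 4 := by nlinarith
      gcongr
      nlinarith
  · have hwk1 : ‖w k‖ ≤ 1 := by rw [hw]; exact Real.exp_le_one_iff.2 (by nlinarith)
    have hphi : phi α (w k) = 0 := by
      have : logPlus ‖w k‖ = 0 := by rw [logPlus]; exact max_eq_right (Real.log_nonpos (norm_nonneg _) hwk1)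
      rw [phi, this]; simp
    rw [hphi, mul_zero, neg_zero, Real.exp_zero, mul_one]
    have hX1 : X ≤ 1 := Real.exp_le_one_iff.2 (by nlinarith [mul_nonneg hβ.le (sq_nonneg (τ k))])
    have hX2 : 1 ≤ Real.exp (2 * β * τ 0 ^ 2) * X := by
      rw [hX, ← Real.exp_add]
      apply Real.one_le_exp
      have h0 := hmono (Nat.zero_le k)
      have : τ k ^ 2 ≤ τ 0 ^ 2 := by nlinarith
      have := mul_le_mul_of_nonneg_left this hβ.le
      linarith
    have hn := norm_nonneg (w k)
    constructor
    · have h3 : 1 ≤ (1 + ‖w k‖) ^ 2 := by nlinarith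
      have := one_le_mul_of_one_le_of_one_le (show 1 ≤ 4 * Real.exp (β / 2) + 4 * Real.exp (2 * β * τ 0 ^ 2) by linarith) h3
      linarith
    · have h3 : (1 + ‖w k‖) ^ 2 ≤ 4 := by nlinarith
      have : 0 ≤ 4 * Real.exp (β / 2) * X := by positivity
      nlinarith

lemma disc_comp {α β : ℝ} (hβ : 0 < β) (hαβ : 2 * α * β = 1) {τ : ℕ → ℝ} (hmono : Monotone τ) {w : ℕ → ℂ}
    (hw : ∀ k, ‖w k‖ = Real.exp (β * (τ k + 1 / 2))) (hinj : Function.Injective w) :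
    ∃ c : NNReal, ∀ g : ℂ → ℂ,
      N4 (fun k => (Real.exp (-(β * τ k ^ 2 / 2)) : ℂ) * g (w k)) ≤ c * discNormP α 4 (Set.range w) g ∧
      discNormP α 4 (Set.range w) g ≤ c * N4 (fun k => (Real.exp (-(β * τ k ^ 2 / 2)) : ℂ) * g (w k)) := by
  obtain ⟨c, hc0, hc⟩ := weight_comp hβ hαβ hmono hw
  refine ⟨c.toNNReal, fun g => ?_⟩
  have h1 : discNormP α 4 (Set.range w) g = ∑' k, ENNReal.ofReal (((1 + ‖w k‖) ^ 2 * Real.exp (-(4 * phi α (w k)))) * ‖g (w k)‖ ^ 4) := by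
    rw [discNormP, tsum_range (fun lam : ℂ => ENNReal.ofReal
    ((1 + ‖lam‖) ^ 2 * ‖g lam‖ ^ (4 : ℝ) * Real.exp (-(4 * phi α lam)))) hinj]
    congr 1; ext k; rw [rpow_four]; congr 1; ring
  have h2 : N4 (fun k => (Real.exp (-(β * τ k ^ 2 / 2)) : ℂ) * g (w k)) = ∑' k, ENNReal.ofReal (Real.exp (-(2 * β * τ k ^ 2)) * ‖g (w k)‖ ^ 4) := by
    unfold N4
    congr 1; ext k
    rw [← ofReal_norm, ← ENNReal.ofReal_pow (norm_nonneg _), norm_mul, Complex.norm_real, Real.norm_of_nonneg (Real.exp_pos _).le, mul_pow, ← Real.exp_nat_mul]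
    congr 3; push_cast; ring
  rw [h1, h2, ← ENNReal.tsum_mul_left, ← ENNReal.tsum_mul_left]
  change _ ≤ ∑' k, ENNReal.ofReal c * _ ∧ _ ≤ ∑' k, ENNReal.ofReal c * _
  constructor
  · apply ENNReal.tsum_le_tsum
    intro k
    rw [← ENNReal.ofReal_mul hc0.le, ← mul_assoc]
    exact ENNReal.ofReal_le_ofReal (mul_le_mul_of_nonneg_right (hc k).1 (by positivity))
  · apply ENNReal.tsum_le_tsum
    intro k
    rw [← ENNReal.ofReal_mul hc0.le, ← mul_assoc]
    exact ENNReal.ofReal_le_ofReal (mul_le_mul_of_nonneg_right (hc k).2 (by positivity))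

lemma fock_rep {α β : ℝ} (hβ : 0 < β) (hαβ : 2 * α * β = 1) :
    ∃ C : NNReal, (∀ x : ℕ → ℂ, N4 x ≠ ⊤ → MemFock α 4 (fun z => PS β x (z * (Real.exp (-(β / 2)) : ℂ))) ∧
      fockNormP α 4 (fun z => PS β x (z * (Real.exp (-(β / 2)) : ℂ))) ≤ C * N4 x ∧
      N4 x ≤ C * fockNormP α 4 (fun z => PS β x (z * (Real.exp (-(β / 2)) : ℂ)))) ∧
      ∀ f, MemFock α 4 f → ∃ x : ℕ → ℂ, N4 x ≠ ⊤ ∧ f = fun z => PS β x (z * (Real.exp (-(β / 2)) : ℂ)) := by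
  obtain ⟨C1, h1⟩ := fock_upper hβ hαβ
  obtain ⟨C2, h2⟩ := fock_lower hβ hαβ
  have hcan : ∀ (y : ℂ) (b : ℝ), y * (Real.exp (-b) : ℂ) * (Real.exp b : ℂ) = y := by
    intro y b; linear_combination y * exp_cancel b
  refine ⟨C1 + C2, fun x hx => ?_, fun f hf => ?_⟩
  · obtain ⟨A, _, hA⟩ := bdd_of_N4 hx
    have hd : Differentiable ℂ (fun z => PS β x (z * (Real.exp (-(β / 2)) : ℂ))) := by
      have := PS_entire hβ hA
      fun_prop
    have h3 := h2 _ _ hd (PS_hasSum hβ hx)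
    simp_rw [hcan] at h3
    refine ⟨⟨hd, (h1 x).trans_lt (ENNReal.mul_lt_top (by simp) hx.lt_top)⟩, (h1 x).trans ?_, h3.trans ?_⟩
    · push_cast; gcongr; exact le_self_add
    · push_cast; gcongr; exact le_add_self
  · obtain ⟨a, ha⟩ := entire_series hf.1
    have h3 := h2 f a hf.1 ha
    set x : ℕ → ℂ := fun n : ℕ => a n * (Real.exp (β * (n : ℝ) ^ 2 / 2 + β * n / 2) : ℂ) with hx
    have hxN : N4 x ≠ ⊤ := (h3.trans_lt (ENNReal.mul_lt_top (by simp) hf.2)).ne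
    refine ⟨x, hxN, ?_⟩
    ext z
    refine (ha z).unique ?_
    refine (PS_hasSum hβ hxN z).congr_fun ?_ |> fun h => h
    intro n
    rw [hx]; beta_reduce
    linear_combination -(a n * z ^ n) * exp_cancel (β * (n : ℝ) ^ 2 / 2 + β * n / 2)

theorem transfer {α β : ℝ} (hβ : 0 < β) (hαβ : 2 * α * β = 1) {τ : ℕ → ℝ} (hmono : Monotone τ) {μ w : ℕ → ℂ}
    (hμ : ∀ k, ‖μ k‖ = Real.exp (β * τ k)) (hwμ : ∀ k, w k = (Real.exp (β / 2) : ℂ) * μ k) (hinj : Function.Injective w) :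
    CompleteInterpolating α 4 (Set.range w) ↔ CISm β τ μ := by
  have hw : ∀ k, ‖w k‖ = Real.exp (β * (τ k + 1 / 2)) := by
    intro k
    rw [hwμ, norm_mul, hμ, Complex.norm_real, Real.norm_of_nonneg (Real.exp_pos _).le, ← Real.exp_add]; congr 1; ring
  have hwm : ∀ k, w k * (Real.exp (-(β / 2)) : ℂ) = μ k := by
    intro k; rw [hwμ]; linear_combination μ k * exp_cancel (β / 2)
  obtain ⟨c, hc⟩ := disc_comp hβ hαβ hmono hw hinj
  obtain ⟨C, hC, hrep⟩ := fock_rep hβ hαβ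
  have hmv : ∀ (x : ℕ → ℂ) k, (Real.exp (-(β * τ k ^ 2 / 2)) : ℂ) * (fun z => PS β x (z * (Real.exp (-(β / 2)) : ℂ))) (w k) = mv β (τ k) (μ k) x := by
    intro x k; beta_reduce; rw [hwm, mv_eq]
  constructor
  · rintro ⟨⟨K, hK1, hK⟩, hI⟩
    have hK0 : ENNReal.ofReal K ≠ 0 := by simp; linarith
    refine ⟨⟨C * (K.toNNReal * c) + c * (K.toNNReal * C), fun x hx => ?_⟩, fun v hv => ?_⟩
    · obtain ⟨hM, hu, hl⟩ := hC x hx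
      obtain ⟨k1, k2⟩ := hK _ hM
      obtain ⟨c1, c2⟩ := hc (fun z => PS β x (z * (Real.exp (-(β / 2)) : ℂ)))
      simp_rw [hmv] at c1 c2
      have k3 := (ENNReal.inv_mul_le_iff hK0 ENNReal.ofReal_ne_top).1 k1
      push_cast
      change _ ≤ (C * (ENNReal.ofReal K * c) + c * (ENNReal.ofReal K * C)) * _ ∧ _ ≤ (C * (ENNReal.ofReal K * c) + c * (ENNReal.ofReal K * C)) * _
      constructor
      · calc N4 x ≤ C * fockNormP α 4 (fun z => PS β x (z * (Real.exp (-(β / 2)) : ℂ))) := hl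
          _ ≤ C * (ENNReal.ofReal K * discNormP α 4 (Set.range w) (fun z => PS β x (z * (Real.exp (-(β / 2)) : ℂ)))) := by gcongr
          _ ≤ C * (ENNReal.ofReal K * (c * N4 (fun k => mv β (τ k) (μ k) x))) := by gcongr
          _ = C * (ENNReal.ofReal K * c) * N4 (fun k => mv β (τ k) (μ k) x) := by ring
          _ ≤ (C * (ENNReal.ofReal K * c) + c * (ENNReal.ofReal K * C)) * N4 (fun k => mv β (τ k) (μ k) x) := by gcongr; exact le_self_add
      · calc N4 (fun k => mv β (τ k) (μ k) x) ≤ c * discNormP α 4 (Set.range w) (fun z => PS β x (z * (Real.exp (-(β / 2)) : ℂ))) := c1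
          _ ≤ c * (ENNReal.ofReal K * fockNormP α 4 (fun z => PS β x (z * (Real.exp (-(β / 2)) : ℂ)))) := by gcongr
          _ ≤ c * (ENNReal.ofReal K * (C * N4 x)) := by gcongr
          _ = c * (ENNReal.ofReal K * C) * N4 x := by ring
          _ ≤ (C * (ENNReal.ofReal K * c) + c * (ENNReal.ofReal K * C)) * N4 x := by gcongr; exact le_add_self
    · set g : ℂ → ℂ := Function.extend w (fun k => (Real.exp (β * τ k ^ 2 / 2) : ℂ) * v k) 0 with hg
      have hgw : ∀ k, (Real.exp (-(β * τ k ^ 2 / 2)) : ℂ) * g (w k) = v k := by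
        intro k; rw [hg, hinj.extend_apply]; linear_combination v k * exp_cancel (β * τ k ^ 2 / 2)
      have h1 := (hc g).2
      simp_rw [hgw] at h1
      obtain ⟨f, hf, hfg⟩ := hI g (h1.trans_lt (ENNReal.mul_lt_top (by simp) hv.lt_top))
      obtain ⟨x, hx, hfx⟩ := hrep f hf
      refine ⟨x, hx, fun k => ?_⟩
      rw [← hmv, ← hfx, hfg _ ⟨k, rfl⟩, hgw]
  · rintro ⟨⟨K, hK⟩, hI⟩
    refine ⟨⟨C * (K * c) + c * (K * C) + 1, by have : (0:ℝ) ≤ C * (K * c) + c * (K * C) := by positivity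
                                               linarith, fun f hf => ?_⟩, fun v hv => ?_⟩
    · obtain ⟨x, hx, hfx⟩ := hrep f hf
      obtain ⟨hM, hu, hl⟩ := hC x hx
      obtain ⟨k1, k2⟩ := hK x hx
      obtain ⟨c1, c2⟩ := hc f
      rw [← hfx] at hu hl
      have hmv' : ∀ k, (Real.exp (-(β * τ k ^ 2 / 2)) : ℂ) * f (w k) = mv β (τ k) (μ k) x := by
        intro k; rw [← hmv, ← hfx]
      simp_rw [hmv'] at c1 c2
      have hof : ENNReal.ofReal (C * (K * c) + c * (K * C) + 1) = C * (K * c) + c * (K * C) + 1 := by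
        rw [show (C * (K * c) + c * (K * C) + 1 : ℝ) = ((C * (K * c) + c * (K * C) + 1 : NNReal) : ℝ) by push_cast; rfl, ENNReal.ofReal_coe_nnreal]
        push_cast; rfl
      constructor
      · rw [ENNReal.inv_mul_le_iff (by rw [hof]; simp) ENNReal.ofReal_ne_top, hof]
        calc fockNormP α 4 f ≤ C * N4 x := hu
          _ ≤ C * (K * N4 (fun k => mv β (τ k) (μ k) x)) := by gcongr
          _ ≤ C * (K * (c * discNormP α 4 (Set.range w) f)) := by gcongr
          _ = C * (K * c) * discNormP α 4 (Set.range w) f := by ring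
          _ ≤ (C * (K * c) + c * (K * C) + 1) * discNormP α 4 (Set.range w) f := by gcongr; rw [add_assoc]; exact le_self_add
      · rw [hof]
        calc discNormP α 4 (Set.range w) f ≤ c * N4 (fun k => mv β (τ k) (μ k) x) := c2
          _ ≤ c * (K * N4 x) := by gcongr
          _ ≤ c * (K * (C * fockNormP α 4 f)) := by gcongr
          _ = c * (K * C) * fockNormP α 4 f := by ring
          _ ≤ (C * (K * c) + c * (K * C) + 1) * fockNormP α 4 f := by gcongr; exact le_add_self.trans le_self_add
    · have h1 := (hc v).1
      obtain ⟨x, hx, hxv⟩ := hI (fun k => (Real.exp (-(β * τ k ^ 2 / 2)) : ℂ) * v (w k)) (h1.trans_lt (ENNReal.mul_lt_top (by simp) hv)).ne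
      refine ⟨_, (hC x hx).1, ?_⟩
      rintro _ ⟨k, rfl⟩
      have h2 := hxv k
      rw [← hmv] at h2
      exact mul_left_cancel₀ (by exact_mod_cast (Real.exp_pos _).ne') h2



/-- Separation in the distance `dRho` versus relative separation. -/
lemma sep_equiv {α : ℝ} (hα : 0 < α) {γ : ℕ → ℂ} (hinj : Function.Injective γ) (h0 : 0 < ‖γ 0‖)
    (hmono : Monotone fun n => ‖γ n‖) :
    DRhoSeparated α (Set.range γ) ↔ ∃ ε : ℝ, 0 < ε ∧ ∀ j k, j ≠ k → ε * ‖γ k‖ ≤ ‖γ j - γ k‖ := by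
  have hs : 0 < Real.sqrt (2 * α) := Real.sqrt_pos.2 (by positivity)
  set s := Real.sqrt (2 * α) with hsd
  have hpos : ∀ n, 0 < ‖γ n‖ := fun n => h0.trans_le (hmono (Nat.zero_le n))
  constructor
  · rintro ⟨ε, hε, h⟩
    -- weak form with the minimum
    have h1 : ∀ j k, j ≠ k → ε / s * min ‖γ j‖ ‖γ k‖ ≤ ‖γ j - γ k‖ := by
      intro j k hjk
      have h2 := h _ ⟨j, rfl⟩ _ ⟨k, rfl⟩ (fun e => hjk (hinj e))
      unfold dRho rhoF at h2
      have hm : min (‖γ j‖ / s) (‖γ k‖ / s) = min ‖γ j‖ ‖γ k‖ / s := (min_div_div_right hs.le _ _)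
      rw [← hsd, hm] at h2
      have hmin : 0 < min ‖γ j‖ ‖γ k‖ := lt_min (hpos j) (hpos k)
      rw [le_div_iff₀ (by positivity)] at h2
      calc ε / s * min ‖γ j‖ ‖γ k‖ = ε * (min ‖γ j‖ ‖γ k‖ / s) := by ring
        _ ≤ ε * (1 + min ‖γ j‖ ‖γ k‖ / s) := by gcongr; linarith
        _ ≤ _ := h2
    set e := ε / s with he
    have he0 : 0 < e := by positivity
    refine ⟨e / (1 + e), by positivity, fun j k hjk => ?_⟩
    have h2 := h1 j k hjk
    have h3 : ‖γ k‖ - ‖γ j‖ ≤ ‖γ j - γ k‖ := by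
      rw [norm_sub_rev]; exact norm_sub_norm_le _ _
    rw [div_mul_eq_mul_div, div_le_iff₀ (by positivity)]
    rcases le_total ‖γ j‖ ‖γ k‖ with h4 | h4
    · rw [min_eq_left h4] at h2
      nlinarith
    · rw [min_eq_right h4] at h2
      nlinarith [norm_nonneg (γ j - γ k)]
  · rintro ⟨ε, hε, h⟩
    refine ⟨ε / (1 / ‖γ 0‖ + 1 / s), by positivity, ?_⟩
    rintro _ ⟨j, rfl⟩ _ ⟨k, rfl⟩ hjk
    have h2 := h j k (fun e => hjk (congrArg γ e))
    unfold dRho rhoF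
    rw [← hsd, le_div_iff₀ (by positivity), div_mul_eq_mul_div, div_le_iff₀ (by positivity)]
    have h3 : min (‖γ j‖ / s) (‖γ k‖ / s) ≤ ‖γ k‖ / s := min_le_right _ _
    have h4 : 1 ≤ ‖γ k‖ / ‖γ 0‖ := by rw [one_le_div h0]; exact hmono (Nat.zero_le k)
    calc ε * (1 + min (‖γ j‖ / s) (‖γ k‖ / s)) ≤ ε * (‖γ k‖ / ‖γ 0‖ + ‖γ k‖ / s) := by gcongr
      _ = (ε * ‖γ k‖) * (1 / ‖γ 0‖ + 1 / s) := by ring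
      _ ≤ _ := by gcongr

/-- Block averages versus linear growth of partial sums. -/
lemma avg_equiv {α β : ℝ} (hα : 0 < α) (hβ : β = 1 / (2 * α)) {τ δ : ℕ → ℝ} (hτ : ∀ n : ℕ, δ n = β * (τ n - n))
    {E : ℝ} (hE : ∀ j : ℕ, |τ j - j| ≤ E) :
    (∃ N : ℕ, 1 ≤ N ∧ -(1 / (4 * α)) < (⨅ n : ℕ, avgD δ N n) ∧ (⨆ n : ℕ, avgD δ N n) < 1 / (4 * α)) ↔
    ∃ c Ca : ℝ, 0 < c ∧ ∀ k m : ℕ, k ≤ m → |Ep τ m - Ep τ k| ≤ (1 / 2 - c) * (m - k) + Ca := by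
  have hβ0 : 0 < β := by rw [hβ]; positivity
  have hβ4 : 1 / (4 * α) = β / 2 := by rw [hβ]; field_simp; norm_num
  rw [hβ4]
  have hE0 : 0 ≤ E := (abs_nonneg _).trans (hE 0)
  have hdiff : ∀ n N : ℕ, Ep τ (n + N) - Ep τ n = ∑ k ∈ Finset.range N, (τ (n + k) - ((n + k : ℕ) : ℝ)) := by
    intro n N
    rw [Ep, Ep, Finset.sum_range_add, add_sub_cancel_left]
  have hbd : ∀ n N : ℕ, |Ep τ (n + N) - Ep τ n| ≤ E * N := by
    intro n N
    rw [hdiff]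
    refine (Finset.abs_sum_le_sum_abs _ _).trans ((Finset.sum_le_sum fun k _ => hE (n + k)).trans ?_)
    simp [mul_comm]
  have havg : ∀ n N : ℕ, 1 ≤ N → avgD δ N n * N = β * (Ep τ (n + N) - Ep τ n) := by
    intro n N hN
    have : (N : ℝ) ≠ 0 := by positivity
    rw [hdiff, avgD, Finset.mul_sum (f := fun k => τ (n + k) - ((n + k : ℕ) : ℝ))]
    simp_rw [hτ]
    rw [mul_right_comm, one_div, inv_mul_cancel₀ this, one_mul]
  have havb : ∀ n N : ℕ, 1 ≤ N → |avgD δ N n| ≤ β * E := by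
    intro n N hN
    have h0 : (0 : ℝ) < N := by positivity
    have h1 := congrArg abs (havg n N hN)
    rw [abs_mul, abs_mul, abs_of_pos h0, abs_of_pos hβ0] at h1
    have h2 := mul_le_mul_of_nonneg_left (hbd n N) hβ0.le
    rw [← h1] at h2
    nlinarith
  constructor
  · rintro ⟨N, hN, h1, h2⟩
    have hN0 : (0 : ℝ) < N := by positivity
    set A := ⨅ n : ℕ, avgD δ N n
    set B := ⨆ n : ℕ, avgD δ N n
    have hA : ∀ n, A ≤ avgD δ N n := fun n => ciInf_le ⟨-(β * E), by rintro _ ⟨n, rfl⟩; exact (abs_le.1 (havb n N hN)).1⟩ n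
    have hB : ∀ n, avgD δ N n ≤ B := fun n => le_ciSup ⟨β * E, by rintro _ ⟨n, rfl⟩; exact (abs_le.1 (havb n N hN)).2⟩ n
    obtain ⟨c, hc0, hc1, hc2, hc3⟩ : ∃ c : ℝ, 0 < c ∧ c ≤ 1 / 2 ∧ -(β * (1 / 2 - c)) ≤ A ∧ B ≤ β * (1 / 2 - c) := by
      refine ⟨min (1 / 2) (min ((A + β / 2) / β) ((β / 2 - B) / β)), ?_, min_le_left _ _, ?_, ?_⟩
      · refine lt_min (by norm_num) (lt_min (div_pos (by linarith) hβ0) (div_pos (by linarith) hβ0))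
      · have : min (1 / 2) (min ((A + β / 2) / β) ((β / 2 - B) / β)) ≤ (A + β / 2) / β := (min_le_right _ _).trans (min_le_left _ _)
        rw [le_div_iff₀ hβ0] at this; linarith
      · have : min (1 / 2) (min ((A + β / 2) / β) ((β / 2 - B) / β)) ≤ (β / 2 - B) / β := (min_le_right _ _).trans (min_le_right _ _)
        rw [le_div_iff₀ hβ0] at this; linarith
    have hblk : ∀ n, |Ep τ (n + N) - Ep τ n| ≤ (1 / 2 - c) * N := by
      intro n
      have h3 := havg n N hN
      have h4 : |avgD δ N n| ≤ β * (1 / 2 - c) := abs_le.2 ⟨hc2.trans (hA n), (hB n).trans hc3⟩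
      have h1 := congrArg abs h3
      rw [abs_mul, abs_mul, abs_of_pos hN0, abs_of_pos hβ0] at h1
      have h5 := mul_le_mul_of_nonneg_right h4 hN0.le
      rw [h1, mul_assoc] at h5
      exact le_of_mul_le_mul_left h5 hβ0
    have hq : ∀ q n : ℕ, |Ep τ (n + q * N) - Ep τ n| ≤ (1 / 2 - c) * (q * N) := by
      intro q n
      induction q with
      | zero => simp
      | succ q ih =>
        have h3 := hblk (n + q * N)
        rw [show n + (q + 1) * N = n + q * N + N by ring]
        have h4 := abs_add_le (Ep τ (n + q * N + N) - Ep τ (n + q * N)) (Ep τ (n + q * N) - Ep τ n)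
        rw [sub_add_sub_cancel] at h4
        push_cast
        linarith
    refine ⟨c, E * N, hc0, fun k m hkm => ?_⟩
    obtain ⟨d, rfl⟩ := Nat.exists_eq_add_of_le hkm
    have hd : d / N * N + d % N = d := Nat.div_add_mod' d N
    have h3 := hq (d / N) k
    have h4 := hbd (k + d / N * N) (d % N)
    rw [add_assoc, hd] at h4
    have h5 := abs_add_le (Ep τ (k + d) - Ep τ (k + d / N * N)) (Ep τ (k + d / N * N) - Ep τ k)
    rw [sub_add_sub_cancel] at h5
    have h6 : ((d % N : ℕ) : ℝ) ≤ N := by exact_mod_cast (Nat.mod_lt d (by omega)).le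
    have h7 : ((d / N : ℕ) : ℝ) * N ≤ d := by
      have : d / N * N ≤ d := by omega
      exact_mod_cast this
    have h8 := mul_le_mul_of_nonneg_left h6 hE0
    have h9 := mul_le_mul_of_nonneg_left h7 (show 0 ≤ 1 / 2 - c by linarith)
    push_cast
    rw [add_sub_cancel_left]
    linarith
  · rintro ⟨c, Ca, hc, h⟩
    obtain ⟨N0, hN0⟩ := exists_nat_gt (2 * Ca / c)
    refine ⟨N0 + 1, by omega, ?_⟩
    set N := N0 + 1 with hN
    have hNp : (0 : ℝ) < N := by positivity
    have hNc : 2 * Ca < c * N := by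
      rw [div_lt_iff₀ hc] at hN0; rw [hN]; push_cast; nlinarith
    have hb : ∀ n, |avgD δ N n| ≤ β * (1 / 2 - c / 2) := by
      intro n
      have h3 := h n (n + N) (by omega)
      push_cast at h3
      rw [add_sub_cancel_left] at h3
      have h1 := congrArg abs (havg n N (by omega))
      rw [abs_mul, abs_mul, abs_of_pos hNp, abs_of_pos hβ0] at h1
      have h4 : |Ep τ (n + N) - Ep τ n| ≤ (1 / 2 - c / 2) * N := by linarith
      have h5 := mul_le_mul_of_nonneg_left h4 hβ0.le
      rw [← h1, ← mul_assoc] at h5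
      exact le_of_mul_le_mul_right h5 hNp
    constructor
    · have : -(β * (1 / 2 - c / 2)) ≤ ⨅ n : ℕ, avgD δ N n := le_ciInf fun n => (abs_le.1 (hb n)).1
      nlinarith
    · have : (⨆ n : ℕ, avgD δ N n) ≤ β * (1 / 2 - c / 2) := ciSup_le fun n => (abs_le.1 (hb n)).2
      nlinarith

theorem main_aux (α : ℝ) (hα : 0 < α) (γ : ℕ → ℂ) (hinj : Function.Injective γ)
    (hmono : ∀ n, ‖γ n‖ ≤ ‖γ (n + 1)‖) (δ θ : ℕ → ℝ)
    (hdecomp : ∀ n, γ n = (Real.exp ((1 + (n : ℝ)) / (2 * α) + δ n) : ℂ) * Complex.exp ((θ n : ℂ) * Complex.I)) :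
    CompleteInterpolating α 4 {w : ℂ | ∃ n : ℕ, w = (Real.exp (-(1 / (4 * α))) : ℂ) * γ n} ↔
      (DRhoSeparated α (Set.range γ) ∧ (∃ M : ℝ, ∀ n, |δ n| ≤ M) ∧
       (∃ N : ℕ, 1 ≤ N ∧ -(1 / (4 * α)) < (⨅ n : ℕ, avgD δ N n) ∧ (⨆ n : ℕ, avgD δ N n) < 1 / (4 * α))) := by
  obtain ⟨β, hβ⟩ : ∃ β, β = 1 / (2 * α) := ⟨_, rfl⟩
  have hβ0 : 0 < β := by rw [hβ]; positivity
  have hαβ : 2 * α * β = 1 := by rw [hβ]; field_simp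
  set τ : ℕ → ℝ := fun n => n + δ n / β with hτd
  have hτ : ∀ n : ℕ, δ n = β * (τ n - n) := by intro n; rw [hτd]; field_simp; ring
  have hγ : ∀ n, ‖γ n‖ = Real.exp (β * (τ n + 1)) := by
    intro n
    rw [hdecomp, norm_mul, Complex.norm_exp_ofReal_mul_I, mul_one, Complex.norm_real, Real.norm_of_nonneg (Real.exp_pos _).le]
    congr 1
    rw [hτ n, hβ]; ring
  set μ : ℕ → ℂ := fun n => (Real.exp (-β) : ℂ) * γ n with hμd
  have hμn : ∀ n, ‖μ n‖ = Real.exp (-β) * ‖γ n‖ := by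
    intro n; rw [hμd]; simp only [norm_mul, Complex.norm_real, Real.norm_of_nonneg (Real.exp_pos _).le]
  have hμ : ∀ n, ‖μ n‖ = Real.exp (β * τ n) := by
    intro n; rw [hμn, hγ, ← Real.exp_add]; congr 1; ring
  have hexp : ∀ b : ℝ, (Real.exp b : ℂ) ≠ 0 := fun b => by exact_mod_cast (Real.exp_pos b).ne'
  have hμi : Function.Injective μ := fun a b h => hinj (mul_left_cancel₀ (hexp _) h)
  set w : ℕ → ℂ := fun n => (Real.exp (-(1 / (4 * α))) : ℂ) * γ n with hwd
  have hwi : Function.Injective w := fun a b h => hinj (mul_left_cancel₀ (hexp _) h)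
  have hwμ : ∀ k, w k = (Real.exp (β / 2) : ℂ) * μ k := by
    intro k
    rw [hwd, hμd]; beta_reduce
    rw [← mul_assoc, ← Complex.ofReal_mul, ← Real.exp_add]
    congr 4
    rw [hβ]; field_simp; norm_num
  have hset : {w : ℂ | ∃ n : ℕ, w = (Real.exp (-(1 / (4 * α))) : ℂ) * γ n} = Set.range w := by
    ext z; simp only [Set.mem_setOf_eq, Set.mem_range, hwd, eq_comm]
  have hγm : Monotone fun n => ‖γ n‖ := monotone_nat_of_le_succ hmono
  have hτm : Monotone τ := by
    intro a b hab
    have := hγm hab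
    simp only [hγ] at this
    have := le_of_mul_le_mul_left (Real.exp_le_exp.1 this) hβ0
    linarith
  rw [hset, transfer hβ0 hαβ hτm hμ hwμ hwi, sep_equiv hα hinj (by rw [hγ]; exact Real.exp_pos _) hγm]
  have hsep : ∀ ε : ℝ, (∀ j k, j ≠ k → ε * ‖γ k‖ ≤ ‖γ j - γ k‖) ↔ (∀ j k, j ≠ k → ε * ‖μ k‖ ≤ ‖μ j - μ k‖) := by
    intro ε
    have hd : ∀ j k, ‖μ j - μ k‖ = Real.exp (-β) * ‖γ j - γ k‖ := by
      intro j k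
      rw [hμd]; beta_reduce
      rw [← mul_sub, norm_mul, Complex.norm_real, Real.norm_of_nonneg (Real.exp_pos _).le]
    have : ∀ j k, (ε * ‖γ k‖ ≤ ‖γ j - γ k‖) ↔ (ε * ‖μ k‖ ≤ ‖μ j - μ k‖) := by
      intro j k
      rw [hd, hμn, mul_left_comm, mul_le_mul_iff_right₀ (Real.exp_pos _)]
    simp_rw [this]
  simp_rw [hsep]
  have hδ : ∀ n, |δ n| = β * |τ n - n| := by intro n; rw [hτ, abs_mul, abs_of_pos hβ0]
  have hbd : (∃ M : ℝ, ∀ n, |δ n| ≤ M) ↔ ∃ E : ℝ, ∀ j, |τ j - j| ≤ E := by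
    constructor
    · rintro ⟨M, hM⟩
      refine ⟨M / β, fun j => ?_⟩
      rw [le_div_iff₀ hβ0, mul_comm, ← hδ]; exact hM j
    · rintro ⟨E, hE⟩
      refine ⟨β * E, fun j => ?_⟩
      rw [hδ]; exact mul_le_mul_of_nonneg_left (hE j) hβ0.le
  rw [hbd]
  constructor
  · intro h
    obtain ⟨h1, ⟨E, h2⟩, h3⟩ := necessity hβ0 hμ hτm hμi h
    exact ⟨h1, ⟨E, h2⟩, (avg_equiv hα hβ hτ h2).2 h3⟩
  · rintro ⟨⟨ε, hε, hs⟩, ⟨E, hE⟩, h3⟩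
    obtain ⟨c, Ca, hc, h4⟩ := (avg_equiv hα hβ hτ hE).1 h3
    exact sufficiency hβ0 hμ hμi hE hε hs hc h4


/-- for `p = 4`, `e^{-1/(4α)}Γ` is a complete interpolating sequence for
`F^4_φ` iff `Γ` is `d_ρ`-separated, `(δ_n)` is bounded, and
`-1/(4α) < ∇_N ≤ Δ_N < 1/(4α)` for some `N ≥ 1`. -/
theorem statement4 (α : ℝ) (hα : 0 < α)
    (γ : ℕ → ℂ) (hinj : Function.Injective γ)
    (hmono : ∀ n, ‖γ n‖ ≤ ‖γ (n + 1)‖)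
    (δ θ : ℕ → ℝ)
    (hdecomp : ∀ n, γ n =
      (Real.exp ((1 + (n : ℝ)) / (2 * α) + δ n) : ℂ) * Complex.exp ((θ n : ℂ) * Complex.I)) :
    CompleteInterpolating α 4
        {w : ℂ | ∃ n : ℕ, w = (Real.exp (-(1 / (4 * α))) : ℂ) * γ n} ↔
      (DRhoSeparated α (Set.range γ) ∧
       (∃ M : ℝ, ∀ n, |δ n| ≤ M) ∧
       (∃ N : ℕ, 1 ≤ N ∧
         -(1 / (4 * α)) < (⨅ n : ℕ, avgD δ N n) ∧
         (⨆ n : ℕ, avgD δ N n) < 1 / (4 * α))) :=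
  main_aux α hα γ hinj hmono δ θ hdecomp

end
end

section
/- Let α > 0 and 1 ≤ p < ∞. There exists a constant C ≥ 1 such that for every f ∈ F^p_φ and every z ∈ ℂ one has |f(z)| ≤ C (1+|z|)^{−2/p} e^{φ(z)} ‖f‖_{p,φ}. In particular, for each fixed z ∈ ℂ the point evaluation functional L_z : f ↦ f(z) is a bounded linear functional on F^p_φ. -/
open MeasureTheory Complex
open scoped ENNReal

noncomputable section

/-- Circle mean value inequality on lower integrals. -/
lemma circle_mv (g : ℂ → ℂ) (z : ℂ) (r : ℝ) (hg : DifferentiableOn ℂ g (Metric.ball z r))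
    (w : ℂ) (hw : w ∈ Metric.ball (0 : ℂ) r) :
    ENNReal.ofReal (2 * Real.pi) * ‖g z‖ₑ ≤
      ∫⁻ θ in Set.Ioc 0 (2 * Real.pi), ‖g (z + circleMap 0 1 θ * w)‖ₑ := by
  have hmem : ∀ ζ : ℂ, ‖ζ‖ ≤ 1 → z + ζ * w ∈ Metric.ball z r := by
    intro ζ hζ
    simp only [Metric.mem_ball, dist_self_add_left, norm_mul, dist_zero_right] at hw ⊢
    nlinarith [norm_nonneg w, norm_nonneg ζ]
  have hd : DifferentiableOn ℂ (fun ζ : ℂ => g (z + ζ * w)) (Metric.closedBall 0 |1|) := by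
    refine hg.comp (by fun_prop) ?_
    intro ζ hζ
    apply hmem
    simpa using hζ
  have h1 : Real.circleAverage (fun ζ : ℂ => g (z + ζ * w)) 0 1 = g z := by
    have hc : DiffContOnCl ℂ (fun ζ : ℂ => g (z + ζ * w)) (Metric.ball 0 |1|) :=
      hd.diffContOnCl_ball subset_rfl
    have := hc.circleAverage
    simpa using this
  rw [Real.circleAverage_def] at h1
  have h2 : (∫ θ in (0:ℝ)..2 * Real.pi, g (z + circleMap 0 1 θ * w)) = (2 * Real.pi : ℝ) • g z := by
    rw [← h1, smul_smul, mul_inv_cancel₀ (by positivity), one_smul]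
  rw [intervalIntegral.integral_of_le (by positivity)] at h2
  calc _ = ‖(2 * Real.pi : ℝ) • g z‖ₑ := by
        rw [enorm_smul, Real.enorm_eq_ofReal (by positivity)]
    _ ≤ _ := by
        rw [← h2]
        exact enorm_integral_le_lintegral_enorm _

lemma area_mv (g : ℂ → ℂ) (z : ℂ) (r : ℝ) (hg : DifferentiableOn ℂ g (Metric.ball z r)) :
    ‖g z‖ₑ * volume (Metric.ball z r) ≤ ∫⁻ w in Metric.ball z r, ‖g w‖ₑ := by
  set G : ℂ → ℝ≥0∞ := (Metric.ball z r).indicator (fun w => ‖g w‖ₑ) with hG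
  have hGm : Measurable G := by
    have h0 : AEMeasurable g (volume.restrict (Metric.ball z r)) :=
      hg.continuousOn.aemeasurable Metric.isOpen_ball.measurableSet
    have : G = fun w => ‖(Metric.ball z r).indicator g w‖ₑ := by
      ext w
      by_cases h : w ∈ Metric.ball z r <;> simp [hG, h]
    rw [this]
    apply Measurable.enorm
    classical
    have hpw := hg.continuousOn.measurable_piecewise (g := fun _ => (0 : ℂ)) continuousOn_const
      Metric.isOpen_ball.measurableSet
    have e : (Metric.ball z r).piecewise g (fun _ => (0 : ℂ)) = (Metric.ball z r).indicator g := by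
      ext w
      by_cases h : w ∈ Metric.ball z r <;> simp [h]
    rwa [e] at hpw
  have hpi : ENNReal.ofReal (2 * Real.pi) ≠ 0 := by simp [Real.pi_pos]
  have hrot : ∀ θ : ℝ, ∫⁻ w, G (z + circleMap 0 1 θ * w) = ∫⁻ w, G w := by
    intro θ
    have hmp := (rotation (Circle.exp θ)).measurePreserving
    have h1 := hmp.lintegral_comp (f := fun w => G (z + w)) (by fun_prop)
    simp only [rotation_apply, Circle.coe_exp] at h1
    simp only [circleMap, zero_add, ofReal_one, one_mul]
    rw [h1]
    exact lintegral_add_left_eq_self G z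
  have hmeas : Measurable (fun q : ℝ × ℂ => G (z + circleMap 0 1 q.1 * q.2)) := by
    apply hGm.comp
    have : Continuous (circleMap 0 1) := continuous_circleMap 0 1
    fun_prop
  have key : ENNReal.ofReal (2 * Real.pi) * (‖g z‖ₑ * volume (Metric.ball z r))
      ≤ ENNReal.ofReal (2 * Real.pi) * ∫⁻ w, G w := by
    calc ENNReal.ofReal (2 * Real.pi) * (‖g z‖ₑ * volume (Metric.ball z r))
        = ∫⁻ w in Metric.ball (0:ℂ) r, ENNReal.ofReal (2 * Real.pi) * ‖g z‖ₑ := by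
          rw [setLIntegral_const, mul_assoc]
          congr 2
          simp only [Complex.volume_ball]
      _ ≤ ∫⁻ w in Metric.ball (0:ℂ) r, ∫⁻ θ in Set.Ioc 0 (2 * Real.pi),
            G (z + circleMap 0 1 θ * w) := by
          apply setLIntegral_mono' Metric.isOpen_ball.measurableSet
          intro w hw
          refine (circle_mv g z r hg w hw).trans (le_of_eq ?_)
          congr 1
          ext θ
          rw [hG, Set.indicator_of_mem]
          simpa using hw
      _ ≤ ∫⁻ w, ∫⁻ θ in Set.Ioc 0 (2 * Real.pi), G (z + circleMap 0 1 θ * w) :=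
          setLIntegral_le_lintegral _ _
      _ = ∫⁻ θ in Set.Ioc 0 (2 * Real.pi), ∫⁻ w, G (z + circleMap 0 1 θ * w) :=
          (lintegral_lintegral_swap hmeas.aemeasurable).symm
      _ = _ := by
          simp_rw [hrot]
          rw [setLIntegral_const, Real.volume_Ioc, sub_zero, mul_comm]
  have h2 := (ENNReal.mul_le_mul_iff_right hpi ENNReal.ofReal_ne_top).1 key
  rwa [hG, lintegral_indicator Metric.isOpen_ball.measurableSet] at h2

lemma area_mv_p (p : ℝ) (hp : 1 ≤ p) (g : ℂ → ℂ) (z : ℂ) (r : ℝ) (hr : 0 < r)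
    (hg : DifferentiableOn ℂ g (Metric.ball z r)) :
    ‖g z‖ₑ ^ p * volume (Metric.ball z r) ≤ ∫⁻ w in Metric.ball z r, ‖g w‖ₑ ^ p := by
  have h1 := area_mv g z r hg
  have hp0 : 0 < p := by linarith
  have hm : AEStronglyMeasurable g (volume.restrict (Metric.ball z r)) :=
    hg.continuousOn.aestronglyMeasurable Metric.isOpen_ball.measurableSet
  have h2 := eLpNorm'_le_eLpNorm'_mul_rpow_measure_univ (p := 1) (q := p) zero_lt_one hp hm
  simp only [eLpNorm', ENNReal.rpow_one, div_one, Measure.restrict_apply_univ] at h2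
  have hV0 : volume (Metric.ball z r) ≠ 0 := (Metric.measure_ball_pos _ _ hr).ne'
  have hVt : volume (Metric.ball z r) ≠ ⊤ := measure_ball_lt_top.ne
  set V := volume (Metric.ball z r)
  have h3 := ENNReal.rpow_le_rpow (h1.trans h2) hp0.le
  rw [ENNReal.mul_rpow_of_nonneg _ _ hp0.le, ENNReal.mul_rpow_of_nonneg _ _ hp0.le,
    ← ENNReal.rpow_mul, ← ENNReal.rpow_mul, one_div, inv_mul_cancel₀ hp0.ne', ENNReal.rpow_one,
    sub_mul, inv_mul_cancel₀ hp0.ne', one_mul] at h3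
  have h4 : V ^ p = V * V ^ (p - 1) := by
    conv_rhs => rw [← ENNReal.rpow_one V, ← ENNReal.rpow_mul, one_mul]
    rw [← ENNReal.rpow_add _ _ hV0 hVt]; ring_nf
  rw [h4, ← mul_assoc] at h3
  refine (ENNReal.mul_le_mul_iff_left ?_ ?_).1 h3
  · exact (ENNReal.rpow_pos (pos_iff_ne_zero.2 hV0) hVt).ne'
  · exact ENNReal.rpow_ne_top_of_nonneg (by linarith) hVt

lemma local_model (α : ℝ) (hα : 0 < α) (f : ℂ → ℂ) (hf : Differentiable ℂ f) (z : ℂ) :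
    ∃ (r : ℝ) (g : ℂ → ℂ), (1 + ‖z‖) / 3 ≤ r ∧ DifferentiableOn ℂ g (Metric.ball z r) ∧
      g z = f z ∧ ∀ w ∈ Metric.ball z r,
        ‖g w‖ ≤ Real.exp (4 * α) * Real.exp (phi α z) * (‖f w‖ * Real.exp (-(phi α w))) := by
  rcases lt_or_ge ‖z‖ 2 with hz | hz
  · refine ⟨1, f, by linarith, hf.differentiableOn, rfl, fun w hw => ?_⟩
    have hw3 : ‖w‖ ≤ 3 := by
      have := norm_le_norm_add_norm_sub' w z
      rw [mem_ball_iff_norm] at hw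
      linarith
    have h0 : 0 ≤ logPlus ‖w‖ := le_max_right _ _
    have h2 : logPlus ‖w‖ ≤ 2 := by
      apply max_le _ (by norm_num)
      rcases (norm_nonneg w).eq_or_lt with h | h
      · rw [← h]; simp
      · have := Real.log_le_sub_one_of_pos h
        linarith
    have h3 : phi α w ≤ 4 * α := by
      have : logPlus ‖w‖ ^ 2 ≤ 4 := by nlinarith
      unfold phi; nlinarith
    have h4 : 0 ≤ phi α z := by unfold phi; positivity
    have : 1 ≤ Real.exp (4 * α) * Real.exp (phi α z) * Real.exp (-(phi α w)) := by
      rw [← Real.exp_add, ← Real.exp_add]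
      apply Real.one_le_exp; linarith
    nlinarith [norm_nonneg (f w)]
  · have hz0 : z ≠ 0 := by rintro rfl; norm_num at hz
    have hre : ∀ w ∈ Metric.ball z (‖z‖ / 2), ‖w / z - 1‖ < 1 / 2 := by
      intro w hw
      rw [mem_ball_iff_norm] at hw
      have : w / z - 1 = (w - z) / z := by field_simp
      rw [this, norm_div, div_lt_iff₀ (by linarith)]
      linarith
    refine ⟨‖z‖ / 2, fun w => f w * Complex.exp (((-(2 * α * Real.log ‖z‖) : ℝ) : ℂ) *
      Complex.log (w / z)), by linarith, ?_, by simp [hz0], fun w hw => ?_⟩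
    · refine hf.differentiableOn.mul ?_
      apply DifferentiableOn.cexp
      apply DifferentiableOn.const_mul
      apply DifferentiableOn.clog (by fun_prop)
      intro w hw
      left
      have h := (abs_le.1 (Complex.abs_re_le_norm (w / z - 1))).1
      have h' := hre w hw
      simp only [sub_re, one_re] at h
      linarith
    · have h1 := hre w hw
      have hq1 : 1 / 2 ≤ ‖w / z‖ := by
        have := norm_sub_norm_le 1 (w / z)
        rw [norm_sub_rev, norm_one] at this; linarith
      have hq2 : ‖w / z‖ ≤ 3 / 2 := by
        have := norm_sub_norm_le (w / z) 1
        rw [norm_one] at this; linarith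
      have ha1 : Real.log ‖w / z‖ ≤ 1 := by
        have := Real.log_le_sub_one_of_pos (x := ‖w / z‖) (by linarith)
        linarith
      have ha2 : -1 ≤ Real.log ‖w / z‖ := by
        have := Real.one_sub_inv_le_log_of_pos (x := ‖w / z‖) (by linarith)
        have h5 : ‖w / z‖⁻¹ ≤ 2 := by
          rw [inv_le_comm₀ (by linarith) (by norm_num)]; linarith
        linarith
      have hw1 : 1 ≤ ‖w‖ := by
        rw [norm_div, le_div_iff₀ (by linarith)] at hq1
        linarith
      have hlog : Real.log ‖w / z‖ = Real.log ‖w‖ - Real.log ‖z‖ := by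
        rw [norm_div, Real.log_div (by linarith) (by linarith)]
      have hpz : phi α z = α * Real.log ‖z‖ ^ 2 := by
        rw [phi, logPlus, max_eq_left (Real.log_nonneg (by linarith))]
      have hpw : phi α w = α * Real.log ‖w‖ ^ 2 := by
        rw [phi, logPlus, max_eq_left (Real.log_nonneg (by linarith))]
      rw [norm_mul, Complex.norm_exp, Complex.re_ofReal_mul, Complex.log_re, mul_left_comm]
      apply mul_le_mul_of_nonneg_left _ (norm_nonneg _)
      rw [← Real.exp_add, ← Real.exp_add]
      apply Real.exp_le_exp.2
      rw [hpz, hpw]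
      rw [hlog] at ha1 ha2 ⊢
      have : (Real.log ‖w‖ - Real.log ‖z‖) ^ 2 ≤ 1 := by nlinarith
      nlinarith

/-- there is a constant `C ≥ 1` such that for every `f ∈ F^p_φ` and `z ∈ ℂ`,
`|f(z)| ≤ C (1+|z|)^{-2/p} e^{φ(z)} ‖f‖_{p,φ}`; in particular each point evaluation is a
bounded linear functional on `F^p_φ`. -/
theorem statement5 (α p : ℝ) (hα : 0 < α) (hp : 1 ≤ p) :
    ∃ C : ℝ, 1 ≤ C ∧ ∀ f : ℂ → ℂ, MemFock α p f → ∀ z : ℂ,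
      ‖f z‖ ≤
        C * (1 + ‖z‖) ^ (-(2 / p)) * Real.exp (phi α z) *
          ((fockNormP α p f).toReal) ^ (1 / p) := by
  have hp0 : 0 < p := by linarith
  have hK : 1 ≤ Real.exp (4 * α) := Real.one_le_exp (by linarith)
  refine ⟨9 * Real.exp (4 * α), by linarith, ?_⟩
  rintro f ⟨hf, hN⟩ z
  obtain ⟨r, g, hr, hg, hgz, hb⟩ := local_model α hα f hf z
  have hz0 := norm_nonneg z
  have hr0 : 0 < r := by linarith
  have h1 := area_mv_p p hp g z r hr0 hg
  set K := Real.exp (4 * α) * Real.exp (phi α z) with hKdef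
  have hK0 : 0 < K := by positivity
  have h2 : ∫⁻ w in Metric.ball z r, ‖g w‖ₑ ^ p ≤ ENNReal.ofReal (K ^ p) * fockNormP α p f := by
    unfold fockNormP
    rw [← lintegral_const_mul' _ _ ENNReal.ofReal_ne_top]
    refine (setLIntegral_mono' Metric.isOpen_ball.measurableSet ?_).trans
      (setLIntegral_le_lintegral (Metric.ball z r) _)
    intro w hw
    rw [← ofReal_norm, ENNReal.ofReal_rpow_of_nonneg (norm_nonneg _) hp0.le,
      ← ENNReal.ofReal_mul (by positivity), ← Real.mul_rpow hK0.le (by positivity)]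
    exact ENNReal.ofReal_le_ofReal (Real.rpow_le_rpow (norm_nonneg _) (hb w hw) hp0.le)
  have h3 := ENNReal.toReal_mono (ENNReal.mul_ne_top ENNReal.ofReal_ne_top hN.ne) (h1.trans h2)
  rw [hgz, ENNReal.toReal_mul, ENNReal.toReal_mul, ← ENNReal.toReal_rpow, toReal_enorm,
    ENNReal.toReal_ofReal (by positivity), Complex.volume_ball] at h3
  have hvol : (ENNReal.ofReal r ^ 2 * (NNReal.pi : ℝ≥0∞)).toReal = r ^ 2 * Real.pi := by
    simp [ENNReal.toReal_mul, hr0.le]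
  rw [hvol] at h3
  set N := (fockNormP α p f).toReal with hNdef
  have hN0 : 0 ≤ N := ENNReal.toReal_nonneg
  have h4 : (1 + ‖z‖) ^ 2 / 9 ≤ r ^ 2 * Real.pi := by
    have : (1 + ‖z‖) ^ 2 / 9 ≤ r ^ 2 := by nlinarith
    nlinarith [Real.pi_gt_three, sq_nonneg r]
  have h5 : ‖f z‖ ^ p * ((1 + ‖z‖) ^ 2 / 9) ≤ K ^ p * N :=
    (mul_le_mul_of_nonneg_left h4 (by positivity)).trans h3
  have hs : 0 < 1 + ‖z‖ := by linarith
  have h6 : ‖f z‖ ^ p ≤ 9 * (1 + ‖z‖) ^ (-2 : ℝ) * K ^ p * N := by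
    have e : (1 + ‖z‖) ^ (-2 : ℝ) = ((1 + ‖z‖) ^ 2)⁻¹ := by
      rw [Real.rpow_neg hs.le]; norm_num
    rw [e]
    have : ‖f z‖ ^ p ≤ (K ^ p * N) / ((1 + ‖z‖) ^ 2 / 9) := (le_div_iff₀ (by positivity)).2 h5
    refine this.trans (le_of_eq ?_)
    field_simp
  have h7 := Real.rpow_le_rpow (by positivity) h6 (by positivity : 0 ≤ 1 / p)
  rw [← Real.rpow_mul (norm_nonneg _), mul_one_div_cancel hp0.ne', Real.rpow_one,
    Real.mul_rpow (by positivity) hN0, Real.mul_rpow (by positivity) (by positivity),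
    Real.mul_rpow (by positivity) (by positivity), ← Real.rpow_mul hs.le, ← Real.rpow_mul hK0.le,
    mul_one_div_cancel hp0.ne', Real.rpow_one] at h7
  have h9 : (9 : ℝ) ^ (1 / p) ≤ 9 := by
    calc (9 : ℝ) ^ (1 / p) ≤ 9 ^ (1 : ℝ) :=
          Real.rpow_le_rpow_of_exponent_le (by norm_num) (by rw [div_le_one hp0]; exact hp)
      _ = 9 := Real.rpow_one 9
  have he : (-2 : ℝ) * (1 / p) = -(2 / p) := by ring
  rw [he] at h7
  refine h7.trans ?_
  calc (9 : ℝ) ^ (1 / p) * (1 + ‖z‖) ^ (-(2 / p)) * K * N ^ (1 / p)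
      ≤ 9 * (1 + ‖z‖) ^ (-(2 / p)) * K * N ^ (1 / p) := by gcongr
    _ = _ := by rw [hKdef]; ring

end
end
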